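/- Low-temperature restricted dynamics mixing time: if β > 1, then there exist constants C₃(β), C₄(β) > 0 depending only on β such that for all n, the mixing time of the restricted Glauber dynamics for the Curie-Weiss Ising model on K_n satisfies C₃(β)·n·log n ≤ t_mix(n) ≤ C₄(β)·n·log n. -/

import Mathlib

open Filter Real

namespace CW

/-- Configurations of the Curie-Weiss model on `n` vertices:
`true` encodes spin `+1` and `false` encodes spin `-1`. -/
abbrev Config (n : ℕ) := Fin n → Bool

noncomputable section

/-- The spin (±1) at site `i`. -/
def spin {n : ℕ} (σ : Config n) (i : Fin n) : ℝ := if σ i then 1 else -1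

/-- Normalized magnetization `S(σ) = n⁻¹ ∑ᵢ σ(i)`. -/
def mag {n : ℕ} (σ : Config n) : ℝ := (∑ i, spin σ i) / n

/-- `p₊(s) = (1 + tanh(βs))/2`. -/
def pPlus (β s : ℝ) : ℝ := (1 + Real.tanh (β * s)) / 2

/-- One-step transition kernel of the Glauber dynamics for the Curie-Weiss
model: a uniformly chosen site `i` is refreshed, becoming `+1` with
probability `p₊(S(σ) - σ(i)/n)`. -/
def glauberKernel (β : ℝ) (n : ℕ) (σ η : Config n) : ℝ :=
  (1 / n) * ∑ i : Fin n,
    if ∀ j, j ≠ i → η j = σ j then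
      (if η i then pPlus β (mag σ - spin σ i / n)
       else 1 - pPlus β (mag σ - spin σ i / n))
    else 0

/-- Law of the Glauber dynamics at time `t` started from `σ`. -/
def glauberLaw (β : ℝ) (n : ℕ) : ℕ → Config n → Config n → ℝ
  | 0, σ, η => if η = σ then 1 else 0
  | t + 1, σ, η => ∑ τ : Config n, glauberLaw β n t σ τ * glauberKernel β n τ η

/-- The (normalized) exponent in the Curie-Weiss measure. -/
def cwExponent {n : ℕ} (β : ℝ) (σ : Config n) : ℝ :=
  (β / n) * ∑ i : Fin n, ∑ j : Fin n, if i < j then spin σ i * spin σ j else 0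

/-- The Curie-Weiss (mean-field Ising) probability measure
`μ(σ) = Z(β)⁻¹ exp((β/n) ∑_{i<j} σ(i)σ(j))`. -/
def cwMeasure (β : ℝ) (n : ℕ) (σ : Config n) : ℝ :=
  Real.exp (cwExponent β σ) / ∑ η : Config n, Real.exp (cwExponent β η)

/-- Total variation distance between two (discrete) distributions. -/
def tvDist {Ω : Type*} [Fintype Ω] (μ ν : Ω → ℝ) : ℝ :=
  (∑ x, |μ x - ν x|) / 2

/-- Worst-case total variation distance to stationarity at time `t`. -/
def glauberDist (β : ℝ) (n t : ℕ) : ℝ :=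
  ⨆ σ : Config n, tvDist (glauberLaw β n t σ) (cwMeasure β n)

/-- The global spin flip `σ ↦ -σ`. -/
def negConfig {n : ℕ} (σ : Config n) : Config n := fun i => !(σ i)

/-- Transition kernel of the Glauber dynamics restricted to the set
`Ω⁺ = {σ : S(σ) ≥ 0}`: a candidate move `η'` is generated by the Glauber
dynamics; if `S(η') ≥ 0` the chain moves to `η'`, otherwise it moves
to `-η'`. -/
def rKernel (β : ℝ) (n : ℕ) (σ η : Config n) : ℝ :=
  (if 0 ≤ mag η then glauberKernel β n σ η else 0) +
    (if mag (negConfig η) < 0 then glauberKernel β n σ (negConfig η) else 0)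

/-- Law of the restricted Glauber dynamics at time `t` started from `σ`. -/
def rLaw (β : ℝ) (n : ℕ) : ℕ → Config n → Config n → ℝ
  | 0, σ, η => if η = σ then 1 else 0
  | t + 1, σ, η => ∑ τ : Config n, rLaw β n t σ τ * rKernel β n τ η

/-- The stationary distribution `μ⁺` of the restricted dynamics: the image of
the Curie-Weiss measure `μ` under the folding map `σ ↦ σ` if `S(σ) ≥ 0`,
`σ ↦ -σ` otherwise. -/
def muPlus (β : ℝ) (n : ℕ) (η : Config n) : ℝ :=
  ∑ σ : Config n,
    if (if 0 ≤ mag σ then σ else negConfig σ) = η then cwMeasure β n σ else 0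

/-- Worst-case total variation distance to stationarity for the restricted
dynamics, the maximum being over starting states in `Ω⁺`. -/
def rDist (β : ℝ) (n t : ℕ) : ℝ :=
  ⨆ σ : {σ : Config n // 0 ≤ mag σ}, tvDist (rLaw β n t σ.1) (muPlus β n)

/-- Mixing time of the restricted Glauber dynamics. -/
def rTMix (β : ℝ) (n : ℕ) : ℕ := sInf {t | rDist β n t ≤ 1 / 4}

theorem hasDerivAt_tanh (x : ℝ) : HasDerivAt tanh (1 - tanh x ^ 2) x := by
  have h : HasDerivAt (fun y => sinh y / cosh y) _ x :=
    (hasDerivAt_sinh x).div (hasDerivAt_cosh x) (cosh_pos x).ne'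
  have e : (fun y => sinh y / cosh y) = tanh := by
    ext y; rw [tanh_eq_sinh_div_cosh]
  rw [e] at h
  convert h using 1
  rw [tanh_eq_sinh_div_cosh]
  have := (cosh_pos x).ne'
  field_simp

theorem continuous_tanh : Continuous tanh :=
  continuous_iff_continuousAt.2 fun x => (hasDerivAt_tanh x).continuousAt

theorem strictMono_tanh : StrictMono tanh :=
  strictMono_of_deriv_pos fun x => by
    rw [(hasDerivAt_tanh x).deriv]; linarith [tanh_sq_lt_one x]

theorem tanh_nonneg {x : ℝ} (hx : 0 ≤ x) : 0 ≤ tanh x := by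
  rw [← tanh_zero]; exact strictMono_tanh.monotone hx

theorem mul_one_sub_tanh_sq_lt {x : ℝ} (hx : 0 < x) : x * (1 - tanh x ^ 2) < tanh x := by
  have h1 : x < sinh x := self_lt_sinh_iff.2 hx
  have h2 : 1 ≤ cosh x := one_le_cosh x
  have h3 := cosh_sq x
  have hc := cosh_pos x
  rw [tanh_eq_sinh_div_cosh]
  have e : x * (1 - (sinh x / cosh x) ^ 2) = x / cosh x ^ 2 := by
    field_simp
    rw [h3]; ring
  rw [e, div_lt_div_iff₀ (by positivity) hc]
  nlinarith [mul_pos hx hc, mul_lt_mul_of_pos_right h1 hc,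
    mul_le_mul_of_nonneg_left h2 (mul_nonneg (hx.le.trans h1.le) hc.le)]

theorem tanh_le_self {x : ℝ} (hx : 0 ≤ x) : tanh x ≤ x := by
  have hanti : AntitoneOn (fun y => tanh y - y) (Set.Ici 0) := by
    refine antitoneOn_of_deriv_nonpos (convex_Ici 0)
      (continuous_tanh.sub continuous_id).continuousOn
      (fun y _ => ((hasDerivAt_tanh y).sub (hasDerivAt_id y)).differentiableAt.differentiableWithinAt)
      fun y _ => ?_
    have := ((hasDerivAt_tanh y).sub (hasDerivAt_id' y)).deriv
    simp only [Pi.sub_def] at this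
    rw [this]
    nlinarith [sq_nonneg (tanh y)]
  have := hanti (Set.mem_Ici.2 le_rfl) (Set.mem_Ici.2 hx) hx
  simp at this
  linarith

theorem abs_tanh_sub_le (x y : ℝ) : |tanh x - tanh y| ≤ |x - y| := by
  have := Convex.norm_image_sub_le_of_norm_hasDerivWithin_le (f := tanh) (C := 1)
    (s := Set.univ) (x := y) (y := x) (fun z _ => (hasDerivAt_tanh z).hasDerivWithinAt)
    (fun z _ => by
      rw [Real.norm_eq_abs, abs_le]
      constructor <;> nlinarith [sq_nonneg (tanh z), tanh_sq_lt_one z]) convex_univ trivial trivial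
  simpa using this

theorem tanh_add (x y : ℝ) :
    tanh (x + y) = (tanh x + tanh y) / (1 + tanh x * tanh y) := by
  have hx := (cosh_pos x).ne'
  have hy := (cosh_pos y).ne'
  have hxy := (cosh_pos (x + y)).ne'
  have h : 1 + tanh x * tanh y = cosh (x + y) / (cosh x * cosh y) := by
    rw [cosh_add, tanh_eq_sinh_div_cosh, tanh_eq_sinh_div_cosh]; field_simp
  rw [h, tanh_eq_sinh_div_cosh (x + y), sinh_add, tanh_eq_sinh_div_cosh, tanh_eq_sinh_div_cosh]
  field_simp

theorem tanh_sub (x y : ℝ) :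
    tanh (x - y) = (tanh x - tanh y) / (1 - tanh x * tanh y) := by
  rw [sub_eq_add_neg, tanh_add, tanh_neg]; ring

theorem one_sub_mul_tanh_sq_pos (x y : ℝ) : 0 < 1 - tanh x ^ 2 * tanh y ^ 2 := by
  nlinarith [tanh_sq_lt_one x, tanh_sq_lt_one y, sq_nonneg (tanh x), sq_nonneg (tanh y)]

theorem one_add_tanh_mul_pos (x y : ℝ) : 0 < 1 + tanh x * tanh y := by
  nlinarith [tanh_lt_one x, tanh_lt_one y, neg_one_lt_tanh x, neg_one_lt_tanh y]

theorem one_sub_tanh_mul_pos (x y : ℝ) : 0 < 1 - tanh x * tanh y := by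
  have := one_add_tanh_mul_pos x (-y); rw [tanh_neg] at this; linarith

theorem tanh_add_add_tanh_sub (x y : ℝ) : tanh (x + y) + tanh (x - y) =
    2 * tanh x * (1 - tanh y ^ 2) / (1 - tanh x ^ 2 * tanh y ^ 2) := by
  rw [tanh_add, tanh_sub]
  have h1 := (one_add_tanh_mul_pos x y).ne'
  have h2 := (one_sub_tanh_mul_pos x y).ne'
  have h3 := (one_sub_mul_tanh_sq_pos x y).ne'
  rw [div_add_div _ _ h1 h2, div_eq_div_iff (mul_ne_zero h1 h2) h3]
  ring

theorem tanh_add_sub_tanh_sub (x y : ℝ) : tanh (x + y) - tanh (x - y) =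
    2 * tanh y * (1 - tanh x ^ 2) / (1 - tanh x ^ 2 * tanh y ^ 2) := by
  rw [tanh_add, tanh_sub]
  have h1 := (one_add_tanh_mul_pos x y).ne'
  have h2 := (one_sub_tanh_mul_pos x y).ne'
  have h3 := (one_sub_mul_tanh_sq_pos x y).ne'
  rw [div_sub_div _ _ h1 h2, div_eq_div_iff (mul_ne_zero h1 h2) h3]
  ring

theorem tanh_add_add_tanh_sub_le {x : ℝ} (hx : 0 ≤ x) (y : ℝ) :
    tanh (x + y) + tanh (x - y) ≤ 2 * tanh x := by
  rw [tanh_add_add_tanh_sub, div_le_iff₀ (one_sub_mul_tanh_sq_pos x y)]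
  have h := tanh_nonneg hx
  have : 0 ≤ tanh x * (tanh y ^ 2 * (1 - tanh x ^ 2)) :=
    mul_nonneg h (mul_nonneg (sq_nonneg _) (by linarith [tanh_sq_lt_one x]))
  nlinarith

theorem le_tanh_add_add_tanh_sub {x : ℝ} (hx : 0 ≤ x) (y : ℝ) :
    2 * tanh x * (1 - y ^ 2) ≤ tanh (x + y) + tanh (x - y) := by
  rw [tanh_add_add_tanh_sub, le_div_iff₀ (one_sub_mul_tanh_sq_pos x y)]
  have h := tanh_nonneg hx
  have hy : tanh y ^ 2 ≤ y ^ 2 := by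
    rw [sq_le_sq]; simpa using abs_tanh_sub_le y 0
  by_cases hy1 : y ^ 2 ≤ 1
  · have h5 : (1 - y ^ 2) * (1 - tanh x ^ 2 * tanh y ^ 2) ≤ 1 - tanh y ^ 2 := by
      nlinarith [mul_nonneg (sq_nonneg (tanh x)) (sq_nonneg (tanh y))]
    nlinarith [mul_le_mul_of_nonneg_left h5 h]
  · have h5 : (1 - y ^ 2) * (1 - tanh x ^ 2 * tanh y ^ 2) ≤ 0 :=
      mul_nonpos_of_nonpos_of_nonneg (by linarith) (one_sub_mul_tanh_sq_pos x y).le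
    nlinarith [mul_nonneg h (sub_nonneg.2 (tanh_sq_lt_one y).le),
      mul_nonneg h (neg_nonneg.2 h5)]

theorem tanh_add_sub_tanh_sub_le (x : ℝ) {y : ℝ} (hy : 0 ≤ y) (hy1 : y ≤ 1 / 2) :
    tanh (x + y) - tanh (x - y) ≤ 2 * y * (1 - tanh x ^ 2) * (1 + 2 * y ^ 2) := by
  rw [tanh_add_sub_tanh_sub, div_le_iff₀ (one_sub_mul_tanh_sq_pos x y)]
  have hu := tanh_le_self hy
  have hu0 := tanh_nonneg hy
  have ht := tanh_sq_lt_one x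
  have hu2 : tanh y ^ 2 ≤ y ^ 2 := by nlinarith
  have h1 : 1 ≤ (1 + 2 * y ^ 2) * (1 - tanh x ^ 2 * tanh y ^ 2) := by
    have : tanh x ^ 2 * tanh y ^ 2 ≤ y ^ 2 := by nlinarith [sq_nonneg (tanh y)]
    have hy2 : y ^ 2 ≤ 1 / 4 := by nlinarith
    nlinarith [mul_le_mul_of_nonneg_left this (by positivity : 0 ≤ 1 + 2 * y ^ 2), sq_nonneg y]
  have h2 : tanh y * (1 - tanh x ^ 2) ≤ y * (1 - tanh x ^ 2) :=
    mul_le_mul_of_nonneg_right hu (by linarith)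
  have h3 : 0 ≤ y * (1 - tanh x ^ 2) := mul_nonneg hy (by linarith)
  nlinarith [mul_le_mul_of_nonneg_left h1 h3]

/-- The drift of the magnetization divided by the magnetization. -/
def relDrift (β s : ℝ) : ℝ := tanh (β * s) / s - 1

/-- The derivative of the drift `tanh (β s) - s`. -/
def driftDeriv (β s : ℝ) : ℝ := β * (1 - tanh (β * s) ^ 2) - 1

theorem driftDeriv_lt_relDrift {β s : ℝ} (hβ : 0 < β) (hs : 0 < s) :
    driftDeriv β s < relDrift β s := by
  have := mul_one_sub_tanh_sq_lt (mul_pos hβ hs)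
  rw [driftDeriv, relDrift, sub_lt_sub_iff_right, lt_div_iff₀ hs]
  linarith

theorem strictAntiOn_relDrift {β : ℝ} (hβ : 0 < β) :
    StrictAntiOn (relDrift β) (Set.Ioi 0) := by
  have hd : ∀ s : ℝ, 0 < s → HasDerivAt (relDrift β)
      ((driftDeriv β s - relDrift β s) / s) s := by
    intro s hs
    have h1 : HasDerivAt (fun s => tanh (β * s)) ((1 - tanh (β * s) ^ 2) * (β * 1)) s :=
      (hasDerivAt_tanh (β * s)).comp s ((hasDerivAt_id s).const_mul β)
    have h2 := (h1.div (hasDerivAt_id s) hs.ne').sub_const 1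
    refine h2.congr_deriv ?_
    unfold driftDeriv relDrift
    simp only [id]
    field_simp
    ring
  refine strictAntiOn_of_deriv_neg (convex_Ioi 0)
    (fun s hs => (hd s hs).continuousAt.continuousWithinAt) fun s hs => ?_
  rw [interior_Ioi] at hs
  rw [(hd s hs).deriv]
  exact div_neg_of_neg_of_pos (by linarith [driftDeriv_lt_relDrift hβ hs]) hs

theorem relDrift_le {β s : ℝ} (hβ : 0 < β) (hs : 0 < s) : relDrift β s ≤ β - 1 := by
  rw [relDrift, sub_le_sub_iff_right, div_le_iff₀ hs]
  exact tanh_le_self (mul_pos hβ hs).le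

theorem neg_one_le_relDrift {β s : ℝ} (hβ : 0 < β) (hs : 0 < s) : -1 ≤ relDrift β s := by
  have : 0 ≤ tanh (β * s) / s := div_nonneg (tanh_nonneg (mul_pos hβ hs).le) hs.le
  rw [relDrift]; linarith

theorem driftDeriv_le {β s : ℝ} (hβ : 0 < β) : driftDeriv β s ≤ β - 1 := by
  rw [driftDeriv]; nlinarith [sq_nonneg (tanh (β * s))]

theorem driftDeriv_anti {β s t : ℝ} (hβ : 0 < β) (hs : 0 ≤ s) (hst : s ≤ t) :
    driftDeriv β t ≤ driftDeriv β s := by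
  have h0 : 0 ≤ tanh (β * s) := tanh_nonneg (mul_nonneg hβ.le hs)
  have h1 : tanh (β * s) ≤ tanh (β * t) :=
    strictMono_tanh.monotone (mul_le_mul_of_nonneg_left hst hβ.le)
  rw [driftDeriv, driftDeriv]
  nlinarith [mul_nonneg hβ.le (sub_nonneg.2 (pow_le_pow_left₀ h0 h1 2))]

theorem continuous_driftDeriv (β : ℝ) : Continuous (driftDeriv β) := by
  unfold driftDeriv
  have := continuous_tanh.comp (continuous_const.mul continuous_id : Continuous fun s : ℝ => β * s)
  exact (continuous_const.mul (continuous_const.sub (this.pow 2))).sub continuous_const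

theorem tendsto_relDrift (β : ℝ) :
    Tendsto (relDrift β) (nhdsWithin 0 (Set.Ioi 0)) (nhds (β - 1)) := by
  have h1 : HasDerivAt (fun s => tanh (β * s)) ((1 - tanh (β * 0) ^ 2) * (β * 1)) 0 :=
    (hasDerivAt_tanh (β * 0)).comp 0 ((hasDerivAt_id (0:ℝ)).const_mul β)
  have h2 := hasDerivAt_iff_tendsto_slope_zero.1 h1
  have h3 := (h2.mono_left (nhdsWithin_mono 0 (s := Set.Ioi 0) (fun x hx => ne_of_gt hx))).sub_const 1
  simp only [mul_zero, tanh_zero, zero_add, smul_eq_mul] at h3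
  refine (h3.congr fun s => ?_).trans (by norm_num)
  simp [relDrift]; ring

theorem exists_drift_bounds {β : ℝ} (hβ : 1 < β) : ∃ s₀ s₁ s₂ c₀ y₁ : ℝ,
    0 < s₀ ∧ 0 < s₁ ∧ s₁ < s₂ ∧ s₂ < 1 ∧ 0 < c₀ ∧ 0 < y₁ ∧
    (∀ s, 0 < s → s ≤ s₀ → 9 / 10 * (β - 1) ≤ relDrift β s ∧ s * tanh (β * s) ≤ 1 / 10) ∧
    (∀ s, 0 < s → s ≤ s₁ → y₁ ≤ relDrift β s) ∧
    (∀ s, 0 < s → s ≤ s₂ → 0 ≤ relDrift β s) ∧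
    (∀ s, s₂ ≤ s → relDrift β s ≤ 0) ∧
    (∀ s, s₁ ≤ s → driftDeriv β s ≤ -c₀) := by
  have hβ0 : 0 < β := by linarith
  have hev : ∀ᶠ s in nhdsWithin (0:ℝ) (Set.Ioi 0), 9 / 10 * (β - 1) < relDrift β s :=
    (tendsto_relDrift β).eventually (lt_mem_nhds (by linarith))
  have hmem : ∀ᶠ s in nhdsWithin (0:ℝ) (Set.Ioi 0), s ∈ Set.Ioo (0:ℝ) (1 / 10) :=
    Ioo_mem_nhdsGT (by norm_num)
  obtain ⟨s₀, h1, h2, h3⟩ := (hev.and hmem).exists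
  have hanti := strictAntiOn_relDrift hβ0
  have hcont : ContinuousOn (relDrift β) (Set.Icc s₀ 1) := by
    intro s hs
    have : s ≠ 0 := by linarith [hs.1]
    unfold relDrift
    refine ContinuousAt.continuousWithinAt ?_
    have h : ContinuousAt (fun s : ℝ => tanh (β * s)) s :=
      (continuous_tanh.comp (continuous_const.mul continuous_id)).continuousAt
    exact (h.div continuousAt_id this).sub continuousAt_const
  have hneg : relDrift β 1 < 0 := by
    simp only [relDrift, div_one]; linarith [tanh_lt_one (β * 1)]
  have hpos : 0 < relDrift β s₀ := by linarith
  obtain ⟨s₂, ⟨h4, h5⟩, h6⟩ := intermediate_value_Icc' (by linarith) hcont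
    (show (0:ℝ) ∈ Set.Icc (relDrift β 1) (relDrift β s₀) from ⟨hneg.le, hpos.le⟩)
  have h5' : s₂ < 1 := lt_of_le_of_ne h5 (by rintro rfl; linarith)
  have h4' : s₀ < s₂ := lt_of_le_of_ne h4 (by rintro rfl; linarith)
  have hs2 : 0 < s₂ := by linarith
  have hd : driftDeriv β s₂ < 0 := by linarith [driftDeriv_lt_relDrift hβ0 hs2]
  have hev2 : ∀ᶠ s in nhdsWithin s₂ (Set.Iio s₂), driftDeriv β s < 0 :=
    ((continuous_driftDeriv β).continuousAt.eventually (gt_mem_nhds hd)).filter_mono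
      nhdsWithin_le_nhds
  have hmem2 : ∀ᶠ s in nhdsWithin s₂ (Set.Iio s₂), s ∈ Set.Ioo (0:ℝ) s₂ :=
    Ioo_mem_nhdsLT hs2
  obtain ⟨s₁, h7, h8, h9⟩ := (hev2.and hmem2).exists
  refine ⟨s₀, s₁, s₂, -driftDeriv β s₁, relDrift β s₁, h2, h8, h9, h5', by linarith, ?_, ?_, ?_,
    ?_, ?_, ?_⟩
  · have := hanti (Set.mem_Ioi.2 h8) (Set.mem_Ioi.2 hs2) h9
    linarith
  · intro s hs hs'
    refine ⟨h1.le.trans (hanti.antitoneOn (Set.mem_Ioi.2 hs) (Set.mem_Ioi.2 h2) hs'), ?_⟩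
    have := tanh_lt_one (β * s)
    nlinarith
  · intro s hs hs'
    exact hanti.antitoneOn (Set.mem_Ioi.2 hs) (Set.mem_Ioi.2 h8) hs'
  · intro s hs hs'
    rw [← h6]
    exact hanti.antitoneOn (Set.mem_Ioi.2 hs) (Set.mem_Ioi.2 hs2) hs'
  · intro s hs
    rw [← h6]
    exact hanti.antitoneOn (Set.mem_Ioi.2 hs2) (Set.mem_Ioi.2 (hs2.trans_le hs)) hs
  · intro s hs
    simpa using driftDeriv_anti hβ0 h8.le hs

theorem exists_inv_pow_taylor (p : ℕ) : ∃ C : ℝ, 0 ≤ C ∧ ∀ x : ℝ, |x| ≤ 1 / 2 →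
    |((1 + x) ^ p)⁻¹ - (1 - p * x + p * (p + 1) / 2 * x ^ 2)| ≤ C * |x| ^ 3 := by
  induction p with
  | zero => exact ⟨0, le_rfl, fun x _ => by simp⟩
  | succ p ih =>
    obtain ⟨C, hC, h⟩ := ih
    refine ⟨2 * (C + (p + 1) * (p + 2) / 2), by positivity, fun x hx => ?_⟩
    have hx1 : 1 / 2 ≤ 1 + x := by linarith [(abs_le.1 hx).1]
    have hne : 1 + x ≠ 0 := by linarith
    have key : ((1 + x) ^ (p + 1))⁻¹ -
        (1 - (p + 1 : ℕ) * x + (p + 1 : ℕ) * ((p + 1 : ℕ) + 1) / 2 * x ^ 2) =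
        (1 + x)⁻¹ * ((((1 + x) ^ p)⁻¹ - (1 - p * x + p * (p + 1) / 2 * x ^ 2)) -
          (p + 1) * (p + 2) / 2 * x ^ 3) := by
      have hp : (1 + x) ^ p ≠ 0 := pow_ne_zero _ hne
      rw [pow_succ]
      push_cast
      field_simp
      ring
    rw [key, abs_mul]
    have h1 : |(1 + x)⁻¹| ≤ 2 := by
      rw [abs_of_pos (inv_pos.2 (by linarith))]
      exact inv_le_of_inv_le₀ (by norm_num) (by linarith)
    have h2 : |(((1 + x) ^ p)⁻¹ - (1 - p * x + p * (p + 1) / 2 * x ^ 2)) -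
        ((p : ℝ) + 1) * (p + 2) / 2 * x ^ 3| ≤ (C + (p + 1) * (p + 2) / 2) * |x| ^ 3 := by
      refine (abs_sub _ _).trans ?_
      have : |((p : ℝ) + 1) * (p + 2) / 2 * x ^ 3| = (p + 1) * (p + 2) / 2 * |x| ^ 3 := by
        rw [abs_mul, abs_of_nonneg (by positivity), abs_pow]
      rw [this]
      linarith [h x hx]
    calc _ ≤ 2 * ((C + (p + 1) * (p + 2) / 2) * |x| ^ 3) :=
          mul_le_mul h1 h2 (abs_nonneg _) (by norm_num)
      _ = _ := by ring

/-- Rate (up to a factor `4`) at which the upper end of an edge with midpoint `s` moves up. -/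
def upRate (β h s : ℝ) : ℝ := (1 - s - h / 2) * (1 + tanh (β * (s + h)))

/-- Rate (up to a factor `4`) at which the lower end of an edge with midpoint `s` moves down. -/
def downRate (β h s : ℝ) : ℝ := (1 + s - h / 2) * (1 - tanh (β * (s - h)))

set_option maxHeartbeats 1000000 in
theorem rate_bounds {β : ℝ} (hβ : 1 < β) {h s : ℝ} (hh : 0 < h) (hh1 : h ≤ 1)
    (hβh : β * h ≤ 1 / 2) (hs : 0 < s) (hs1 : s ≤ 1) :
    upRate β h s + downRate β h s ≤ 2 + h - 2 * s * tanh (β * s) + 2 * h * driftDeriv β s +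
      (4 * β ^ 3 + 2 * β ^ 2) * h ^ 2 ∧
    |(upRate β h s + downRate β h s) / 2 - (1 - s * tanh (β * s))| ≤ (1 + 3 * β + β ^ 2) * h ∧
    |(upRate β h s - downRate β h s) / (2 * s) - relDrift β s| ≤ (2 * β ^ 3 + 4 * β) * h ∧
    |upRate β h s| ≤ 4 ∧ |downRate β h s| ≤ 4 := by
  have hβ0 : 0 < β := by linarith
  set T := tanh (β * s) with hT
  set Tp := tanh (β * (s + h)) with hTp
  set Tm := tanh (β * (s - h)) with hTm
  have hT0 : 0 ≤ T := tanh_nonneg (by positivity)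
  have hT1 : T < 1 := tanh_lt_one _
  have hTs : T ≤ β * s := tanh_le_self (by positivity)
  have hTp1 : Tp < 1 := tanh_lt_one _
  have hTp2 : -1 < Tp := neg_one_lt_tanh _
  have hTm1 : Tm < 1 := tanh_lt_one _
  have hTm2 : -1 < Tm := neg_one_lt_tanh _
  have hS1 : Tp + Tm ≤ 2 * T := by
    have := tanh_add_add_tanh_sub_le (x := β * s) (by positivity) (β * h)
    rwa [← mul_add, ← mul_sub] at this
  have hS2 : 2 * T * (1 - (β * h) ^ 2) ≤ Tp + Tm := by
    have := le_tanh_add_add_tanh_sub (x := β * s) (by positivity) (β * h)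
    rwa [← mul_add, ← mul_sub] at this
  have hD1 : Tp - Tm ≤ 2 * (β * h) * (1 - T ^ 2) * (1 + 2 * (β * h) ^ 2) := by
    have := tanh_add_sub_tanh_sub_le (β * s) (y := β * h) (by positivity) hβh
    rwa [← mul_add, ← mul_sub] at this
  have hD0 : 0 ≤ Tp - Tm := by
    have : Tm ≤ Tp := strictMono_tanh.monotone (by nlinarith)
    linarith
  have hT2 : 0 ≤ 1 - T ^ 2 := by nlinarith
  have hbh : 0 < β * h := by positivity
  have hbh2 : (β * h) ^ 2 ≤ 1 / 4 := by nlinarith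
  have hD2 : Tp - Tm ≤ 3 * β * h := by
    have : (1 - T ^ 2) * (1 + 2 * (β * h) ^ 2) ≤ 3 / 2 := by nlinarith [sq_nonneg T]
    nlinarith [mul_le_mul_of_nonneg_left this hbh.le]
  have hsum : upRate β h s + downRate β h s =
      (1 - h / 2) * (2 + (Tp - Tm)) - s * (Tp + Tm) := by
    simp only [upRate, downRate, ← hTp, ← hTm]; ring
  have hdif : upRate β h s - downRate β h s =
      (1 - h / 2) * (Tp + Tm) - 2 * s - s * (Tp - Tm) := by
    simp only [upRate, downRate, ← hTp, ← hTm]; ring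
  have hh2 : h ^ 2 ≤ h := by nlinarith
  have hsT : 0 ≤ s * T := by positivity
  have hsT1 : s * T ≤ 1 := by nlinarith
  have hsS : s * (2 * T * (1 - (β * h) ^ 2)) ≤ s * (Tp + Tm) :=
    mul_le_mul_of_nonneg_left hS2 hs.le
  have hsS' : s * (Tp + Tm) ≤ s * (2 * T) := mul_le_mul_of_nonneg_left hS1 hs.le
  have hTβ : s * T * (β * h) ^ 2 ≤ β ^ 2 * h ^ 2 := by nlinarith [sq_nonneg (β * h)]
  have hhD : 0 ≤ h * (Tp - Tm) := mul_nonneg hh.le hD0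
  have hβ2h : β ^ 2 * h ^ 2 ≤ β ^ 2 * h := mul_le_mul_of_nonneg_left hh2 (by positivity)
  refine ⟨?_, ?_, ?_, ?_, ?_⟩
  · rw [hsum, driftDeriv, ← hT]
    have h3 : (β * h) * (1 - T ^ 2) * (β * h) ^ 2 ≤ β ^ 3 * h ^ 2 := by
      have e1 : (β * h) * (1 - T ^ 2) * (β * h) ^ 2 = β ^ 3 * h ^ 2 * (h * (1 - T ^ 2)) := by ring
      rw [e1]
      have : h * (1 - T ^ 2) ≤ 1 := by nlinarith [sq_nonneg T]
      have hp : 0 ≤ β ^ 3 * h ^ 2 := by positivity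
      exact mul_le_of_le_one_right hp this
    linarith
  · rw [hsum, abs_le]
    have hβh' : 0 ≤ β ^ 2 * h := by positivity
    have hhD1 : h * (Tp - Tm) ≤ Tp - Tm := by nlinarith
    constructor <;> linarith
  · have hYs : relDrift β s = (2 * T - 2 * s) / (2 * s) := by
      rw [relDrift, ← hT]; field_simp
    rw [hYs, ← sub_div, abs_div, abs_of_pos (by positivity : 0 < 2 * s),
      div_le_iff₀ (by positivity), hdif, abs_le]
    have h1 : T * (β * h) ^ 2 ≤ s * β ^ 3 * h := by
      have e1 : (β * h) ^ 2 ≤ β ^ 2 * h := by rw [mul_pow]; exact hβ2h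
      calc T * (β * h) ^ 2 ≤ (β * s) * (β ^ 2 * h) := mul_le_mul hTs e1 (by positivity) (by positivity)
        _ = _ := by ring
    have h2 : h * T ≤ h * (β * s) := mul_le_mul_of_nonneg_left hTs hh.le
    have h4 : s * (Tp - Tm) ≤ s * (3 * β * h) := mul_le_mul_of_nonneg_left hD2 hs.le
    have h5 : 0 ≤ s * (Tp - Tm) := mul_nonneg hs.le hD0
    have h6 : h * (Tp + Tm) ≤ h * (2 * T) := mul_le_mul_of_nonneg_left hS1 hh.le
    have hSpos : 0 ≤ Tp + Tm := le_trans (by nlinarith [mul_nonneg hT0 (sub_nonneg.2 (hbh2.trans (by norm_num : (1:ℝ)/4 ≤ 1)))]) hS2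
    have h7 : 0 ≤ h * (Tp + Tm) := mul_nonneg hh.le hSpos
    have h8 : 0 ≤ s * β ^ 3 * h := by positivity
    have h9 : 0 ≤ s * β * h := by positivity
    constructor <;> linarith
  · rw [upRate, ← hTp, abs_mul]
    have : |1 - s - h / 2| ≤ 2 := by rw [abs_le]; constructor <;> linarith
    have h' : |1 + Tp| ≤ 2 := by rw [abs_le]; constructor <;> linarith
    nlinarith [abs_nonneg (1 - s - h / 2), abs_nonneg (1 + Tp)]
  · rw [downRate, ← hTm, abs_mul]
    have : |1 + s - h / 2| ≤ 2 := by rw [abs_le]; constructor <;> linarith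
    have h' : |1 - Tm| ≤ 2 := by rw [abs_le]; constructor <;> linarith
    nlinarith [abs_nonneg (1 + s - h / 2), abs_nonneg (1 - Tm)]

/-- The odd part of the weight used to control discrete gradients. -/
def oddWeight (p : ℕ) (c s : ℝ) : ℝ := s / (s ^ 2 + c) ^ p

theorem oddWeight_neg (p : ℕ) (c s : ℝ) : oddWeight p c (-s) = -oddWeight p c s := by
  simp [oddWeight, neg_div]

theorem oddWeight_nonneg (p : ℕ) {c s : ℝ} (hc : 0 ≤ c) (hs : 0 ≤ s) : 0 ≤ oddWeight p c s := by
  unfold oddWeight; positivity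

theorem oddWeight_shift (p : ℕ) {c s : ℝ} (hc : 0 < c) (hs : s ≠ 0) (e : ℝ) :
    oddWeight p c (s + e) = oddWeight p c s *
      ((1 + e / s) * ((1 + (2 * s * e + e ^ 2) / (s ^ 2 + c)) ^ p)⁻¹) := by
  have hq : 0 < s ^ 2 + c := by positivity
  have h1 : (s + e) ^ 2 + c = (s ^ 2 + c) * (1 + (2 * s * e + e ^ 2) / (s ^ 2 + c)) := by
    field_simp; ring
  have h2 : s + e = s * (1 + e / s) := by field_simp
  unfold oddWeight
  rw [h1, mul_pow, div_eq_mul_inv, mul_inv, div_eq_mul_inv, h2]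
  ring

theorem shift_sq_le {κ h s : ℝ} (hκ : 0 < κ) (hh : 0 < h) (hκh : h ≤ κ) {e : ℝ}
    (he : e ^ 2 = h ^ 2) :
    ((2 * s * e + e ^ 2) / (s ^ 2 + κ * h)) ^ 2 ≤ 4 * (h / κ) := by
  have hq : 0 < s ^ 2 + κ * h := by positivity
  rw [div_pow, div_le_iff₀ (by positivity)]
  have e1 : 4 * (h / κ) * (s ^ 2 + κ * h) ^ 2 =
      4 * (h / κ) * (s ^ 2 - κ * h) ^ 2 + 16 * s ^ 2 * h ^ 2 := by field_simp; ring
  have e2 : 4 * (h / κ) * (s ^ 2 + κ * h) ^ 2 =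
      4 * (h / κ) * (s ^ 2) ^ 2 + 8 * s ^ 2 * h ^ 2 + 4 * κ * h ^ 3 := by field_simp; ring
  have h3 : (2 * s * e + e ^ 2) ^ 2 ≤ 8 * s ^ 2 * h ^ 2 + 2 * h ^ 4 := by
    have : (2 * s * e + e ^ 2) ^ 2 = 2 * (4 * s ^ 2 * e ^ 2 + (e ^ 2) ^ 2)
      - (2 * s * e - e ^ 2) ^ 2 := by ring
    rw [this, he]
    nlinarith [sq_nonneg (2 * s * e - h ^ 2)]
  have h4 : 0 ≤ 4 * (h / κ) * (s ^ 2) ^ 2 := by positivity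
  have h5 : h ^ 4 ≤ κ * h ^ 3 := by
    have : 0 ≤ h ^ 3 := by positivity
    nlinarith
  have h6 : 0 ≤ h ^ 4 := by positivity
  linarith

theorem second_order_identity (p : ℝ) {a d h s ρ : ℝ} (hs : s ≠ 0) :
    a * ((1 + h / s) * (1 - p * (ρ * (h + 2 * s)) + p * (p + 1) / 2 * (ρ * (h + 2 * s)) ^ 2)) +
    d * ((1 + -h / s) * (1 - p * (ρ * (h - 2 * s)) + p * (p + 1) / 2 * (ρ * (h - 2 * s)) ^ 2)) =
    (a + d) / 2 * (2 - 6 * p * h * ρ + 4 * (p * (p + 1)) * (s ^ 2 * ρ) * ρ +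
      5 * (p * (p + 1)) * h ^ 2 * ρ ^ 2) +
    (a - d) / (2 * s) * (2 * h - 4 * p * (s ^ 2 * ρ) - 2 * p * h ^ 2 * ρ +
      p * (p + 1) * (8 * (s ^ 2 * ρ) * h * ρ + h ^ 3 * ρ ^ 2)) := by
  field_simp
  ring

theorem mul_le_of_abs_le {x y a b : ℝ} (hx : |x| ≤ a) (hy : |y| ≤ b) : x * y ≤ a * b :=
  (le_abs_self _).trans (by
    rw [abs_mul]; exact mul_le_mul hx hy (abs_nonneg _) ((abs_nonneg _).trans hx))

theorem second_order_bound {p L K₁ K₂ K₃ K₄ a₁ A τ Y B h r ρ : ℝ} (hp : 0 ≤ p)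
    (hh : 0 < h) (hh1 : h ≤ 1) (hρ : 0 ≤ ρ) (hρL : ρ ≤ L) (hr : 0 ≤ r) (hr1 : r ≤ 1)
    (h1 : |a₁ - τ| ≤ K₁ * h) (h2 : |A - Y| ≤ K₂ * h) (h3 : 2 * a₁ ≤ B + K₃ * h ^ 2)
    (h4 : |Y| ≤ K₄) (ha : |a₁| ≤ 4) :
    a₁ * (2 - 6 * p * h * ρ + 4 * (p * (p + 1)) * (r * h) * ρ +
      5 * (p * (p + 1)) * h ^ 2 * ρ ^ 2) +
    A * (2 * h - 4 * p * (r * h) - 2 * p * h ^ 2 * ρ +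
      p * (p + 1) * (8 * (r * h) * h * ρ + h ^ 3 * ρ ^ 2)) ≤
    B + 2 * h * (Y * (1 - 2 * p * r)) + h * (τ * (ρ * (4 * (p * (p + 1)) * r - 6 * p))) +
    (K₃ + K₁ * (L * (4 * (p * (p + 1)) + 6 * p)) + 4 * (5 * (p * (p + 1)) * L ^ 2) +
      K₂ * (2 + 4 * p) + (K₄ + K₂) * (2 * p * L + p * (p + 1) * (8 * L + L ^ 2))) * h ^ 2 := by
  have hL : 0 ≤ L := hρ.trans hρL
  have hP : 0 ≤ p * (p + 1) := by positivity
  set P := p * (p + 1)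
  have hK2 : 0 ≤ K₂ := by
    by_contra hneg
    have := (abs_nonneg _).trans h2
    nlinarith
  have hX : |ρ * (4 * P * r - 6 * p)| ≤ L * (4 * P + 6 * p) := by
    rw [abs_mul, abs_of_nonneg hρ]
    refine mul_le_mul hρL ?_ (abs_nonneg _) hL
    have : P * r ≤ P := mul_le_of_le_one_right hP hr1
    have : 0 ≤ P * r := by positivity
    rw [abs_le]; constructor <;> linarith
  have hρ2 : ρ ^ 2 ≤ L ^ 2 := by gcongr
  have hX2 : |5 * P * ρ ^ 2| ≤ 5 * P * L ^ 2 := by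
    rw [abs_of_nonneg (by positivity)]; gcongr
  have hN1 : |2 - 4 * p * r| ≤ 2 + 4 * p := by
    have : p * r ≤ p := mul_le_of_le_one_right hp hr1
    have : 0 ≤ p * r := by positivity
    rw [abs_le]; constructor <;> linarith
  have hN2 : |-2 * p * ρ + P * (8 * r * ρ + h * ρ ^ 2)| ≤ 2 * p * L + P * (8 * L + L ^ 2) := by
    have i1 : p * ρ ≤ p * L := by gcongr
    have i2 : r * ρ ≤ L := (mul_le_of_le_one_left hρ hr1).trans hρL
    have i3 : h * ρ ^ 2 ≤ L ^ 2 := (mul_le_of_le_one_left (by positivity) hh1).trans hρ2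
    have i4 : P * (8 * r * ρ + h * ρ ^ 2) ≤ P * (8 * L + L ^ 2) := by
      apply mul_le_mul_of_nonneg_left _ hP; linarith
    have i5 : 0 ≤ P * (8 * r * ρ + h * ρ ^ 2) := by positivity
    have i6 : 0 ≤ P * (8 * L + L ^ 2) := by positivity
    have i7 : 0 ≤ p * ρ := by positivity
    rw [abs_le]; constructor <;> linarith
  have hA : |A| ≤ K₄ + K₂ := by
    have : |A| ≤ |A - Y| + |Y| := by
      have := abs_add_le (A - Y) Y; rwa [sub_add_cancel] at this
    have : K₂ * h ≤ K₂ := mul_le_of_le_one_right hK2 hh1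
    linarith
  have j1 := mul_le_of_abs_le h1 hX
  have j2 := mul_le_of_abs_le ha hX2
  have j3 := mul_le_of_abs_le h2 hN1
  have j4 := mul_le_of_abs_le hA hN2
  have k1 := mul_le_mul_of_nonneg_left j1 hh.le
  have k2 := mul_le_mul_of_nonneg_left j2 (sq_nonneg h)
  have k3 := mul_le_mul_of_nonneg_left j3 hh.le
  have k4 := mul_le_mul_of_nonneg_left j4 (sq_nonneg h)
  have e : a₁ * (2 - 6 * p * h * ρ + 4 * P * (r * h) * ρ + 5 * P * h ^ 2 * ρ ^ 2) +
    A * (2 * h - 4 * p * (r * h) - 2 * p * h ^ 2 * ρ +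
      P * (8 * (r * h) * h * ρ + h ^ 3 * ρ ^ 2)) =
    2 * a₁ + h * (τ * (ρ * (4 * P * r - 6 * p))) + h * ((a₁ - τ) * (ρ * (4 * P * r - 6 * p))) +
    h ^ 2 * (a₁ * (5 * P * ρ ^ 2)) + 2 * h * (Y * (1 - 2 * p * r)) +
    h * ((A - Y) * (2 - 4 * p * r)) +
    h ^ 2 * (A * (-2 * p * ρ + P * (8 * r * ρ + h * ρ ^ 2))) := by ring
  rw [e]
  have f : (K₃ + K₁ * (L * (4 * P + 6 * p)) + 4 * (5 * P * L ^ 2) +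
      K₂ * (2 + 4 * p) + (K₄ + K₂) * (2 * p * L + P * (8 * L + L ^ 2))) * h ^ 2 =
    K₃ * h ^ 2 + h * (K₁ * h * (L * (4 * P + 6 * p))) + h ^ 2 * (4 * (5 * P * L ^ 2)) +
    h * (K₂ * h * (2 + 4 * p)) + h ^ 2 * ((K₄ + K₂) * (2 * p * L + P * (8 * L + L ^ 2))) := by
    ring
  rw [f]
  linarith

/-- The exponent governing the decay of the odd weight under the gradient dynamics, where
`r = s² / (s² + κ h)`. -/
def oddExponent (β : ℝ) (p : ℕ) (κ s r : ℝ) : ℝ :=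
  driftDeriv β s + relDrift β s * (1 - 2 * p * r) +
    (1 - s * tanh (β * s)) * ((1 - r) / κ * (2 * (p * (p + 1)) * r - 3 * p))

set_option maxHeartbeats 1000000 in
theorem exists_oddWeight_step {β : ℝ} (hβ : 1 < β) (p : ℕ) {κ : ℝ} (hκ : 0 < κ) :
    ∃ K : ℝ, 0 ≤ K ∧ ∀ ε h s : ℝ, 0 < ε → ε ≤ 1 / 2 → 0 < h → h ≤ 1 → β * h ≤ 1 / 2 → h ≤ κ →
      4 * (h / κ) ≤ ε ^ 2 → h / 2 ≤ s → s ≤ 1 →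
      upRate β h s * oddWeight p (κ * h) (s + h) + downRate β h s * oddWeight p (κ * h) (s - h) ≤
        oddWeight p (κ * h) s * ((2 + h - 2 * s * tanh (β * s)) +
          2 * h * oddExponent β p κ s (s ^ 2 / (s ^ 2 + κ * h)) + K * ε * h) := by
  obtain ⟨C, hC, hCx⟩ := exists_inv_pow_taylor p
  set K₁ := 1 + 3 * β + β ^ 2
  set K₂ := 2 * β ^ 3 + 4 * β
  set K₃ := 4 * β ^ 3 + 2 * β ^ 2
  set L := 1 / κ
  set KK := K₃ + K₁ * (L * (4 * ((p:ℝ) * (p + 1)) + 6 * p)) + 4 * (5 * ((p:ℝ) * (p + 1)) * L ^ 2) +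
      K₂ * (2 + 4 * p) + (β + K₂) * (2 * p * L + p * (p + 1) * (8 * L + L ^ 2)) with hKK
  have hL : 0 < L := by positivity
  have hβ0 : 0 < β := by linarith
  have hKK0 : 0 ≤ KK := by positivity
  refine ⟨KK * κ + 96 * C / κ, by positivity, fun ε h s hε hε1 hh hh1 hβh hhκ hεh hs hs1 => ?_⟩
  have hs0 : 0 < s := by linarith
  have hc : 0 < κ * h := by positivity
  have hq : 0 < s ^ 2 + κ * h := by positivity
  obtain ⟨b1, b2, b3, b4, b5⟩ := rate_bounds hβ hh hh1 hβh hs0 hs1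
  set α := upRate β h s
  set δ := downRate β h s
  set ρ := h / (s ^ 2 + κ * h) with hρ
  set r := s ^ 2 / (s ^ 2 + κ * h) with hr
  have hsr : s ^ 2 * ρ = r * h := by rw [hρ, hr]; ring
  have hr0 : 0 ≤ r := by positivity
  have hr1 : r ≤ 1 := by rw [hr, div_le_one hq]; linarith
  have hρ0 : 0 ≤ ρ := by positivity
  have hρr : ρ = (1 - r) / κ := by rw [hρ, hr]; field_simp; ring
  have hρL : ρ ≤ L := by
    rw [hρr]; exact div_le_div_of_nonneg_right (by linarith) hκ.le
  have hv : 0 ≤ oddWeight p (κ * h) s := oddWeight_nonneg p hc.le hs0.le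
  have hY : |relDrift β s| ≤ β := by
    rw [abs_le]; constructor
    · linarith [neg_one_le_relDrift hβ0 hs0]
    · linarith [relDrift_le hβ0 hs0]
  have ha : |(α + δ) / 2| ≤ 4 := by
    rw [abs_le] at b4 b5 ⊢; constructor <;> linarith [b4.1, b4.2, b5.1, b5.2]
  have xb : ∀ e : ℝ, e ^ 2 = h ^ 2 →
      |((1 + (2 * s * e + e ^ 2) / (s ^ 2 + κ * h)) ^ p)⁻¹ -
        (1 - p * ((2 * s * e + e ^ 2) / (s ^ 2 + κ * h)) +
          p * (p + 1) / 2 * ((2 * s * e + e ^ 2) / (s ^ 2 + κ * h)) ^ 2)| ≤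
        C * (4 * (h / κ) * ε) := by
    intro e he
    set x := (2 * s * e + e ^ 2) / (s ^ 2 + κ * h)
    have hx2 : x ^ 2 ≤ 4 * (h / κ) := shift_sq_le hκ hh hhκ he
    have hxε : |x| ≤ ε := abs_le_of_sq_le_sq (hx2.trans hεh) hε.le
    refine (hCx x (hxε.trans hε1)).trans ?_
    have : |x| ^ 3 = x ^ 2 * |x| := by rw [← sq_abs]; ring
    rw [this]
    gcongr
  have e1 := xb h rfl
  have e2 := xb (-h) (by ring)
  have x1 : (2 * s * h + h ^ 2) / (s ^ 2 + κ * h) = ρ * (h + 2 * s) := by rw [hρ]; ring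
  have x2 : (2 * s * -h + (-h) ^ 2) / (s ^ 2 + κ * h) = ρ * (h - 2 * s) := by rw [hρ]; ring
  rw [sub_eq_add_neg s h, oddWeight_shift p hc hs0.ne' h, oddWeight_shift p hc hs0.ne' (-h)]
  have hhs : h / s ≤ 2 := by rw [div_le_iff₀ hs0]; linarith
  have hhs0 : 0 ≤ h / s := by positivity
  have f1 : |α * (1 + h / s)| ≤ 12 := by
    rw [abs_mul]
    have : |1 + h / s| ≤ 3 := by rw [abs_le]; constructor <;> linarith
    nlinarith [abs_nonneg α, abs_nonneg (1 + h / s)]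
  have f2 : |δ * (1 + -h / s)| ≤ 12 := by
    rw [abs_mul]
    have : |1 + -h / s| ≤ 3 := by rw [neg_div, abs_le]; constructor <;> linarith
    nlinarith [abs_nonneg δ, abs_nonneg (1 + -h / s)]
  have g1 := mul_le_of_abs_le f1 e1
  have g2 := mul_le_of_abs_le f2 e2
  rw [x1] at g1 ⊢
  rw [x2] at g2 ⊢
  have id := second_order_identity (p : ℝ) (a := α) (d := δ) (h := h) (ρ := ρ) hs0.ne'
  rw [hsr] at id
  have bd := second_order_bound (p := p) (K₁ := K₁) (K₂ := K₂) (K₃ := K₃) (K₄ := β)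
    (a₁ := (α + δ) / 2) (A := (α - δ) / (2 * s)) (τ := 1 - s * tanh (β * s)) (Y := relDrift β s)
    (B := 2 + h - 2 * s * tanh (β * s) + 2 * h * driftDeriv β s)
    (by positivity) hh hh1 hρ0 hρL hr0 hr1 b2 b3 (by linarith) hY ha
  rw [← hKK] at bd
  have hh2 : KK * h ^ 2 ≤ KK * κ * ε * h := by
    have : h ≤ κ * ε := by
      have : 4 * h ≤ ε ^ 2 * κ := by
        rw [← mul_div_assoc, div_le_iff₀ hκ] at hεh; exact hεh
      have h1 : ε ^ 2 ≤ ε := by nlinarith only [hε, hε1]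
      have h2 : ε ^ 2 * κ ≤ ε * κ := mul_le_mul_of_nonneg_right h1 hκ.le
      linarith only [this, h2, hh]
    calc KK * h ^ 2 = KK * h * h := by ring
      _ ≤ KK * h * (κ * ε) := by gcongr
      _ = _ := by ring
  have hE : 2 * h * (relDrift β s * (1 - 2 * p * r)) +
      h * ((1 - s * tanh (β * s)) * (ρ * (4 * ((p:ℝ) * (p + 1)) * r - 6 * p))) +
      2 * h * driftDeriv β s = 2 * h * oddExponent β p κ s r := by
    rw [oddExponent, hρr]; ring
  have hCκ : 12 * (C * (4 * (h / κ) * ε)) = 48 * C / κ * ε * h := by ring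
  have main : α * ((1 + h / s) * ((1 + ρ * (h + 2 * s)) ^ p)⁻¹) +
      δ * ((1 + -h / s) * ((1 + ρ * (h - 2 * s)) ^ p)⁻¹) ≤
      (2 + h - 2 * s * tanh (β * s)) + 2 * h * oddExponent β p κ s r +
        (KK * κ + 96 * C / κ) * ε * h := by
    have tot := add_le_add (add_le_add g1 g2) (id.le.trans bd)
    rw [hCκ] at tot
    refine le_trans (le_of_eq (by ring)) (tot.trans ?_)
    have e : (KK * κ + 96 * C / κ) * ε * h =
        KK * κ * ε * h + (48 * C / κ * ε * h + 48 * C / κ * ε * h) := by ring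
    rw [← hE, e]
    clear_value KK
    linarith only [hh2]
  calc _ = oddWeight p (κ * h) s * (α * ((1 + h / s) * ((1 + ρ * (h + 2 * s)) ^ p)⁻¹) +
      δ * ((1 + -h / s) * ((1 + ρ * (h - 2 * s)) ^ p)⁻¹)) := by ring
    _ ≤ _ := mul_le_mul_of_nonneg_left main hv

theorem oddExponent_le_of_small {β : ℝ} (hβ : 1 < β) {p : ℕ} (hp : 19 ≤ p) {s r : ℝ} (hs : 0 < s)
    (hr : 0 ≤ r) (hr1 : r ≤ 1) (hY : 9 / 10 * (β - 1) ≤ relDrift β s)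
    (hT : s * tanh (β * s) ≤ 1 / 10) :
    oddExponent β p (5 * p / (4 * (β - 1))) s r ≤ -(16 / 100) * (β - 1) := by
  have hγ : 0 < β - 1 := by linarith
  have hp' : (19 : ℝ) ≤ p := by exact_mod_cast hp
  have hT0 : 0 ≤ s * tanh (β * s) := mul_nonneg hs.le (tanh_nonneg (by positivity))
  have h1 := driftDeriv_le (β := β) (s := s) (by linarith)
  have h2 := relDrift_le (β := β) (s := s) (by linarith) hs
  set γ := β - 1
  set Y := relDrift β s
  set τ := 1 - s * tanh (β * s) with hτ
  have e : (1 - r) / (5 * p / (4 * γ)) * (2 * ((p : ℝ) * (p + 1)) * r - 3 * p) =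
      γ * (8 / 10 * ((1 - r) * (2 * (p + 1) * r - 3))) := by
    field_simp; ring
  rw [oddExponent, e]
  have h3 : Y * (1 - 2 * p * r) ≤ γ * (1 - 18 / 10 * p * r) := by
    have : 9 / 10 * γ * (p * r) ≤ Y * (p * r) := mul_le_mul_of_nonneg_right hY (by positivity)
    linarith
  have h4 : τ * (8 / 10 * ((1 - r) * (2 * (p + 1) * r - 3))) ≤
      16 / 10 * (p + 1) * r - 216 / 100 * (1 - r) := by
    have a1 : τ * ((1 - r) * (2 * (p + 1) * r)) ≤ 2 * (p + 1) * r := by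
      have : τ * (1 - r) ≤ 1 := by nlinarith
      have h0 : 0 ≤ 2 * ((p : ℝ) + 1) * r := by positivity
      calc _ = (τ * (1 - r)) * (2 * (p + 1) * r) := by ring
        _ ≤ 1 * (2 * (p + 1) * r) := mul_le_mul_of_nonneg_right this h0
        _ = _ := one_mul _
    have a2 : 9 / 10 * (1 - r) ≤ τ * (1 - r) :=
      mul_le_mul_of_nonneg_right (by linarith) (by linarith)
    linarith
  have h5 : τ * (γ * (8 / 10 * ((1 - r) * (2 * (p + 1) * r - 3)))) ≤
      γ * (16 / 10 * (p + 1) * r - 216 / 100 * (1 - r)) := by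
    calc _ = γ * (τ * (8 / 10 * ((1 - r) * (2 * (p + 1) * r - 3)))) := by ring
      _ ≤ _ := mul_le_mul_of_nonneg_left h4 hγ.le
  have h6 : 0 ≤ γ * (r * ((p : ℝ) - 19)) :=
    mul_nonneg hγ.le (mul_nonneg hr (by linarith))
  have h7 : 0 ≤ γ * r := by positivity
  linarith

theorem correction_le {β : ℝ} (hβ : 0 < β) (p : ℕ) {κ s r : ℝ} (hκ : 0 < κ) (hs : 0 < s)
    (hs1 : s ≤ 1) (hr1 : r ≤ 1) :
    (1 - s * tanh (β * s)) * ((1 - r) / κ * (2 * (p * (p + 1)) * r - 3 * p)) ≤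
      2 * (p * (p + 1)) * ((1 - r) / κ) := by
  have hT0 : 0 ≤ tanh (β * s) := tanh_nonneg (by positivity)
  have hT1 := tanh_lt_one (β * s)
  have hT2 : 0 ≤ s * tanh (β * s) := by positivity
  have hT3 : s * tanh (β * s) ≤ 1 := mul_le_one₀ hs1 hT0 hT1.le
  have hx : 0 ≤ (1 - r) / κ := div_nonneg (by linarith) hκ.le
  have hy : 2 * ((p : ℝ) * (p + 1)) * r - 3 * p ≤ 2 * (p * (p + 1)) := by
    have : 2 * ((p : ℝ) * (p + 1)) * r ≤ 2 * ((p : ℝ) * (p + 1)) :=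
      mul_le_of_le_one_right (by positivity) hr1
    have : (0:ℝ) ≤ p := by positivity
    linarith
  have h0 : 0 ≤ 2 * ((p : ℝ) * (p + 1)) := by positivity
  have h1 := mul_le_mul_of_nonneg_left hy hx
  calc _ ≤ (1 - s * tanh (β * s)) * ((1 - r) / κ * (2 * (p * (p + 1)))) :=
        mul_le_mul_of_nonneg_left h1 (by linarith)
    _ ≤ 1 * ((1 - r) / κ * (2 * (p * (p + 1)))) :=
        mul_le_mul_of_nonneg_right (by linarith) (by positivity)
    _ = _ := by ring

theorem oddWeight_le (p : ℕ) {c s a : ℝ} (hc : 0 ≤ c) (ha : 0 < a) (has : a ≤ s) :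
    oddWeight (p + 1) c s ≤ (a ^ (2 * p + 1))⁻¹ := by
  have hs : 0 < s := by linarith
  unfold oddWeight
  have h1 : (s ^ 2) ^ (p + 1) ≤ (s ^ 2 + c) ^ (p + 1) := by gcongr; linarith
  have h2 : s / (s ^ 2) ^ (p + 1) = (s ^ (2 * p + 1))⁻¹ := by
    rw [← pow_mul, show 2 * (p + 1) = (2 * p + 1) + 1 by ring, pow_succ]; field_simp
  calc _ ≤ s / (s ^ 2) ^ (p + 1) := by gcongr
    _ = _ := h2
    _ ≤ _ := by gcongr

theorem le_oddWeight_of_large (p : ℕ) {c s a : ℝ} (hc : 0 ≤ c) (hs : 0 < s) (has : s ≤ a)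
    (hcs : (p + 1 : ℕ) * c ≤ s ^ 2) :
    (a ^ (2 * p + 1))⁻¹ / 3 ≤ oddWeight (p + 1) c s := by
  unfold oddWeight
  have h1 : s ^ 2 + c ≤ s ^ 2 * exp (1 / (p + 1 : ℕ)) := by
    have : s ^ 2 * (1 / (p + 1 : ℕ) + 1) ≤ s ^ 2 * exp (1 / (p + 1 : ℕ)) :=
      mul_le_mul_of_nonneg_left (add_one_le_exp _) (by positivity)
    have h2 : c ≤ s ^ 2 * (1 / (p + 1 : ℕ)) := by
      rw [mul_one_div, le_div_iff₀ (by positivity)]; linarith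
    linarith
  have h2 : (s ^ 2 + c) ^ (p + 1) ≤ (s ^ 2) ^ (p + 1) * 3 := by
    calc _ ≤ (s ^ 2 * exp (1 / (p + 1 : ℕ))) ^ (p + 1) := by gcongr
      _ = (s ^ 2) ^ (p + 1) * exp 1 := by
        rw [mul_pow, ← exp_nat_mul]; congr 2; field_simp
      _ ≤ _ := by gcongr; exact exp_one_lt_three.le
  have h3 : s / (s ^ 2) ^ (p + 1) = (s ^ (2 * p + 1))⁻¹ := by
    rw [← pow_mul, show 2 * (p + 1) = (2 * p + 1) + 1 by ring, pow_succ]; field_simp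
  calc (a ^ (2 * p + 1))⁻¹ / 3 ≤ (s ^ (2 * p + 1))⁻¹ / 3 := by gcongr
    _ = s / ((s ^ 2) ^ (p + 1) * 3) := by rw [← h3, div_div]
    _ ≤ _ := by gcongr

theorem le_oddWeight_of_small (p : ℕ) {κ h s : ℝ} (hκ : 0 < κ) (hh : 0 < h) (hh1 : h ≤ 1)
    (hs : h / 2 ≤ s) (hcs : s ^ 2 ≤ (p + 2 + 1 : ℕ) * (κ * h)) {B : ℝ} (hB : 0 ≤ B)
    (hBh : 2 * (((p + 2 + 1 : ℕ) + 1) * κ) ^ (p + 2 + 1) * B * h ≤ 1) :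
    B ≤ oddWeight (p + 2 + 1) (κ * h) s := by
  have hs0 : 0 < s := by linarith
  unfold oddWeight
  rw [le_div_iff₀ (by positivity)]
  set N := p + 2 + 1
  have h1 : s ^ 2 + κ * h ≤ ((N : ℕ) + 1) * κ * h := by linarith
  have h2 : (s ^ 2 + κ * h) ^ N ≤ (((N : ℕ) + 1) * κ) ^ N * h ^ 2 := by
    calc _ ≤ (((N : ℕ) + 1) * κ * h) ^ N := by gcongr
      _ = (((N : ℕ) + 1) * κ) ^ N * h ^ N := by rw [mul_pow]
      _ ≤ _ := by
        gcongr ?_ * ?_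
        exact pow_le_pow_of_le_one hh.le hh1 (by omega)
  calc B * (s ^ 2 + κ * h) ^ N ≤ B * ((((N : ℕ) + 1) * κ) ^ N * h ^ 2) := by gcongr
    _ = (2 * (((N : ℕ) + 1) * κ) ^ N * B * h) * (h / 2) := by ring
    _ ≤ 1 * (h / 2) := by gcongr
    _ ≤ s := by linarith

theorem eventually_mul_le (A : ℝ) {B : ℝ} (hB : 0 < B) :
    ∀ᶠ h in nhdsWithin (0 : ℝ) (Set.Ioi 0), A * h ≤ B := by
  have : Tendsto (fun h : ℝ => A * h) (nhdsWithin 0 (Set.Ioi 0)) (nhds 0) := by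
    have : Tendsto (fun h : ℝ => A * h) (nhds 0) (nhds (A * 0)) := tendsto_id.const_mul A
    rw [mul_zero] at this
    exact this.mono_left nhdsWithin_le_nhds
  exact (this.eventually (gt_mem_nhds hB)).mono fun _ h => h.le

theorem neg_one_le_driftDeriv {β : ℝ} (hβ : 0 < β) (s : ℝ) : -1 ≤ driftDeriv β s := by
  have := mul_nonneg hβ.le (sub_nonneg.2 (tanh_sq_lt_one (β * s)).le)
  rw [driftDeriv]; linarith

theorem exists_exponent (R B : ℝ) (hR : 1 < R) (hB : 0 < B) : ∃ q : ℕ, 18 ≤ q ∧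
    ((q + 1 : ℕ) : ℝ) ≤ B * R ^ (2 * q + 1) := by
  have h := tendsto_pow_const_div_const_pow_of_one_lt 1 hR
  have h2 := (h.eventually (gt_mem_nhds hB)).and (eventually_ge_atTop 19)
  obtain ⟨n, h3, h4⟩ := h2.exists
  obtain ⟨q, rfl⟩ : ∃ q, n = q + 1 := ⟨n - 1, by omega⟩
  refine ⟨q, by omega, ?_⟩
  rw [div_lt_iff₀ (by positivity), pow_one] at h3
  refine h3.le.trans ?_
  gcongr
  · exact hR.le
  · omega

set_option maxHeartbeats 1000000 in
/-- There is a weight `oddWeight + M` which is a strict supersolution for the evolution of the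
discrete gradients of the magnetization chain. -/
theorem exists_supersolution {β : ℝ} (hβ : 1 < β) : ∃ (p : ℕ) (κ M c h₀ : ℝ), 0 < κ ∧ 0 < M ∧
    0 < c ∧ 0 < h₀ ∧ ∀ h s : ℝ, 0 < h → h ≤ h₀ → h / 2 ≤ s → s ≤ 1 →
      upRate β h s * (oddWeight p (κ * h) (s + h) + M) +
        downRate β h s * (oddWeight p (κ * h) (s - h) + M) ≤
      (2 + h - 2 * s * tanh (β * s) - 2 * c * h) * (oddWeight p (κ * h) s + M) := by
  obtain ⟨s₀', s₁, s₂, c₀, y₁, hs₀', hs₁, hs₁₂, hs₂, hc₀, hy₁, hA, hB, hC, hD, hg⟩ :=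
    exists_drift_bounds hβ
  have hβ0 : 0 < β := by linarith
  have hγ : 0 < β - 1 := by linarith
  set γ := β - 1 with hγdef
  set s₀ := min s₀' s₁
  have hs₀ : 0 < s₀ := lt_min hs₀' hs₁
  set c₁ := min (16 / 100 * γ) (y₁ / 2)
  have hc₁ : 0 < c₁ := lt_min (by positivity) (by positivity)
  have hc₁γ : c₁ ≤ 16 / 100 * γ := min_le_left _ _
  have hc₁y : c₁ ≤ y₁ / 2 := min_le_right _ _
  have hc₀1 : c₀ ≤ 1 := by
    have := neg_one_le_driftDeriv hβ0 1
    linarith [hg 1 (by linarith)]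
  have hs₂0 : 0 < s₂ := hs₁.trans hs₁₂
  have hR : 1 < s₂ / s₁ := by rwa [one_lt_div hs₁]
  obtain ⟨q, hq, hqR⟩ := exists_exponent (s₂ / s₁) (c₁ * c₀ / (180 * γ)) hR (by positivity)
  set n := q + 1 with hn
  have hn19 : (19 : ℝ) ≤ n := by
    have : 19 ≤ n := by omega
    exact_mod_cast this
  set m := 2 * q + 1
  set κ := 5 * (n : ℝ) / (4 * γ) with hκdef
  have hκ : 0 < κ := by positivity
  set M := 10 * n / c₀ * (s₂ ^ m)⁻¹ with hM
  have hM0 : 0 < M := by positivity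
  set B := 6 * γ * M / c₁ with hBdef
  have hB0 : 0 < B := by positivity
  have hBs : B ≤ (s₁ ^ m)⁻¹ / 3 := by
    rw [div_pow] at hqR
    have e1 : (n : ℝ) * (180 * γ) * s₁ ^ m ≤ c₁ * c₀ * s₂ ^ m := by
      have hp1 : 0 < s₁ ^ m := by positivity
      rw [div_mul_div_comm, le_div_iff₀ (by positivity)] at hqR
      linarith
    have e2 : B = (n * (180 * γ)) / (c₁ * c₀ * s₂ ^ m) / 3 := by
      rw [hBdef, hM]; field_simp; ring
    rw [e2]
    gcongr
    rw [inv_eq_one_div, div_le_div_iff₀ (by positivity) (by positivity)]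
    linarith
  obtain ⟨K, hK, hstep⟩ := exists_oddWeight_step hβ n hκ
  set ε := min (1 / 2) (min c₁ (c₀ / 2) / (K + 1))
  have hε : 0 < ε := lt_min (by norm_num) (div_pos (lt_min hc₁ (by positivity)) (by linarith))
  have hε2 : ε ≤ 1 / 2 := min_le_left _ _
  have hKε : K * ε ≤ min c₁ (c₀ / 2) := by
    have h1 : ε ≤ min c₁ (c₀ / 2) / (K + 1) := min_le_right _ _
    rw [le_div_iff₀ (by linarith)] at h1
    linarith
  have hKε1 : K * ε ≤ c₁ := hKε.trans (min_le_left _ _)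
  have hKε0 : K * ε ≤ c₀ / 2 := hKε.trans (min_le_right _ _)
  set K₃ := 4 * β ^ 3 + 2 * β ^ 2 with hK₃
  set c := min c₁ c₀ / 8
  have hc : 0 < c := by have := lt_min hc₁ hc₀; positivity
  have hcc₁ : 8 * c ≤ c₁ := by
    have : min c₁ c₀ ≤ c₁ := min_le_left _ _
    simp only [c]; linarith
  have hcc₀ : 8 * c ≤ c₀ := by
    have : min c₁ c₀ ≤ c₀ := min_le_right _ _
    simp only [c]; linarith
  have hev := (eventually_mul_le 1 one_pos).and <|
    (eventually_mul_le β (one_half_pos)).and <| (eventually_mul_le 1 hκ).and <|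
    (eventually_mul_le (4 / κ) (pow_pos hε 2)).and <|
    (eventually_mul_le K₃ (lt_min hγ hc₀)).and <|
    (eventually_mul_le (2 * (n * (n + 1)) / s₀ ^ 2)
      (lt_min (half_pos hy₁) (half_pos hc₀))).and <|
    (eventually_mul_le κ (pow_pos hs₀ 2)).and
    (eventually_mul_le (2 * (((q - 2 + 2 + 1 : ℕ) + 1) * κ) ^ (q - 2 + 2 + 1) * B) one_pos)
  obtain ⟨h₀, hh₀, hall⟩ := mem_nhdsGT_iff_exists_Ioc_subset.1 hev
  refine ⟨n, κ, M, c, h₀, hκ, hM0, hc, hh₀, fun h s hh hhh₀ hs hs1 => ?_⟩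
  obtain ⟨k1, k2, k3, k4, k5, k6, k7, k8⟩ := hall ⟨hh, hhh₀⟩
  rw [one_mul] at k1 k3
  have hs0 : 0 < s := by linarith
  have hst := hstep ε h s hε hε2 hh k1 k2 k3 (by rw [div_mul_eq_mul_div] at k4; rwa [← mul_div_assoc]) hs hs1
  have hsum := (rate_bounds hβ hh k1 k2 hs0 hs1).1
  set v := oddWeight n (κ * h) s
  have hv : 0 ≤ v := oddWeight_nonneg n (by positivity) hs0.le
  set r := s ^ 2 / (s ^ 2 + κ * h) with hr
  have hq0 : 0 < s ^ 2 + κ * h := by positivity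
  have hr0 : 0 ≤ r := by positivity
  have hr1 : r ≤ 1 := by rw [hr, div_le_one hq0]; linarith [mul_pos hκ hh]
  have hk5γ := k5.trans (min_le_left _ _)
  have hk5c := k5.trans (min_le_right _ _)
  have hk6y := k6.trans (min_le_left _ _)
  have hk6c := k6.trans (min_le_right _ _)
  have hgγ : driftDeriv β s ≤ γ := driftDeriv_le hβ0
  have hgY := (driftDeriv_lt_relDrift hβ0 hs0).le
  set Y := relDrift β s
  have hfar : s₀ ≤ s → (n : ℝ) ≤ 2 * n * r ∧ oddExponent β n κ s r ≤ driftDeriv β s +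
      Y * (1 - 2 * n * r) + 2 * (n * (n + 1)) / s₀ ^ 2 * h := by
    intro hs₀s
    have hsq : s₀ ^ 2 ≤ s ^ 2 := by gcongr
    constructor
    · have hr2 : 1 / 2 ≤ r := by
        rw [hr, div_le_div_iff₀ (by norm_num) hq0]; linarith only [hsq, k7]
      have := mul_le_mul_of_nonneg_left hr2 (by positivity : (0 : ℝ) ≤ n)
      linarith only [this]
    · have h1 := correction_le hβ0 n hκ hs0 hs1 hr1
      have h2 : (1 - r) / κ ≤ h / s₀ ^ 2 := by
        have : (1 - r) / κ = h / (s ^ 2 + κ * h) := by rw [hr]; field_simp; ring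
        rw [this]; gcongr; linarith [mul_pos hκ hh]
      have h3 : 2 * ((n : ℝ) * (n + 1)) * ((1 - r) / κ) ≤ 2 * (n * (n + 1)) * (h / s₀ ^ 2) := by
        gcongr
      have h4 : 2 * ((n : ℝ) * (n + 1)) * (h / s₀ ^ 2) = 2 * (n * (n + 1)) / s₀ ^ 2 * h := by ring
      rw [oddExponent]; linarith
  have key : v * (2 * oddExponent β n κ s r + K * ε) + M * (2 * driftDeriv β s + K₃ * h) ≤
      -(2 * c) * (v + M) := by
    rcases le_total s s₁ with hss₁ | hss₁
    · have hE : oddExponent β n κ s r ≤ -c₁ := by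
        rcases le_total s s₀ with hss₀ | hss₀
        · obtain ⟨a1, a2⟩ := hA s hs0 (hss₀.trans (min_le_left _ _))
          have := oddExponent_le_of_small hβ (by omega : 19 ≤ n) hs0 hr0 hr1 a1 a2
          linarith
        · obtain ⟨b1, b2⟩ := hfar hss₀
          have b3 := hB s hs0 hss₁
          have b4 : (17 : ℝ) ≤ 2 * n * r - 2 := by linarith only [b1, hn19]
          have b5 : Y * 1 ≤ Y * (2 * n * r - 2) :=
            mul_le_mul_of_nonneg_left (by linarith) (by linarith)
          linarith
      have hvB : B ≤ v := by
        rcases le_total ((n : ℝ) * (κ * h)) (s ^ 2) with hsq | hsq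
        · exact hBs.trans (le_oddWeight_of_large q (by positivity) hs0 hss₁ hsq)
        · have := le_oddWeight_of_small (q - 2) hκ hh k1 hs (B := B)
            (by rwa [show q - 2 + 2 + 1 = n by omega]) hB0.le k8
          rwa [show q - 2 + 2 + 1 = n by omega] at this
      have hMv : 6 * γ * M ≤ c₁ * v := by
        rw [hBdef, div_le_iff₀ hc₁] at hvB; linarith
      have hMv' : M ≤ v := by
        have : c₁ * v ≤ 16 / 100 * γ * v := by gcongr
        have : γ * (6 * M) ≤ γ * (16 / 100 * v) := by linarith
        have := le_of_mul_le_mul_left this hγ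
        linarith
      have t1 : v * (2 * oddExponent β n κ s r + K * ε) ≤ v * (-c₁) :=
        mul_le_mul_of_nonneg_left (by linarith) hv
      have t2 : M * (2 * driftDeriv β s + K₃ * h) ≤ M * (3 * γ) :=
        mul_le_mul_of_nonneg_left (by linarith) hM0.le
      have t3 : c * (v + M) ≤ c * (2 * v) := mul_le_mul_of_nonneg_left (by linarith) hc.le
      have t4 : 8 * c * v ≤ c₁ * v := mul_le_mul_of_nonneg_right hcc₁ hv
      linarith
    · obtain ⟨b1, b2⟩ := hfar ((min_le_right _ _).trans hss₁)
      have b3 := hg s hss₁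
      have b4 : (1 : ℝ) ≤ 2 * n * r := by linarith only [b1, hn19]
      have t2 : M * (2 * driftDeriv β s + K₃ * h) ≤ M * (-c₀) :=
        mul_le_mul_of_nonneg_left (by linarith) hM0.le
      rcases le_total s s₂ with hss₂ | hss₂
      · have b5 : Y * (1 - 2 * n * r) ≤ 0 :=
          mul_nonpos_of_nonneg_of_nonpos (hC s hs0 hss₂) (by linarith)
        have t1 : v * (2 * oddExponent β n κ s r + K * ε) ≤ v * (-(c₀ / 2)) :=
          mul_le_mul_of_nonneg_left (by linarith) hv
        have t3 : 8 * c * (v + M) ≤ c₀ * (v + M) := by gcongr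
        have : 0 ≤ c₀ * v := by positivity
        have : 0 ≤ c₀ * M := by positivity
        linarith
      · have hY1 : -1 ≤ Y := neg_one_le_relDrift hβ0 hs0
        have b5 : Y * (1 - 2 * n * r) ≤ 2 * n := by
          have : (n : ℝ) * r ≤ n := mul_le_of_le_one_right (by positivity) hr1
          have : (-Y) * (2 * n * r - 1) ≤ 1 * (2 * n * r - 1) :=
            mul_le_mul_of_nonneg_right (by linarith) (by linarith)
          linarith
        have hvs : v ≤ (s₂ ^ m)⁻¹ := oddWeight_le q (by positivity) hs₂0 hss₂
        have hMe : c₀ * M = 10 * n * (s₂ ^ m)⁻¹ := by rw [hM]; field_simp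
        have t1 : v * (2 * oddExponent β n κ s r + K * ε) ≤ v * (5 * n) :=
          mul_le_mul_of_nonneg_left (by linarith) hv
        have t4 : n * v ≤ n * (s₂ ^ m)⁻¹ := by gcongr
        have t5 : v ≤ M := by
          have : c₀ * M ≤ M := mul_le_of_le_one_left hM0.le hc₀1
          have : 1 * v ≤ n * v := by gcongr; linarith
          have : 0 ≤ n * (s₂ ^ m)⁻¹ := by positivity
          linarith
        have t3 : 8 * c * (v + M) ≤ c₀ * (2 * M) :=
          mul_le_mul hcc₀ (by linarith) (by positivity) hc₀.le
        linarith
  have hMsum := mul_le_mul_of_nonneg_left hsum hM0.le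
  have hkey := mul_le_mul_of_nonneg_left key hh.le
  rw [← hK₃] at hMsum
  linarith only [hMsum, hkey, hst]

theorem pPlus_neg (β s : ℝ) : pPlus β (-s) = 1 - pPlus β s := by
  simp only [pPlus, mul_neg, tanh_neg]; ring

theorem pPlus_pos (β s : ℝ) : 0 < pPlus β s := by
  have := neg_one_lt_tanh (β * s); rw [pPlus]; linarith

theorem pPlus_lt_one (β s : ℝ) : pPlus β s < 1 := by
  have := tanh_lt_one (β * s); rw [pPlus]; linarith

/-- Probability that the number of `+` spins increases from `k` in one step. -/
def birth (β : ℝ) (n k : ℕ) : ℝ := ((n : ℝ) - k) / n * pPlus β ((2 * k - n) / n + 1 / n)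

/-- Probability that the number of `+` spins decreases from `k` in one step. -/
def death (β : ℝ) (n k : ℕ) : ℝ := (k : ℝ) / n * (1 - pPlus β ((2 * k - n) / n - 1 / n))

/-- The generator of the chain of the number of `+` spins, acting on functions. -/
def layerStep (β : ℝ) (n : ℕ) (F : ℕ → ℝ) (k : ℕ) : ℝ :=
  birth β n k * F (k + 1) + death β n k * F (k - 1) + (1 - birth β n k - death β n k) * F k

theorem layerStep_succ_sub (β : ℝ) (n : ℕ) (F : ℕ → ℝ) (k : ℕ) :
    layerStep β n F (k + 1) - layerStep β n F k =
      birth β n (k + 1) * (F (k + 2) - F (k + 1)) +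
      (1 - birth β n k - death β n (k + 1)) * (F (k + 1) - F k) +
      death β n k * (F k - F (k - 1)) := by
  simp only [layerStep, Nat.add_sub_cancel]; ring

theorem birth_reflect (β : ℝ) {n k : ℕ} (hk : k ≤ n) : birth β n (n - k) = death β n k := by
  simp only [birth, death, Nat.cast_sub hk]
  have : (2 * ((n : ℝ) - k) - n) / n + 1 / n = -((2 * k - n) / n - 1 / n) := by ring
  rw [this, pPlus_neg, sub_sub_cancel]

theorem death_reflect (β : ℝ) {n k : ℕ} (hk : k ≤ n) : death β n (n - k) = birth β n k := by
  rw [← birth_reflect β (Nat.sub_le n k), Nat.sub_sub_self hk]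

theorem death_zero (β : ℝ) (n : ℕ) : death β n 0 = 0 := by simp [death]

theorem birth_self (β : ℝ) (n : ℕ) : birth β n n = 0 := by simp [birth]

theorem layerStep_reflect (β : ℝ) {n : ℕ} {F : ℕ → ℝ} (hF : ∀ k ≤ n, F (n - k) = F k) {k : ℕ}
    (hk : k ≤ n) : layerStep β n F (n - k) = layerStep β n F k := by
  have h1 : death β n k * F (n - k + 1) = death β n k * F (k - 1) := by
    rcases Nat.eq_zero_or_pos k with rfl | h
    · simp [death_zero]
    · rw [← hF (k - 1) (by omega)]; congr 2; omega
  have h2 : birth β n k * F (n - k - 1) = birth β n k * F (k + 1) := by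
    rcases hk.eq_or_lt with rfl | h
    · simp [birth_self]
    · rw [← hF (k + 1) (by omega)]; congr 2
  rw [layerStep, layerStep, birth_reflect β hk, death_reflect β hk, h1, h2, hF k hk]
  ring

theorem birth_nonneg (β : ℝ) {n k : ℕ} (hk : k ≤ n) : 0 ≤ birth β n k := by
  have : (k : ℝ) ≤ n := by exact_mod_cast hk
  exact mul_nonneg (div_nonneg (by linarith) (by positivity)) (pPlus_pos _ _).le

theorem death_nonneg (β : ℝ) (n k : ℕ) : 0 ≤ death β n k :=
  mul_nonneg (by positivity) (by linarith [pPlus_lt_one β ((2 * k - n) / n - 1 / n)])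

theorem four_mul_birth_succ (β : ℝ) {n : ℕ} (hn : n ≠ 0) (k : ℕ) :
    4 * birth β n (k + 1) = upRate β (2 / n) ((2 * k + 1 - n) / n) := by
  have hn' : (n : ℝ) ≠ 0 := by exact_mod_cast hn
  have e : (2 * ((k + 1 : ℕ) : ℝ) - n) / n + 1 / n = (2 * k + 1 - n) / n + 2 / n := by
    push_cast; ring
  rw [birth, upRate, pPlus, e]
  push_cast
  field_simp
  ring

theorem four_mul_death (β : ℝ) {n : ℕ} (hn : n ≠ 0) (k : ℕ) :
    4 * death β n k = downRate β (2 / n) ((2 * k + 1 - n) / n) := by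
  have hn' : (n : ℝ) ≠ 0 := by exact_mod_cast hn
  have e : (2 * (k : ℝ) - n) / n - 1 / n = (2 * k + 1 - n) / n - 2 / n := by ring
  rw [death, downRate, pPlus, e]
  field_simp
  ring

theorem four_mul_birth_add_death (β : ℝ) {n : ℕ} (hn : n ≠ 0) (k : ℕ) :
    4 * (birth β n k + death β n (k + 1)) = 2 + 2 / n -
      2 * ((2 * k + 1 - n) / n) * tanh (β * ((2 * k + 1 - n) / n)) := by
  have hn' : (n : ℝ) ≠ 0 := by exact_mod_cast hn
  have e : (2 * ((k + 1 : ℕ) : ℝ) - n) / n - 1 / n = (2 * k + 1 - n) / n := by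
    push_cast; ring
  have e' : (2 * (k : ℝ) - n) / n + 1 / n = (2 * k + 1 - n) / n := by ring
  rw [birth, death, e, e', pPlus]
  push_cast
  field_simp
  ring

/-- Discrete gradients of a reflection symmetric function are contracted, in the weighted sense,
by one step of the chain. -/
theorem abs_layerStep_succ_sub_le {β : ℝ} (hβ : 0 < β) {n : ℕ} (hn : 4 ≤ n) (hβn : 2 * β ≤ n)
    {p : ℕ} {κ M c : ℝ} (hκ : 0 < κ) (hM : 0 < M)
    (hw : ∀ s : ℝ, 1 / n ≤ s → s ≤ 1 →
      upRate β (2 / n) s * (oddWeight p (κ * (2 / n)) (s + 2 / n) + M) +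
        downRate β (2 / n) s * (oddWeight p (κ * (2 / n)) (s - 2 / n) + M) ≤
      (2 + 2 / n - 2 * s * tanh (β * s) - 4 * c / n) * (oddWeight p (κ * (2 / n)) s + M))
    {F : ℕ → ℝ} (hF : ∀ k ≤ n, F (n - k) = F k) {a : ℝ} (ha : 0 ≤ a)
    (hD : ∀ k : ℕ, n ≤ 2 * k → k < n →
      |F (k + 1) - F k| ≤ a * (oddWeight p (κ * (2 / n)) ((2 * k + 1 - n) / n) + M))
    {k : ℕ} (hk : n ≤ 2 * k) (hkn : k < n) :
    |layerStep β n F (k + 1) - layerStep β n F k| ≤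
      a * (1 - c / n) * (oddWeight p (κ * (2 / n)) ((2 * k + 1 - n) / n) + M) := by
  have hn0 : n ≠ 0 := by omega
  have hnpos : (0 : ℝ) < n := by positivity
  have hn4 : (4 : ℝ) ≤ n := by exact_mod_cast hn
  have hk' : (n : ℝ) ≤ 2 * k := by exact_mod_cast hk
  have hkn' : (k : ℝ) + 1 ≤ n := by exact_mod_cast hkn
  set s : ℝ := (2 * k + 1 - n) / n with hs
  have hs1 : 1 / n ≤ s := by rw [hs]; gcongr; linarith
  have hs2 : s ≤ 1 := by rw [hs, div_le_one hnpos]; linarith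
  have hs0 : 0 ≤ s := le_trans (by positivity) hs1
  set W : ℝ → ℝ := fun x => oddWeight p (κ * (2 / n)) x + M with hW
  have hup : s + 2 / n = (2 * ((k + 1 : ℕ) : ℝ) + 1 - n) / n := by rw [hs]; push_cast; ring
  have key := hw s hs1 hs2
  rw [← four_mul_birth_succ β hn0, ← four_mul_death β hn0] at key
  have hbd := four_mul_birth_add_death β hn0 k
  rw [← hs] at hbd
  change _ * W (s + 2 / n) + _ * W (s - 2 / n) ≤ _ * W s at key
  rw [← hbd] at key
  have hW0 : 0 ≤ W s := add_nonneg (oddWeight_nonneg p (by positivity) hs0) hM.le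
  have hT : 0 ≤ s * tanh (β * s) := mul_nonneg hs0 (tanh_nonneg (by positivity))
  have h2n : (2 : ℝ) / n ≤ 1 / 2 := by rw [div_le_div_iff₀ hnpos two_pos]; linarith
  have hcoef : 0 ≤ 1 - birth β n k - death β n (k + 1) := by linarith
  have hb0 := birth_nonneg β (show k + 1 ≤ n from hkn)
  have hd0 := death_nonneg β n k
  have t1 : birth β n (k + 1) * |F (k + 2) - F (k + 1)| ≤
      birth β n (k + 1) * (a * W (s + 2 / n)) := by
    rcases (show k + 1 ≤ n from hkn).eq_or_lt with h | h
    · rw [h, birth_self]; simp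
    · refine mul_le_mul_of_nonneg_left ?_ hb0
      have := hD (k + 1) (by omega) h
      rw [← hup] at this; exact this
  have t2 : |F (k + 1) - F k| ≤ a * W s := hD k hk hkn
  suffices H : |layerStep β n F (k + 1) - layerStep β n F k| ≤ birth β n (k + 1) * (a * W (s + 2 / n))
      + (1 - birth β n k - death β n (k + 1)) * (a * W s) + death β n k * (a * W (s - 2 / n)) by
    refine H.trans ?_
    have h4 : 4 * c / n = 4 * (c / n) := by ring
    rw [h4] at key
    have := mul_le_mul_of_nonneg_left key ha
    change _ ≤ a * (1 - c / n) * W s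
    linarith
  rw [layerStep_succ_sub]
  rcases (show n + 2 ≤ 2 * k ∨ 2 * k = n + 1 ∨ 2 * k = n by omega) with h | h | h
  · have t3 : |F k - F (k - 1)| ≤ a * W (s - 2 / n) := by
      have h1 := hD (k - 1) (by omega) (by omega)
      rw [Nat.sub_add_cancel (by omega)] at h1
      have : s - 2 / n = (2 * ((k - 1 : ℕ) : ℝ) + 1 - n) / n := by
        rw [hs, Nat.cast_sub (by omega)]; push_cast; ring
      rw [this]; exact h1
    refine (abs_add_three _ _ _).trans ?_
    rw [abs_mul, abs_mul, abs_mul, abs_of_nonneg hb0, abs_of_nonneg hcoef, abs_of_nonneg hd0]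
    have := mul_le_mul_of_nonneg_left t2 hcoef
    have := mul_le_mul_of_nonneg_left t3 hd0
    linarith
  · have t3 : F k - F (k - 1) = 0 := by
      rw [← hF k (by omega), show n - k = k - 1 by omega, sub_self]
    have hz : s - 2 / n = 0 := by
      have : (2 * k : ℝ) = n + 1 := by exact_mod_cast h
      rw [hs, this]; ring
    have hW1 : 0 ≤ W (s - 2 / n) := by simp [hz, hW, oddWeight, hM.le]
    rw [t3, mul_zero, add_zero]
    refine (abs_add_le _ _).trans ?_
    rw [abs_mul, abs_mul, abs_of_nonneg hb0, abs_of_nonneg hcoef]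
    have := mul_le_mul_of_nonneg_left t2 hcoef
    have : 0 ≤ death β n k * (a * W (s - 2 / n)) := by positivity
    linarith
  · have t3 : F k - F (k - 1) = -(F (k + 1) - F k) := by
      rw [← hF (k - 1) (by omega), show n - (k - 1) = k + 1 by omega]; ring
    have hkn2 : (2 * k : ℝ) = n := by exact_mod_cast h
    have hsn : s = 1 / n := by rw [hs, hkn2]; ring
    have hz : s - 2 / n = -s := by rw [hsn]; ring
    have hWneg : -W s ≤ W (s - 2 / n) := by
      simp only [hz, hW, oddWeight_neg]; linarith
    have hdk : 4 * death β n k ≤ 3 / 2 := by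
      rw [four_mul_death β hn0, ← hs, downRate, hz, hsn, mul_neg, tanh_neg]
      have hβ2 : β * (1 / n) ≤ 1 / 2 := by rw [mul_one_div, div_le_div_iff₀ hnpos two_pos]; linarith
      have h1 := (tanh_le_self (x := β * (1 / n)) (by positivity)).trans hβ2
      have h2 : 1 + 1 / (n : ℝ) - 2 / n / 2 = 1 := by ring
      rw [h2]; linarith
    have hco : 0 ≤ 1 - birth β n k - death β n (k + 1) - death β n k := by linarith
    rw [t3, show birth β n (k + 1) * (F (k + 2) - F (k + 1)) +
      (1 - birth β n k - death β n (k + 1)) * (F (k + 1) - F k) +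
      death β n k * -(F (k + 1) - F k) = birth β n (k + 1) * (F (k + 2) - F (k + 1)) +
      (1 - birth β n k - death β n (k + 1) - death β n k) * (F (k + 1) - F k) by ring]
    refine (abs_add_le _ _).trans ?_
    rw [abs_mul, abs_mul, abs_of_nonneg hb0, abs_of_nonneg hco]
    have i1 := mul_le_mul_of_nonneg_left t2 hco
    have i2 := mul_le_mul_of_nonneg_left hWneg (mul_nonneg ha hd0)
    linarith

theorem layerStep_iterate_reflect (β : ℝ) {n : ℕ} {F : ℕ → ℝ} (hF : ∀ k ≤ n, F (n - k) = F k)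
    (t : ℕ) : ∀ k ≤ n, (layerStep β n)^[t] F (n - k) = (layerStep β n)^[t] F k := by
  induction t with
  | zero => simpa using hF
  | succ t ih =>
    intro k hk
    rw [Function.iterate_succ_apply']
    exact layerStep_reflect β ih hk

theorem abs_sub_last_le {F : ℕ → ℝ} {n : ℕ} {b : ℝ} {j : ℕ}
    (h : ∀ k, j ≤ k → k < n → |F (k + 1) - F k| ≤ b) (hj : j ≤ n) :
    |F j - F n| ≤ (n - j : ℕ) * b := by
  induction n, hj using Nat.le_induction with
  | base => simp
  | succ m hm ih =>
    have h1 := ih fun k hk hkm => h k hk (by omega)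
    have h2 := h m hm (by omega)
    rw [abs_sub_comm] at h2
    have h3 := abs_sub_le (F j) (F m) (F (m + 1))
    rw [Nat.sub_add_comm hm]
    push_cast
    linarith

/-- Reflection symmetric functions are flattened exponentially fast, at rate of order `1 / n`. -/
theorem exists_layer_flattening {β : ℝ} (hβ : 1 < β) : ∃ (A c : ℝ) (p n₀ : ℕ), 0 < A ∧ 0 < c ∧
    1 ≤ n₀ ∧ ∀ n : ℕ, n₀ ≤ n → c ≤ n ∧ ∀ F : ℕ → ℝ, (∀ k ≤ n, F (n - k) = F k) →
      (∀ k ≤ n, |F k| ≤ 1) → ∀ t j k : ℕ, j ≤ n → k ≤ n →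
        |(layerStep β n)^[t] F j - (layerStep β n)^[t] F k| ≤
          A * (n : ℝ) ^ p * (1 - c / n) ^ t := by
  obtain ⟨p, κ, M, c, h₀, hκ, hM, hc, hh₀, hsup⟩ := exists_supersolution hβ
  set A' := 1 / (2 * κ) ^ p + M with hA'
  have hA'0 : 0 < A' := by positivity
  set n₀ := 4 + ⌈2 * β⌉₊ + ⌈c⌉₊ + ⌈2 / h₀⌉₊
  refine ⟨4 / M * A', c, p + 1, n₀, by positivity, hc, by omega, fun n hn => ?_⟩
  have hn' : (4 : ℝ) + ⌈2 * β⌉₊ + ⌈c⌉₊ + ⌈2 / h₀⌉₊ ≤ n := by exact_mod_cast hn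
  have i1 := Nat.le_ceil (2 * β)
  have i2 := Nat.le_ceil c
  have i3 := Nat.le_ceil (2 / h₀)
  have z1 : (0 : ℝ) ≤ ⌈2 * β⌉₊ := Nat.cast_nonneg _
  have z2 : (0 : ℝ) ≤ ⌈c⌉₊ := Nat.cast_nonneg _
  have z3 : (0 : ℝ) ≤ ⌈2 / h₀⌉₊ := Nat.cast_nonneg _
  have hcn : c ≤ n := by linarith
  refine ⟨hcn, fun F hF hF1 t => ?_⟩
  have hn0 : (0 : ℝ) < n := by linarith
  have hnh : 2 / (n : ℝ) ≤ h₀ := by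
    rw [div_le_comm₀ hn0 hh₀]; linarith
  have hfac : 0 ≤ 1 - c / n := by rw [sub_nonneg, div_le_one hn0]; exact hcn
  have hw : ∀ s : ℝ, 1 / n ≤ s → s ≤ 1 →
      upRate β (2 / n) s * (oddWeight p (κ * (2 / n)) (s + 2 / n) + M) +
        downRate β (2 / n) s * (oddWeight p (κ * (2 / n)) (s - 2 / n) + M) ≤
      (2 + 2 / n - 2 * s * tanh (β * s) - 4 * c / n) * (oddWeight p (κ * (2 / n)) s + M) := by
    intro s hs hs1
    have := hsup (2 / n) s (by positivity) hnh (by rwa [div_right_comm, div_self two_ne_zero]) hs1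
    rwa [show 2 * c * (2 / (n : ℝ)) = 4 * c / n by ring] at this
  have hgrad : ∀ k : ℕ, n ≤ 2 * k → k < n →
      |(layerStep β n)^[t] F (k + 1) - (layerStep β n)^[t] F k| ≤
      2 / M * (1 - c / n) ^ t * (oddWeight p (κ * (2 / n)) ((2 * k + 1 - n) / n) + M) := by
    induction t with
    | zero =>
      intro k hk hkn
      have h1 := abs_le.1 (hF1 k hkn.le)
      have h2 := abs_le.1 (hF1 (k + 1) hkn)
      have h3 : |F (k + 1) - F k| ≤ 2 := by rw [abs_le]; constructor <;> linarith
      have h4 : 0 ≤ oddWeight p (κ * (2 / n)) ((2 * k + 1 - n) / n) := by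
        have : (n : ℝ) ≤ 2 * k := by exact_mod_cast hk
        exact oddWeight_nonneg p (by positivity) (div_nonneg (by linarith) hn0.le)
      have h5 : 2 / M * M ≤ 2 / M * (oddWeight p (κ * (2 / n)) ((2 * k + 1 - n) / n) + M) := by
        gcongr; linarith
      rw [div_mul_cancel₀ _ hM.ne'] at h5
      simpa using h3.trans h5
    | succ t ih =>
      intro k hk hkn
      rw [Function.iterate_succ_apply', pow_succ, ← mul_assoc]
      exact abs_layerStep_succ_sub_le (by linarith)
        (by have : (4 : ℝ) ≤ n := by linarith
            exact_mod_cast this) (by linarith) hκ hM hw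
        (layerStep_iterate_reflect β hF t) (by positivity) ih hk hkn
  have hgrad' : ∀ k : ℕ, n ≤ 2 * k → k < n →
      |(layerStep β n)^[t] F (k + 1) - (layerStep β n)^[t] F k| ≤
      2 / M * (1 - c / n) ^ t * (A' * n ^ p) := by
    intro k hk hkn
    refine (hgrad k hk hkn).trans ?_
    refine mul_le_mul_of_nonneg_left ?_ (by positivity)
    have hk1 : (n : ℝ) ≤ 2 * k := by exact_mod_cast hk
    have hk2 : (k : ℝ) + 1 ≤ n := by exact_mod_cast hkn
    have hs1 : (2 * (k : ℝ) + 1 - n) / n ≤ 1 := by rw [div_le_one hn0]; linarith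
    have hn1 : (1 : ℝ) ≤ n ^ p := one_le_pow₀ (by linarith)
    have hv : oddWeight p (κ * (2 / n)) ((2 * k + 1 - n) / n) ≤ 1 / (2 * κ) ^ p * n ^ p := by
      unfold oddWeight
      have : (κ * (2 / n)) ^ p ≤ (((2 * (k : ℝ) + 1 - n) / n) ^ 2 + κ * (2 / n)) ^ p := by
        gcongr
        have := sq_nonneg ((2 * (k : ℝ) + 1 - n) / n)
        linarith
      calc _ ≤ 1 / (κ * (2 / n)) ^ p := by gcongr
        _ = _ := by
          rw [show κ * (2 / (n : ℝ)) = 2 * κ / n by ring, div_pow, one_div_div, div_mul_eq_mul_div,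
            one_mul]
    have : M * 1 ≤ M * n ^ p := by gcongr
    rw [hA']
    linarith
  have hlast : ∀ j ≤ n, |(layerStep β n)^[t] F j - (layerStep β n)^[t] F n| ≤
      n * (2 / M * (1 - c / n) ^ t * (A' * n ^ p)) := by
    have main : ∀ j ≤ n, n ≤ 2 * j → |(layerStep β n)^[t] F j - (layerStep β n)^[t] F n| ≤
      n * (2 / M * (1 - c / n) ^ t * (A' * n ^ p)) := by
      intro j hj hj2
      refine (abs_sub_last_le (fun k hjk hkn => hgrad' k (by omega) hkn) hj).trans ?_
      gcongr
      exact_mod_cast Nat.sub_le n j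
    intro j hj
    rcases le_total n (2 * j) with h | h
    · exact main j hj h
    · rw [← layerStep_iterate_reflect β hF t j hj]
      exact main (n - j) (by omega) (by omega)
  intro j k hj hk
  have h1 := hlast j hj
  have h2 := hlast k hk
  rw [abs_sub_comm] at h2
  have h3 := abs_sub_le ((layerStep β n)^[t] F j) ((layerStep β n)^[t] F n)
    ((layerStep β n)^[t] F k)
  calc _ ≤ n * (2 / M * (1 - c / n) ^ t * (A' * n ^ p)) +
      n * (2 / M * (1 - c / n) ^ t * (A' * n ^ p)) := by linarith
    _ = _ := by ring

/-- Probability that a refresh at site `i` produces a `+` spin. -/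
def plusProb (β : ℝ) {n : ℕ} (σ : Config n) (i : Fin n) : ℝ := pPlus β (mag σ - spin σ i / n)

/-- The Markov operator of the Glauber dynamics. -/
def glauberOp (β : ℝ) (n : ℕ) (h : Config n → ℝ) (σ : Config n) : ℝ :=
  (1 / n) * ∑ i, (plusProb β σ i * h (Function.update σ i true) +
    (1 - plusProb β σ i) * h (Function.update σ i false))

/-- Reflection of a configuration into `Ω⁺`. -/
def fold {n : ℕ} (σ : Config n) : Config n := if 0 ≤ mag σ then σ else negConfig σ

/-- The Markov operator of the restricted Glauber dynamics. -/
def restrictedOp (β : ℝ) (n : ℕ) (f : Config n → ℝ) : Config n → ℝ :=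
  glauberOp β n fun σ => f (fold σ)

section basic

variable {n : ℕ} (β : ℝ)

theorem negConfig_negConfig (σ : Config n) : negConfig (negConfig σ) = σ := by
  ext i; simp [negConfig]

theorem spin_negConfig (σ : Config n) (i : Fin n) : spin (negConfig σ) i = -spin σ i := by
  cases h : σ i <;> simp [spin, negConfig, h]

theorem mag_negConfig (σ : Config n) : mag (negConfig σ) = -mag σ := by
  simp [mag, spin_negConfig, neg_div]

theorem spin_sq (σ : Config n) (i : Fin n) : spin σ i ^ 2 = 1 := by
  cases h : σ i <;> simp [spin, h]

theorem abs_spin (σ : Config n) (i : Fin n) : |spin σ i| = 1 := by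
  cases h : σ i <;> simp [spin, h]

theorem plusProb_nonneg (σ : Config n) (i : Fin n) : 0 ≤ plusProb β σ i := (pPlus_pos _ _).le

theorem plusProb_le_one (σ : Config n) (i : Fin n) : plusProb β σ i ≤ 1 := (pPlus_lt_one _ _).le

theorem sum_glauberKernel_mul (σ : Config n) (h : Config n → ℝ) :
    ∑ η, glauberKernel β n σ η * h η = glauberOp β n h σ := by
  simp only [glauberKernel, glauberOp, mul_assoc, Finset.sum_mul, Finset.mul_sum]
  rw [Finset.sum_comm]
  refine Finset.sum_congr rfl fun i _ => ?_
  rw [← Finset.mul_sum]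
  congr 1
  have hne : Function.update σ i true ≠ Function.update σ i false := fun e => by
    have := congrFun e i; simp at this
  rw [← Finset.sum_subset (Finset.subset_univ {Function.update σ i true, Function.update σ i false}),
    Finset.sum_pair hne]
  · have h1 : ∀ b, ∀ j, j ≠ i → Function.update σ i b j = σ j := fun b j hj => by simp [hj]
    rw [if_pos (h1 true), if_pos (h1 false)]
    simp [plusProb]
  · intro η _ hη
    rw [if_neg, zero_mul]
    intro hall
    apply hη
    have : η = Function.update σ i (η i) := by
      ext j
      by_cases hj : j = i
      · subst hj; simp
      · simp [hj, hall j hj]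
    rw [this]
    cases η i <;> simp

theorem sum_negConfig (g : Config n → ℝ) : ∑ η, g (negConfig η) = ∑ η, g η :=
  Fintype.sum_equiv ⟨negConfig, negConfig, negConfig_negConfig, negConfig_negConfig⟩ _ _
    fun _ => rfl

theorem sum_rKernel_mul (σ : Config n) (f : Config n → ℝ) :
    ∑ η, rKernel β n σ η * f η = restrictedOp β n f σ := by
  rw [restrictedOp, ← sum_glauberKernel_mul]
  simp only [rKernel, add_mul, Finset.sum_add_distrib]
  rw [← sum_negConfig fun η => (if mag (negConfig η) < 0 then
    glauberKernel β n σ (negConfig η) else 0) * f η, ← Finset.sum_add_distrib]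
  refine Finset.sum_congr rfl fun η _ => ?_
  simp only [negConfig_negConfig, fold]
  by_cases h : 0 ≤ mag η
  · simp [h, not_lt.2 h]
  · simp [h, not_le.1 h]

theorem sum_rLaw_mul (t : ℕ) (σ : Config n) (f : Config n → ℝ) :
    ∑ η, rLaw β n t σ η * f η = (restrictedOp β n)^[t] f σ := by
  induction t generalizing f with
  | zero => simp [rLaw]
  | succ t ih =>
    rw [Function.iterate_succ_apply, ← ih]
    simp only [rLaw, Finset.sum_mul]
    rw [Finset.sum_comm]
    refine Finset.sum_congr rfl fun τ _ => ?_
    rw [← sum_rKernel_mul, Finset.mul_sum]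
    simp only [mul_assoc]

theorem glauberOp_add (f g : Config n → ℝ) (σ : Config n) :
    glauberOp β n (fun τ => f τ + g τ) σ = glauberOp β n f σ + glauberOp β n g σ := by
  simp only [glauberOp, ← mul_add, ← Finset.sum_add_distrib]
  congr 1
  exact Finset.sum_congr rfl fun i _ => by ring

theorem glauberOp_const_mul (a : ℝ) (f : Config n → ℝ) (σ : Config n) :
    glauberOp β n (fun τ => a * f τ) σ = a * glauberOp β n f σ := by
  simp only [glauberOp, Finset.mul_sum]
  exact Finset.sum_congr rfl fun i _ => by ring

theorem glauberOp_const (hn : n ≠ 0) (a : ℝ) (σ : Config n) :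
    glauberOp β n (fun _ => a) σ = a := by
  have : (n : ℝ) ≠ 0 := by exact_mod_cast hn
  simp only [glauberOp, ← add_mul, add_sub_cancel, one_mul]
  simp; field_simp

theorem glauberOp_mono {f g : Config n → ℝ} (hfg : ∀ σ, f σ ≤ g σ) (σ : Config n) :
    glauberOp β n f σ ≤ glauberOp β n g σ := by
  refine mul_le_mul_of_nonneg_left (Finset.sum_le_sum fun i _ => ?_) (by positivity)
  have h1 := mul_le_mul_of_nonneg_left (hfg (Function.update σ i true)) (plusProb_nonneg β σ i)
  have h2 := mul_le_mul_of_nonneg_left (hfg (Function.update σ i false))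
    (sub_nonneg.2 (plusProb_le_one β σ i))
  linarith

theorem glauberOp_finset_sum {ι : Type*} (s : Finset ι) (f : ι → Config n → ℝ) (σ : Config n) :
    glauberOp β n (fun τ => ∑ i ∈ s, f i τ) σ = ∑ i ∈ s, glauberOp β n (f i) σ := by
  simp only [glauberOp, Finset.mul_sum, ← Finset.sum_add_distrib]
  rw [Finset.sum_comm]

theorem spin_comp (σ : Config n) (ρ : Equiv.Perm (Fin n)) (i : Fin n) :
    spin (σ ∘ ρ) i = spin σ (ρ i) := rfl

theorem mag_comp (σ : Config n) (ρ : Equiv.Perm (Fin n)) : mag (σ ∘ ρ) = mag σ := by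
  simp only [mag, spin_comp, Equiv.sum_comp ρ fun i => spin σ i]

theorem update_comp (σ : Config n) (ρ : Equiv.Perm (Fin n)) (i : Fin n) (b : Bool) :
    Function.update (σ ∘ ρ) i b = Function.update σ (ρ i) b ∘ ρ := by
  rw [Function.update_comp_equiv, Equiv.symm_apply_apply]

theorem glauberOp_comp_perm (h : Config n → ℝ) (ρ : Equiv.Perm (Fin n)) (σ : Config n) :
    glauberOp β n h (σ ∘ ρ) = glauberOp β n (fun τ => h (τ ∘ ρ)) σ := by
  simp only [glauberOp, plusProb, mag_comp, spin_comp, update_comp]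
  congr 1
  exact Equiv.sum_comp ρ fun i => pPlus β (mag σ - spin σ i / n) * h (Function.update σ i true ∘ ρ) +
    (1 - pPlus β (mag σ - spin σ i / n)) * h (Function.update σ i false ∘ ρ)

theorem negConfig_update (σ : Config n) (i : Fin n) (b : Bool) :
    Function.update (negConfig σ) i b = negConfig (Function.update σ i (!b)) := by
  ext j
  by_cases hj : j = i
  · subst hj; simp [negConfig]
  · simp [negConfig, hj]

theorem glauberOp_negConfig (h : Config n → ℝ) (σ : Config n) :
    glauberOp β n h (negConfig σ) = glauberOp β n (fun τ => h (negConfig τ)) σ := by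
  simp only [glauberOp, plusProb, mag_negConfig, spin_negConfig, negConfig_update]
  congr 1
  refine Finset.sum_congr rfl fun i _ => ?_
  rw [show -mag σ - -spin σ i / n = -(mag σ - spin σ i / n) by ring, pPlus_neg]
  simp only [Bool.not_true, Bool.not_false]
  ring

theorem negConfig_comp (σ : Config n) (ρ : Equiv.Perm (Fin n)) :
    negConfig (σ ∘ ρ) = negConfig σ ∘ ρ := rfl

theorem fold_comp (σ : Config n) (ρ : Equiv.Perm (Fin n)) : fold (σ ∘ ρ) = fold σ ∘ ρ := by
  simp only [fold, mag_comp, negConfig_comp]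
  split_ifs <;> rfl

theorem restrictedOp_comp_perm (f : Config n → ℝ) (ρ : Equiv.Perm (Fin n)) (σ : Config n) :
    restrictedOp β n f (σ ∘ ρ) = restrictedOp β n (fun τ => f (τ ∘ ρ)) σ := by
  simp only [restrictedOp, glauberOp_comp_perm, fold_comp]

theorem fold_eq_of_even {f : Config n → ℝ} (hf : ∀ σ, f (negConfig σ) = f σ) (σ : Config n) :
    f (fold σ) = f σ := by
  rw [fold]; split_ifs
  · rfl
  · exact hf σ

theorem glauberOp_iterate_even {f : Config n → ℝ} (hf : ∀ σ, f (negConfig σ) = f σ) (t : ℕ) :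
    ∀ σ, (glauberOp β n)^[t] f (negConfig σ) = (glauberOp β n)^[t] f σ := by
  induction t with
  | zero => exact hf
  | succ t ih =>
    intro σ
    rw [Function.iterate_succ_apply', glauberOp_negConfig]
    simp only [ih]

theorem restrictedOp_iterate_of_even {f : Config n → ℝ} (hf : ∀ σ, f (negConfig σ) = f σ) (t : ℕ) :
    (restrictedOp β n)^[t] f = (glauberOp β n)^[t] f := by
  induction t with
  | zero => rfl
  | succ t ih =>
    rw [Function.iterate_succ_apply', Function.iterate_succ_apply', ih, restrictedOp]
    simp only [fold_eq_of_even (glauberOp_iterate_even β hf t)]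

end basic

theorem pPlus_mono {β : ℝ} (hβ : 0 ≤ β) {x y : ℝ} (h : x ≤ y) : pPlus β x ≤ pPlus β y := by
  have := strictMono_tanh.monotone (mul_le_mul_of_nonneg_left h hβ)
  simp only [pPlus]; linarith

theorem comp_swap_eq_self {n : ℕ} {σ : Config n} {i j : Fin n} (h : σ i = σ j) :
    σ ∘ Equiv.swap i j = σ := by
  ext k
  simp only [Function.comp, Equiv.swap_apply_def]
  split_ifs with h1 h2
  · rw [h1, h]
  · rw [h2, h]
  · rfl

theorem abs_glauberOp_sub_swap_le {β : ℝ} (hβ : 0 ≤ β) {n : ℕ} {h : Config n → ℝ} {c : ℝ}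
    (hc : ∀ σ i j, |h σ - h (σ ∘ Equiv.swap i j)| ≤ c) (σ : Config n) (i j : Fin n) :
    |glauberOp β n h σ - glauberOp β n h (σ ∘ Equiv.swap i j)| ≤ (1 - 1 / n) * c := by
  have hn1 : (1 : ℝ) ≤ n := by
    have := i.pos
    exact_mod_cast this
  have hc0 : 0 ≤ c := (abs_nonneg _).trans (hc σ i j)
  have hn0 : (0 : ℝ) < n := by linarith
  have hfac : (0 : ℝ) ≤ 1 - 1 / n := by
    rw [sub_nonneg, div_le_one hn0]; exact hn1
  have main : ∀ i j : Fin n, σ i = true → σ j = false →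
      |glauberOp β n h σ - glauberOp β n h (σ ∘ Equiv.swap i j)| ≤ (1 - 1 / n) * c := by
    intro i j hi hj
    have hij : i ≠ j := fun e => by rw [e, hj] at hi; exact absurd hi (by simp)
    have hp : plusProb β σ i ≤ plusProb β σ j := by
      apply pPlus_mono hβ
      have : (0 : ℝ) ≤ 1 / n := by positivity
      simp only [spin, hi, hj, if_true, Bool.false_eq_true, if_false, neg_div]
      linarith
    rw [glauberOp_comp_perm]
    simp only [glauberOp]
    rw [← mul_sub, ← Finset.sum_sub_distrib, abs_mul, abs_of_nonneg (by positivity : (0 : ℝ) ≤ 1 / n)]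
    have hterm : ∀ k ∈ Finset.univ, |plusProb β σ k * h (Function.update σ k true) +
        (1 - plusProb β σ k) * h (Function.update σ k false) -
        (plusProb β σ k * h (Function.update σ k true ∘ Equiv.swap i j) +
        (1 - plusProb β σ k) * h (Function.update σ k false ∘ Equiv.swap i j))| ≤
        c * (1 - (if k = i then 1 - plusProb β σ i else 0) -
          (if k = j then plusProb β σ j else 0)) := by
      intro k _
      have h0 := plusProb_nonneg β σ k
      have h1 := plusProb_le_one β σ k
      have hT := hc (Function.update σ k true) i j
      have hF := hc (Function.update σ k false) i j
      by_cases hki : k = i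
      · subst hki
        rw [comp_swap_eq_self (σ := Function.update σ k false) (by simp [hij.symm, hj])]
        rw [if_pos rfl, if_neg hij, add_sub_add_right_eq_sub, ← mul_sub, abs_mul, abs_of_nonneg h0]
        nlinarith only [h0, hT]
      by_cases hkj : k = j
      · subst hkj
        rw [comp_swap_eq_self (σ := Function.update σ k true) (by simp [hij, hi])]
        rw [if_pos rfl, if_neg hki, add_sub_add_left_eq_sub, ← mul_sub, abs_mul,
          abs_of_nonneg (sub_nonneg.2 h1)]
        nlinarith only [h1, hF]
      rw [if_neg hki, if_neg hkj, add_sub_add_comm, ← mul_sub, ← mul_sub]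
      refine (abs_add_le _ _).trans ?_
      rw [abs_mul, abs_mul, abs_of_nonneg h0, abs_of_nonneg (sub_nonneg.2 h1)]
      nlinarith only [h0, h1, hT, hF]
    refine (mul_le_mul_of_nonneg_left ((Finset.abs_sum_le_sum_abs _ _).trans
      (Finset.sum_le_sum hterm)) (by positivity)).trans ?_
    rw [← Finset.mul_sum, Finset.sum_sub_distrib, Finset.sum_sub_distrib]
    simp only [Finset.sum_const, Finset.card_univ, Fintype.card_fin, nsmul_eq_mul, mul_one,
      Finset.sum_ite_eq', Finset.mem_univ, if_true]
    have : (1 - 1 / (n : ℝ)) * c = 1 / n * (c * (n - 1)) := by field_simp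
    rw [this]
    refine mul_le_mul_of_nonneg_left (mul_le_mul_of_nonneg_left ?_ hc0) (by positivity)
    linarith
  cases hi : σ i <;> cases hj : σ j
  · rw [comp_swap_eq_self (by rw [hi, hj]), sub_self, abs_zero]; positivity
  · rw [Equiv.swap_comm]; exact main j i hj hi
  · exact main i j hi hj
  · rw [comp_swap_eq_self (by rw [hi, hj]), sub_self, abs_zero]; positivity

theorem abs_restrictedOp_iterate_sub_swap_le {β : ℝ} (hβ : 0 ≤ β) {n : ℕ} {h : Config n → ℝ}
    {c : ℝ} (hc : ∀ σ i j, |h σ - h (σ ∘ Equiv.swap i j)| ≤ c) (t : ℕ) :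
    ∀ σ i j, |(restrictedOp β n)^[t] h σ - (restrictedOp β n)^[t] h (σ ∘ Equiv.swap i j)| ≤
      (1 - 1 / n) ^ t * c := by
  induction t with
  | zero => simpa using hc
  | succ t ih =>
    intro σ i j
    rw [Function.iterate_succ_apply', pow_succ', mul_assoc]
    refine abs_glauberOp_sub_swap_le hβ (fun τ k l => ?_) σ i j
    rw [fold_comp]
    exact ih _ k l

theorem abs_sub_comp_perm_le {n : ℕ} {h : Config n → ℝ} {c : ℝ} (hc0 : 0 ≤ c)
    (hc : ∀ σ i j, |h σ - h (σ ∘ Equiv.swap i j)| ≤ c) (ρ : Equiv.Perm (Fin n)) (σ : Config n) :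
    |h σ - h (σ ∘ ρ)| ≤ n * c := by
  have key : ∀ m : ℕ, ∀ ρ : Equiv.Perm (Fin n), ρ.support.card ≤ m → ∀ σ : Config n,
      |h σ - h (σ ∘ ρ)| ≤ m * c := by
    intro m
    induction m with
    | zero =>
      intro ρ hρ σ
      have : ρ = 1 := by
        rw [← Equiv.Perm.support_eq_empty_iff]
        exact Finset.card_eq_zero.1 (Nat.le_zero.1 hρ)
      subst this
      simp
    | succ m ih =>
      intro ρ hρ σ
      by_cases h1 : ρ = 1
      · subst h1
        simp; positivity
      obtain ⟨x, hx⟩ : ∃ x, ρ x ≠ x := by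
        by_contra! hh
        exact h1 (Equiv.ext hh)
      have hlt := Equiv.Perm.card_support_swap_mul hx
      have h2 := ih (Equiv.swap x (ρ x) * ρ) (by omega) (σ ∘ Equiv.swap x (ρ x))
      have h3 : (σ ∘ Equiv.swap x (ρ x)) ∘ (Equiv.swap x (ρ x) * ρ : Equiv.Perm (Fin n)) = σ ∘ ρ := by
        ext k; simp
      rw [h3] at h2
      have h4 := hc σ x (ρ x)
      have := abs_sub_le (h σ) (h (σ ∘ Equiv.swap x (ρ x))) (h (σ ∘ ρ))
      push_cast
      linarith
  refine key n ρ ?_ σ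
  simpa using Finset.card_le_univ ρ.support

/-- Average of a function over all permutations of the vertices. -/
def symm {n : ℕ} (f : Config n → ℝ) (σ : Config n) : ℝ :=
  (1 / (n.factorial : ℝ)) * ∑ ρ : Equiv.Perm (Fin n), f (σ ∘ ρ)

theorem symm_comp {n : ℕ} (f : Config n → ℝ) (σ : Config n) (ρ : Equiv.Perm (Fin n)) :
    symm f (σ ∘ ρ) = symm f σ := by
  simp only [symm]
  congr 1
  exact Fintype.sum_equiv (Equiv.mulLeft ρ) _ _ fun τ => rfl

theorem sum_perm_one (n : ℕ) : (1 / (n.factorial : ℝ)) * ∑ _ρ : Equiv.Perm (Fin n), (1 : ℝ) = 1 := by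
  have : (n.factorial : ℝ) ≠ 0 := by exact_mod_cast n.factorial_ne_zero
  simp [Fintype.card_perm, this]

theorem abs_sub_symm_le {n : ℕ} {f : Config n → ℝ} {c : ℝ} {σ : Config n}
    (hc : ∀ ρ : Equiv.Perm (Fin n), |f σ - f (σ ∘ ρ)| ≤ c) : |f σ - symm f σ| ≤ c := by
  have h1 : f σ - symm f σ =
      (1 / (n.factorial : ℝ)) * ∑ ρ : Equiv.Perm (Fin n), (f σ - f (σ ∘ ρ)) := by
    have h2 : ∑ _ρ : Equiv.Perm (Fin n), f σ = f σ * ∑ _ρ : Equiv.Perm (Fin n), (1 : ℝ) := by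
      rw [Finset.mul_sum]; simp only [mul_one]
    rw [Finset.sum_sub_distrib, h2, symm]
    linear_combination (-f σ) * sum_perm_one n
  rw [h1, abs_mul, abs_of_nonneg (by positivity)]
  calc _ ≤ (1 / (n.factorial : ℝ)) * ∑ ρ : Equiv.Perm (Fin n), c * 1 := by
        refine mul_le_mul_of_nonneg_left ((Finset.abs_sum_le_sum_abs _ _).trans
          (Finset.sum_le_sum fun ρ _ => ?_)) (by positivity)
        rw [mul_one]; exact hc ρ
    _ = c := by rw [← Finset.mul_sum]; linear_combination c * sum_perm_one n

theorem abs_symm_le {n : ℕ} {f : Config n → ℝ} {c : ℝ} (hc : ∀ σ, |f σ| ≤ c) (σ : Config n) :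
    |symm f σ| ≤ c := by
  rw [symm, abs_mul, abs_of_nonneg (by positivity)]
  calc _ ≤ (1 / (n.factorial : ℝ)) * ∑ ρ : Equiv.Perm (Fin n), c * 1 := by
        refine mul_le_mul_of_nonneg_left ((Finset.abs_sum_le_sum_abs _ _).trans
          (Finset.sum_le_sum fun ρ _ => ?_)) (by positivity)
        rw [mul_one]; exact hc _
    _ = c := by rw [← Finset.mul_sum]; linear_combination c * sum_perm_one n

theorem restrictedOp_symm (β : ℝ) {n : ℕ} (f : Config n → ℝ) :
    restrictedOp β n (symm f) = symm (restrictedOp β n f) := by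
  ext σ
  simp only [symm, restrictedOp_comp_perm]
  simp only [restrictedOp, symm, glauberOp_const_mul, glauberOp_finset_sum]

theorem restrictedOp_iterate_symm (β : ℝ) {n : ℕ} (f : Config n → ℝ) (t : ℕ) :
    (restrictedOp β n)^[t] (symm f) = symm ((restrictedOp β n)^[t] f) := by
  induction t with
  | zero => rfl
  | succ t ih => rw [Function.iterate_succ_apply', Function.iterate_succ_apply', ih, restrictedOp_symm]

theorem abs_restrictedOp_iterate_sub_symm_le {β : ℝ} (hβ : 0 ≤ β) {n : ℕ} {f : Config n → ℝ}
    (hf : ∀ σ, |f σ| ≤ 1) (hn : n ≠ 0) (t : ℕ) (σ : Config n) :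
    |(restrictedOp β n)^[t] f σ - (restrictedOp β n)^[t] (symm f) σ| ≤
      n * ((1 - 1 / n) ^ t * 2) := by
  rw [restrictedOp_iterate_symm]
  have hn1 : (1 : ℝ) ≤ n := by exact_mod_cast Nat.one_le_iff_ne_zero.2 hn
  have hfac : (0 : ℝ) ≤ 1 - 1 / n := by
    rw [sub_nonneg, div_le_one (by linarith)]; exact hn1
  refine abs_sub_symm_le fun ρ => abs_sub_comp_perm_le (by positivity)
    (abs_restrictedOp_iterate_sub_swap_le hβ (fun τ i j => ?_) t) ρ σ
  have := abs_sub (f τ) (f (τ ∘ Equiv.swap i j))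
  linarith [hf τ, hf (τ ∘ Equiv.swap i j)]

/-- The number of `+` spins. -/
def numPlus {n : ℕ} (σ : Config n) : ℕ := (Finset.univ.filter fun i => σ i = true).card

theorem numPlus_le {n : ℕ} (σ : Config n) : numPlus σ ≤ n := by
  simpa [numPlus] using Finset.card_le_univ (Finset.univ.filter fun i => σ i = true)

theorem numPlus_negConfig {n : ℕ} (σ : Config n) : numPlus (negConfig σ) = n - numPlus σ := by
  have := Finset.card_filter_add_card_filter_not (s := (Finset.univ : Finset (Fin n)))
    (fun i => σ i = true)
  simp only [Finset.card_univ, Fintype.card_fin] at this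
  have h2 : numPlus (negConfig σ) = (Finset.univ.filter fun i => ¬ σ i = true).card := by
    simp [numPlus, negConfig]
  rw [h2]; unfold numPlus; omega

theorem sum_spin {n : ℕ} (σ : Config n) : ∑ i, spin σ i = 2 * numPlus σ - n := by
  have : ∀ i, spin σ i = 2 * (if σ i = true then 1 else 0) - 1 := fun i => by
    simp only [spin]; split_ifs <;> norm_num
  simp only [this, Finset.sum_sub_distrib, ← Finset.mul_sum, Finset.sum_boole, numPlus]
  simp

theorem mag_eq {n : ℕ} (σ : Config n) : mag σ = (2 * numPlus σ - n) / n := by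
  rw [mag, sum_spin]

theorem sum_spin_update {n : ℕ} (σ : Config n) (k : Fin n) (b : Bool) :
    ∑ j, spin (Function.update σ k b) j = ∑ j, spin σ j - spin σ k + (if b then 1 else -1) := by
  rw [← Finset.add_sum_erase _ _ (Finset.mem_univ k),
    ← Finset.add_sum_erase _ (spin σ) (Finset.mem_univ k)]
  have : ∑ x ∈ Finset.univ.erase k, spin (Function.update σ k b) x =
      ∑ x ∈ Finset.univ.erase k, spin σ x := Finset.sum_congr rfl fun x hx => by
    simp [spin, Finset.ne_of_mem_erase hx]
  rw [this]; simp only [spin, Function.update_self]; ring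

theorem numPlus_update {n : ℕ} (σ : Config n) (i : Fin n) (b : Bool) :
    numPlus (Function.update σ i b) + (if σ i then 1 else 0) =
      numPlus σ + (if b then 1 else 0) := by
  have h1 := sum_spin (Function.update σ i b)
  have h2 := sum_spin σ
  have h3 := sum_spin_update σ i b
  have h4 : (numPlus (Function.update σ i b) : ℝ) + (if σ i then 1 else 0) =
      numPlus σ + (if b then 1 else 0) := by
    simp only [spin] at h3
    simp only [spin] at h1 h2
    rw [h1, h2] at h3
    cases b <;> cases hi : σ i <;> simp [hi] at h3 ⊢ <;> linarith
  cases b <;> cases hi : σ i <;> simp [hi] at h4 ⊢ <;> exact_mod_cast h4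

theorem glauberOp_numPlus (β : ℝ) {n : ℕ} (hn : n ≠ 0) (F : ℕ → ℝ) (σ : Config n) :
    glauberOp β n (fun τ => F (numPlus τ)) σ = layerStep β n F (numPlus σ) := by
  have hn0 : (n : ℝ) ≠ 0 := by exact_mod_cast hn
  set m := numPlus σ with hm
  set P := pPlus β ((2 * m - n) / n + 1 / n) with hP
  set Q := pPlus β ((2 * m - n) / n - 1 / n) with hQ
  have hterm : ∀ i, plusProb β σ i * F (numPlus (Function.update σ i true)) +
      (1 - plusProb β σ i) * F (numPlus (Function.update σ i false)) =
      (P * F (m + 1) + (1 - P) * F m) +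
      (Q * F m + (1 - Q) * F (m - 1) - (P * F (m + 1) + (1 - P) * F m)) *
        (if σ i = true then 1 else 0) := by
    intro i
    have h1 := numPlus_update σ i true
    have h2 := numPlus_update σ i false
    simp only [← hm] at h1 h2
    cases hi : σ i
    · simp [hi] at h1 h2
      rw [h1, h2, plusProb, mag_eq, ← hm]
      simp only [spin, hi, Bool.false_eq_true, if_false, neg_div, sub_neg_eq_add]
      rw [← hP]; ring
    · simp [hi] at h1 h2
      rw [h1, show numPlus (Function.update σ i false) = m - 1 by omega, plusProb, mag_eq, ← hm]
      simp only [spin, hi, if_true]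
      rw [← hQ]; ring
  rw [glauberOp, Finset.sum_congr rfl fun i _ => hterm i, Finset.sum_add_distrib, ← Finset.mul_sum,
    Finset.sum_boole, layerStep, birth, death, ← hP, ← hQ]
  have : ((Finset.univ.filter fun i => σ i = true).card : ℝ) = m := rfl
  rw [this]
  simp only [Finset.sum_const, Finset.card_univ, Fintype.card_fin, nsmul_eq_mul]
  field_simp
  ring

theorem glauberOp_iterate_numPlus (β : ℝ) {n : ℕ} (hn : n ≠ 0) (F : ℕ → ℝ) (t : ℕ) :
    (glauberOp β n)^[t] (fun τ => F (numPlus τ)) = fun σ => (layerStep β n)^[t] F (numPlus σ) := by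
  induction t with
  | zero => rfl
  | succ t ih =>
    rw [Function.iterate_succ_apply', ih]
    ext σ
    rw [glauberOp_numPlus β hn, Function.iterate_succ_apply']

theorem exists_perm_of_numPlus_eq {n : ℕ} {σ τ : Config n} (h : numPlus σ = numPlus τ) :
    ∃ ρ : Equiv.Perm (Fin n), σ ∘ ρ = τ := by
  have hc : Fintype.card {i // τ i = true} = Fintype.card {i // σ i = true} := by
    rw [Fintype.card_subtype, Fintype.card_subtype]; exact h.symm
  let e := Fintype.equivOfCardEq hc
  refine ⟨e.extendSubtype, ?_⟩
  ext i
  by_cases hi : τ i = true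
  · simp only [Function.comp, hi]; exact e.extendSubtype_mem i hi
  · have := e.extendSubtype_not_mem i hi
    simp only [Function.comp]
    rw [Bool.eq_false_of_not_eq_true this, Bool.eq_false_of_not_eq_true hi]

theorem exists_eq_numPlus {n : ℕ} {h : Config n → ℝ}
    (hperm : ∀ σ (ρ : Equiv.Perm (Fin n)), h (σ ∘ ρ) = h σ) (heven : ∀ σ, h (negConfig σ) = h σ)
    (hb : ∀ σ, |h σ| ≤ 1) : ∃ F : ℕ → ℝ, (∀ σ, h σ = F (numPlus σ)) ∧
      (∀ k ≤ n, F (n - k) = F k) ∧ ∀ k, |F k| ≤ 1 := by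
  classical
  let F : ℕ → ℝ := fun k => if hk : ∃ σ : Config n, numPlus σ = k then h hk.choose else 0
  have hF : ∀ σ, h σ = F (numPlus σ) := fun σ => by
    have hk : ∃ τ : Config n, numPlus τ = numPlus σ := ⟨σ, rfl⟩
    simp only [F, dif_pos hk]
    obtain ⟨ρ, hρ⟩ := exists_perm_of_numPlus_eq hk.choose_spec
    rw [← hperm hk.choose ρ, hρ]
  refine ⟨F, hF, fun k hk => ?_, fun k => ?_⟩
  · by_cases hex : ∃ σ : Config n, numPlus σ = k
    · obtain ⟨σ, rfl⟩ := hex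
      rw [← numPlus_negConfig, ← hF, ← hF, heven]
    · have hex' : ¬ ∃ σ : Config n, numPlus σ = n - k := fun ⟨σ, hσ⟩ => hex ⟨negConfig σ, by
        rw [numPlus_negConfig, hσ, Nat.sub_sub_self hk]⟩
      simp only [F, dif_neg hex, dif_neg hex']
  · simp only [F]
    split_ifs with hk
    · exact hb _
    · simp

theorem sum_pairs_eq {n : ℕ} (s : Fin n → ℝ) :
    2 * ∑ i, ∑ j, (if i < j then s i * s j else 0) = (∑ i, s i) ^ 2 - ∑ i, s i ^ 2 := by
  have h1 : (∑ i, s i) ^ 2 = ∑ i, ∑ j, s i * s j := by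
    rw [sq, Finset.sum_mul_sum]
  have h2 : ∑ i, s i ^ 2 = ∑ i, ∑ j, (if i = j then s i * s j else 0) := by
    refine Finset.sum_congr rfl fun i _ => ?_
    rw [Finset.sum_ite_eq]; simp [sq]
  have h3 : ∑ i, ∑ j, (if i < j then s i * s j else 0) =
      ∑ i, ∑ j, (if j < i then s i * s j else 0) := by
    rw [Finset.sum_comm]
    simp only [mul_comm]
  rw [two_mul]
  nth_rw 2 [h3]
  rw [h1, h2, ← Finset.sum_add_distrib, ← Finset.sum_sub_distrib]
  refine Finset.sum_congr rfl fun i _ => ?_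
  rw [← Finset.sum_add_distrib, ← Finset.sum_sub_distrib]
  refine Finset.sum_congr rfl fun j _ => ?_
  rcases lt_trichotomy i j with h | h | h
  · simp [h, h.not_gt, h.ne]
  · simp [h]
  · simp [h, h.not_gt, h.ne']

theorem cwExponent_eq {n : ℕ} (β : ℝ) (σ : Config n) :
    cwExponent β σ = β / n * (((∑ i, spin σ i) ^ 2 - n) / 2) := by
  have h := sum_pairs_eq (spin σ)
  simp only [spin_sq] at h
  simp only [Finset.sum_const, Finset.card_univ, Fintype.card_fin, nsmul_eq_mul, mul_one] at h
  rw [cwExponent]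
  congr 1
  linarith

theorem cwExponent_comp {n : ℕ} (β : ℝ) (σ : Config n) (ρ : Equiv.Perm (Fin n)) :
    cwExponent β (σ ∘ ρ) = cwExponent β σ := by
  simp only [cwExponent_eq, spin_comp, Equiv.sum_comp ρ fun i => spin σ i]

theorem cwMeasure_comp {n : ℕ} (β : ℝ) (σ : Config n) (ρ : Equiv.Perm (Fin n)) :
    cwMeasure β n (σ ∘ ρ) = cwMeasure β n σ := by
  simp only [cwMeasure, cwExponent_comp]

theorem partition_pos (β : ℝ) (n : ℕ) : 0 < ∑ η : Config n, Real.exp (cwExponent β η) :=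
  Finset.sum_pos (fun _ _ => Real.exp_pos _) Finset.univ_nonempty

theorem cwMeasure_pos (β : ℝ) (n : ℕ) (σ : Config n) : 0 < cwMeasure β n σ :=
  div_pos (Real.exp_pos _) (partition_pos β n)

theorem sum_cwMeasure (β : ℝ) (n : ℕ) : ∑ σ, cwMeasure β n σ = 1 := by
  simp only [cwMeasure]
  rw [← Finset.sum_div, div_self (partition_pos β n).ne']

theorem exp_neg_mul_tanh (x : ℝ) :
    Real.exp (-x) * ((1 + Real.tanh x) / 2) = Real.exp x * (1 - (1 + Real.tanh x) / 2) := by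
  have h : Real.cosh x ≠ 0 := (Real.cosh_pos x).ne'
  rw [Real.tanh_eq_sinh_div_cosh]
  have h1 := Real.cosh_add_sinh x
  have h2 := Real.cosh_sub_sinh x
  field_simp
  rw [← h1, ← h2]; ring

theorem detailed_balance (β : ℝ) {n : ℕ} (σ : Config n) (k : Fin n) :
    cwMeasure β n (Function.update σ k false) * plusProb β σ k =
      cwMeasure β n (Function.update σ k true) * (1 - plusProb β σ k) := by
  have hn : (n : ℝ) ≠ 0 := by
    have := k.pos
    exact_mod_cast this.ne'
  set M := ∑ j, spin σ j - spin σ k with hM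
  have hp : plusProb β σ k = (1 + Real.tanh (β * (M / n))) / 2 := by
    rw [plusProb, pPlus, mag, hM]; congr 4; ring
  have hf : cwExponent β (Function.update σ k false) =
      β / n * ((M ^ 2 + 1 - n) / 2) + -(β * (M / n)) := by
    rw [cwExponent_eq, sum_spin_update, ← hM]; simp only [Bool.false_eq_true, if_false]
    field_simp; ring
  have ht : cwExponent β (Function.update σ k true) =
      β / n * ((M ^ 2 + 1 - n) / 2) + β * (M / n) := by
    rw [cwExponent_eq, sum_spin_update, ← hM]; simp only [if_true]
    field_simp; ring
  have h := exp_neg_mul_tanh (β * (M / n))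
  simp only [cwMeasure, hf, ht, hp, Real.exp_add]
  linear_combination (Real.exp (β / n * ((M ^ 2 + 1 - n) / 2)) / ∑ η : Config n, Real.exp (cwExponent β η)) * h

theorem sum_flip {n : ℕ} (k : Fin n) (g : Config n → ℝ) :
    ∑ σ, g (Function.update σ k (!(σ k))) = ∑ σ, g σ := by
  have h : ∀ σ : Config n, Function.update (Function.update σ k (!(σ k))) k
      (!(Function.update σ k (!(σ k)) k)) = σ := fun σ => by simp
  exact Fintype.sum_equiv (Function.Involutive.toPerm
    (fun σ : Config n => Function.update σ k (!(σ k))) h) _ _ fun _ => rfl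

theorem two_mul_sum_eq_sum_update {n : ℕ} (k : Fin n) (g : Config n → ℝ) :
    2 * ∑ σ, g σ = ∑ σ, (g (Function.update σ k true) + g (Function.update σ k false)) := by
  rw [two_mul]
  nth_rw 2 [← sum_flip k g]
  rw [← Finset.sum_add_distrib]
  refine Finset.sum_congr rfl fun σ _ => ?_
  have h := Function.update_eq_self k σ
  cases hk : σ k <;> rw [hk] at h
  · rw [h, add_comm]; rfl
  · rw [h]; rfl

theorem sum_cwMeasure_mul_glauberOp (β : ℝ) {n : ℕ} (hn : n ≠ 0) (h : Config n → ℝ) :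
    ∑ σ, cwMeasure β n σ * glauberOp β n h σ = ∑ σ, cwMeasure β n σ * h σ := by
  have hn0 : (n : ℝ) ≠ 0 := by exact_mod_cast hn
  have hsite : ∀ k, ∑ σ, cwMeasure β n σ * (plusProb β σ k * h (Function.update σ k true) +
      (1 - plusProb β σ k) * h (Function.update σ k false)) = ∑ σ, cwMeasure β n σ * h σ := by
    intro k
    have hpu : ∀ (σ : Config n) b, plusProb β (Function.update σ k b) k = plusProb β σ k := by
      intro σ b
      simp only [plusProb, mag, sum_spin_update]
      congr 1
      simp only [spin, Function.update_self]
      ring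
    refine mul_left_cancel₀ (two_ne_zero (α := ℝ)) ?_
    rw [two_mul_sum_eq_sum_update k, two_mul_sum_eq_sum_update k]
    refine Finset.sum_congr rfl fun σ _ => ?_
    simp only [hpu, Function.update_idem]
    have := detailed_balance β σ k
    linear_combination (h (Function.update σ k true) - h (Function.update σ k false)) * this
  simp only [glauberOp]
  have : ∀ σ : Config n, cwMeasure β n σ * (1 / (n : ℝ) * ∑ k,
      (plusProb β σ k * h (Function.update σ k true) +
      (1 - plusProb β σ k) * h (Function.update σ k false))) =
      1 / n * ∑ k, cwMeasure β n σ * (plusProb β σ k * h (Function.update σ k true) +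
      (1 - plusProb β σ k) * h (Function.update σ k false)) := fun σ => by
    rw [← Finset.mul_sum]; ring
  rw [Finset.sum_congr rfl fun σ _ => this σ, ← Finset.mul_sum, Finset.sum_comm,
    Finset.sum_congr rfl fun k _ => hsite k]
  simp only [Finset.sum_const, Finset.card_univ, Fintype.card_fin, nsmul_eq_mul]
  field_simp

theorem sum_cwMeasure_mul_glauberOp_iterate (β : ℝ) {n : ℕ} (hn : n ≠ 0) (t : ℕ)
    (h : Config n → ℝ) :
    ∑ σ, cwMeasure β n σ * (glauberOp β n)^[t] h σ = ∑ σ, cwMeasure β n σ * h σ := by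
  induction t with
  | zero => rfl
  | succ t ih => rw [Function.iterate_succ_apply', sum_cwMeasure_mul_glauberOp β hn, ih]

theorem sum_muPlus_mul (β : ℝ) (n : ℕ) (f : Config n → ℝ) :
    ∑ η, muPlus β n η * f η = ∑ σ, cwMeasure β n σ * f (fold σ) := by
  simp only [muPlus, Finset.sum_mul]
  rw [Finset.sum_comm]
  refine Finset.sum_congr rfl fun σ _ => ?_
  simp only [ite_mul, zero_mul]
  rw [Finset.sum_ite_eq]
  simp [fold]

theorem sum_cwMeasure_mul_symm (β : ℝ) (n : ℕ) (f : Config n → ℝ) :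
    ∑ σ, cwMeasure β n σ * symm f σ = ∑ σ, cwMeasure β n σ * f σ := by
  have h1 : ∀ σ : Config n, cwMeasure β n σ * symm f σ = 1 / (n.factorial : ℝ) *
      ∑ ρ : Equiv.Perm (Fin n), cwMeasure β n (σ ∘ ρ) * f (σ ∘ ρ) := fun σ => by
    simp only [cwMeasure_comp, symm, ← Finset.mul_sum]; ring
  have h2 : ∀ ρ : Equiv.Perm (Fin n), ∑ σ : Config n, cwMeasure β n (σ ∘ ρ) * f (σ ∘ ρ) =
      (∑ σ, cwMeasure β n σ * f σ) * 1 := fun ρ => by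
    rw [mul_one]
    exact Fintype.sum_equiv (Equiv.arrowCongr ρ.symm (Equiv.refl Bool)) _ _ fun σ => rfl
  rw [Finset.sum_congr rfl fun σ _ => h1 σ, ← Finset.mul_sum, Finset.sum_comm,
    Finset.sum_congr rfl fun ρ _ => h2 ρ, ← Finset.mul_sum]
  linear_combination (∑ σ, cwMeasure β n σ * f σ) * sum_perm_one n

theorem fold_of_mag_nonneg {n : ℕ} {σ : Config n} (h : 0 ≤ mag σ) : fold σ = σ := if_pos h

theorem mag_fold_nonneg {n : ℕ} (σ : Config n) : 0 ≤ mag (fold σ) := by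
  unfold fold
  split_ifs with h
  · exact h
  · rw [mag_negConfig]; linarith

theorem symm_fold_negConfig {n : ℕ} (hn : n ≠ 0) (f : Config n → ℝ) (σ : Config n) :
    symm f (fold (negConfig σ)) = symm f (fold σ) := by
  rcases lt_trichotomy (mag σ) 0 with h | h | h
  · rw [fold_of_mag_nonneg (by rw [mag_negConfig]; linarith), fold, if_neg h.not_ge]
  · rw [fold_of_mag_nonneg (by rw [mag_negConfig, h, neg_zero]), fold_of_mag_nonneg h.ge]
    have h2 : (2 * numPlus σ : ℝ) = n := by
      rw [mag_eq, div_eq_zero_iff] at h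
      rcases h with h | h
      · linarith
      · exact absurd (by exact_mod_cast h) hn
    have h3 : 2 * numPlus σ = n := by exact_mod_cast h2
    obtain ⟨ρ, hρ⟩ := exists_perm_of_numPlus_eq (σ := σ) (τ := negConfig σ)
      (by rw [numPlus_negConfig]; omega)
    rw [← hρ, symm_comp]
  · rw [fold_of_mag_nonneg h.le, fold, if_neg (by rw [mag_negConfig]; linarith),
      negConfig_negConfig]

theorem restrictedOp_iterate_eq (β : ℝ) {n : ℕ} {f : Config n → ℝ}
    (hf : ∀ σ, f (fold (negConfig σ)) = f (fold σ)) (t : ℕ) {σ : Config n} (hσ : 0 ≤ mag σ) :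
    (restrictedOp β n)^[t] f σ = (glauberOp β n)^[t] (fun τ => f (fold τ)) σ := by
  cases t with
  | zero => simp [fold_of_mag_nonneg hσ]
  | succ t =>
    have h : restrictedOp β n f = restrictedOp β n fun τ => f (fold τ) := by
      simp only [restrictedOp, fold_of_mag_nonneg (mag_fold_nonneg _)]
    rw [← restrictedOp_iterate_of_even β (f := fun τ => f (fold τ)) hf,
      Function.iterate_succ_apply, Function.iterate_succ_apply, h]

theorem sum_muPlus_mul_eq (β : ℝ) {n : ℕ} (hn : n ≠ 0) (f : Config n → ℝ) (t : ℕ) :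
    ∑ η, muPlus β n η * f η =
      ∑ σ, cwMeasure β n σ * (glauberOp β n)^[t] (fun τ => symm f (fold τ)) σ := by
  rw [sum_cwMeasure_mul_glauberOp_iterate β hn, sum_muPlus_mul,
    ← sum_cwMeasure_mul_symm β n fun σ => f (fold σ)]
  simp only [symm, fold_comp]

/-- If the symmetrized observable has flattened, then the restricted chain is close to
equilibrium. -/
theorem abs_restrictedOp_iterate_sub_le {β : ℝ} (hβ : 0 ≤ β) {n : ℕ} (hn : n ≠ 0)
    {f : Config n → ℝ} (hf : ∀ σ, |f σ| ≤ 1) {t : ℕ} {D : ℝ}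
    (hD : ∀ σ τ : Config n, 0 ≤ mag σ → 0 ≤ mag τ → |(restrictedOp β n)^[t] (symm f) σ -
      (restrictedOp β n)^[t] (symm f) τ| ≤ D) {σ : Config n} (hσ : 0 ≤ mag σ) :
    |(restrictedOp β n)^[t] f σ - ∑ η, muPlus β n η * f η| ≤ n * ((1 - 1 / n) ^ t * 2) + D := by
  have heven := symm_fold_negConfig hn f
  have h1 := abs_restrictedOp_iterate_sub_symm_le hβ hf hn t σ
  have h2 : |(restrictedOp β n)^[t] (symm f) σ - ∑ η, muPlus β n η * f η| ≤ D := by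
    rw [sum_muPlus_mul_eq β hn f t]
    set g := (glauberOp β n)^[t] (fun τ => symm f (fold τ)) with hg
    have hgD : ∀ τ, |(restrictedOp β n)^[t] (symm f) σ - g τ| ≤ D := fun τ => by
      have h3 := fold_eq_of_even (f := g)
        (glauberOp_iterate_even β (f := fun τ => symm f (fold τ)) heven t) τ
      rw [← h3, hg, ← restrictedOp_iterate_eq β heven t (mag_fold_nonneg τ)]
      exact hD σ _ hσ (mag_fold_nonneg τ)
    have h4 : (restrictedOp β n)^[t] (symm f) σ - ∑ τ, cwMeasure β n τ * g τ =
        ∑ τ, cwMeasure β n τ * ((restrictedOp β n)^[t] (symm f) σ - g τ) := by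
      simp only [mul_sub, Finset.sum_sub_distrib, ← Finset.sum_mul, sum_cwMeasure, one_mul]
    rw [h4]
    calc _ ≤ ∑ τ, cwMeasure β n τ * D := by
          refine (Finset.abs_sum_le_sum_abs _ _).trans (Finset.sum_le_sum fun τ _ => ?_)
          rw [abs_mul, abs_of_pos (cwMeasure_pos β n τ)]
          exact mul_le_mul_of_nonneg_left (hgD τ) (cwMeasure_pos β n τ).le
      _ = D := by rw [← Finset.sum_mul, sum_cwMeasure, one_mul]
  exact (abs_sub_le _ _ _).trans (add_le_add h1 h2)

theorem rDist_le_of_forall {β : ℝ} {n t : ℕ} {D : ℝ} (hD0 : 0 ≤ D)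
    (h : ∀ f : Config n → ℝ, (∀ σ, |f σ| ≤ 1) → ∀ σ : Config n, 0 ≤ mag σ →
      |(restrictedOp β n)^[t] f σ - ∑ η, muPlus β n η * f η| ≤ D) : rDist β n t ≤ D / 2 := by
  refine Real.iSup_le (fun σ => ?_) (by positivity)
  let f : Config n → ℝ := fun η => if 0 ≤ rLaw β n t σ.1 η - muPlus β n η then 1 else -1
  have hf : ∀ η, |f η| ≤ 1 := fun η => by simp only [f]; split_ifs <;> simp
  have h1 := h f hf σ.1 σ.2
  rw [← sum_rLaw_mul, ← Finset.sum_sub_distrib] at h1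
  unfold tvDist
  refine div_le_div_of_nonneg_right (le_trans (le_of_eq ?_) ((le_abs_self _).trans h1)) (by norm_num)
  refine Finset.sum_congr rfl fun η _ => ?_
  simp only [f]
  split_ifs with h2
  · rw [abs_of_nonneg h2]; ring
  · rw [abs_of_neg (not_le.1 h2)]; ring

theorem one_sub_div_pow_le {n c : ℝ} (hn : 0 < n) (hc : c ≤ n) (t : ℕ) :
    (1 - c / n) ^ t ≤ Real.exp (-(c * t / n)) := by
  have h1 : (0 : ℝ) ≤ 1 - c / n := by rw [sub_nonneg, div_le_one hn]; exact hc
  have h2 := Real.add_one_le_exp (-(c / n))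
  calc (1 - c / n) ^ t ≤ Real.exp (-(c / n)) ^ t := pow_le_pow_left₀ h1 (by linarith) t
    _ = _ := by rw [← Real.exp_nat_mul]; congr 1; ring

theorem exists_rDist_le {β : ℝ} (hβ : 1 < β) : ∃ (K : ℝ) (n₀ : ℕ), 0 < K ∧ 2 ≤ n₀ ∧ ∀ n, n₀ ≤ n →
    ∀ t : ℕ, K * (n * Real.log n) ≤ t → rDist β n t ≤ 1 / 4 := by
  obtain ⟨A, c, p, n₀, hA, hc, hn₀, hflat⟩ := exists_layer_flattening hβ
  obtain ⟨n₁, hn₁⟩ := exists_nat_ge (4 + 2 * A)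
  set d := min c 1 with hd
  have hd0 : 0 < d := lt_min hc one_pos
  refine ⟨(p + 2) / d, max (max n₀ n₁) 2, by positivity, le_max_right _ _, fun n hn t ht => ?_⟩
  have hnn0 : n₀ ≤ n := (le_max_left _ _).trans ((le_max_left _ _).trans hn)
  have hnn1 : n₁ ≤ n := (le_max_right _ _).trans ((le_max_left _ _).trans hn)
  have hn2 : 2 ≤ n := (le_max_right _ _).trans hn
  have hn0 : n ≠ 0 := by omega
  have hnR : (1 : ℝ) ≤ n := by exact_mod_cast (by omega : 1 ≤ n)
  have hnpos : (0 : ℝ) < n := by linarith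
  have hAn : 4 + 2 * A ≤ n := hn₁.trans (by exact_mod_cast hnn1)
  obtain ⟨hcn, hF⟩ := hflat n hnn0
  have hfac : (0 : ℝ) ≤ 1 - 1 / n := by rw [sub_nonneg, div_le_one hnpos]; exact hnR
  have hfac2 : (0 : ℝ) ≤ 1 - c / n := by rw [sub_nonneg, div_le_one hnpos]; exact hcn
  have key : rDist β n t ≤ (n * ((1 - 1 / n) ^ t * 2) + A * (n : ℝ) ^ p * (1 - c / n) ^ t) / 2 := by
    refine rDist_le_of_forall (by positivity) fun f hf σ hσ => ?_
    refine abs_restrictedOp_iterate_sub_le (by linarith) hn0 hf (fun τ υ hτ hυ => ?_) hσ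
    have heven := symm_fold_negConfig hn0 f
    obtain ⟨F, hF1, hF2, hF3⟩ := exists_eq_numPlus (h := fun σ => symm f (fold σ))
      (fun σ ρ => by rw [fold_comp, symm_comp]) heven (fun σ => abs_symm_le hf _)
    rw [restrictedOp_iterate_eq β heven t hτ, restrictedOp_iterate_eq β heven t hυ, funext hF1,
      glauberOp_iterate_numPlus β hn0]
    exact hF F hF2 (fun k _ => hF3 k) t _ _ (numPlus_le _) (numPlus_le _)
  refine key.trans ?_
  have hexp : ∀ a, d ≤ a → a ≤ n → (1 - a / n) ^ t ≤ 1 / (n : ℝ) ^ (p + 2) := by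
    intro a hda han
    refine (one_sub_div_pow_le hnpos han t).trans ?_
    have h1 : Real.exp (-((p + 2) * Real.log n)) = 1 / (n : ℝ) ^ (p + 2) := by
      rw [Real.exp_neg, one_div]
      congr 1
      have : ((p : ℝ) + 2) = ((p + 2 : ℕ) : ℝ) := by push_cast; ring
      rw [this, Real.exp_nat_mul, Real.exp_log hnpos]
    rw [← h1]
    refine Real.exp_le_exp.2 (neg_le_neg ?_)
    rw [le_div_iff₀ hnpos]
    have h2 : (p + 2) * Real.log n * n = d * ((p + 2) / d * (n * Real.log n)) := by field_simp
    rw [h2]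
    exact (mul_le_mul_of_nonneg_left ht hd0.le).trans
      (mul_le_mul_of_nonneg_right hda (Nat.cast_nonneg t))
  have e1 := hexp 1 (min_le_right _ _) hnR
  have e2 := hexp c (min_le_left _ _) hcn
  have e3 : (n : ℝ) * (1 / (n : ℝ) ^ (p + 2)) ≤ 1 / n := by
    rw [mul_one_div, div_le_div_iff₀ (by positivity) hnpos]
    have : (n : ℝ) ^ 2 ≤ (n : ℝ) ^ (p + 2) := pow_le_pow_right₀ hnR (by omega)
    linarith only [this, sq (n : ℝ)]
  have e4 : (n : ℝ) ^ p * (1 / (n : ℝ) ^ (p + 2)) ≤ 1 / n := by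
    rw [mul_one_div, div_le_div_iff₀ (by positivity) hnpos, one_mul, ← pow_succ]
    exact pow_le_pow_right₀ hnR (by omega)
  have e5 := mul_le_mul_of_nonneg_left e1 hnpos.le
  have e6 := mul_le_mul_of_nonneg_left e2 (by positivity : 0 ≤ (n : ℝ) ^ p)
  have e7 := mul_le_mul_of_nonneg_left (e6.trans e4) hA.le
  have e8 : (2 + A) * (1 / n) ≤ 1 / 2 := by
    rw [mul_one_div, div_le_div_iff₀ hnpos (by norm_num)]; linarith only [hAn]
  have e9 := e5.trans e3
  linarith only [e7, e8, e9]

theorem mag_le_mag_update_true {n : ℕ} (σ : Config n) (i : Fin n) :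
    mag σ ≤ mag (Function.update σ i true) := by
  simp only [mag]
  refine div_le_div_of_nonneg_right ?_ (Nat.cast_nonneg n)
  rw [sum_spin_update]
  have := (abs_le.1 (abs_spin σ i).le).2
  simp only [if_true]; linarith

/-- A single refresh to `+` at a prescribed site has probability bounded below on `Ω⁺`. -/
theorem le_restrictedOp {β : ℝ} (hβ : 0 ≤ β) {n : ℕ} {f : Config n → ℝ}
    (hf : ∀ σ : Config n, 0 ≤ mag σ → 0 ≤ f σ) {σ : Config n} (hσ : 0 ≤ mag σ) (i : Fin n) :
    pPlus β (-1) / n * f (Function.update σ i true) ≤ restrictedOp β n f σ := by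
  have hn : (1 : ℝ) ≤ n := by
    have := i.pos
    exact_mod_cast this
  have hfold : ∀ τ : Config n, 0 ≤ f (fold τ) := fun τ => hf _ (mag_fold_nonneg τ)
  have hup : 0 ≤ mag (Function.update σ i true) := hσ.trans (mag_le_mag_update_true σ i)
  rw [restrictedOp, glauberOp, div_mul_eq_mul_div, div_eq_inv_mul, ← one_div]
  refine mul_le_mul_of_nonneg_left ?_ (by positivity)
  have hterm : ∀ k ∈ Finset.univ, 0 ≤ plusProb β σ k * f (fold (Function.update σ k true)) +
      (1 - plusProb β σ k) * f (fold (Function.update σ k false)) := fun k _ =>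
    add_nonneg (mul_nonneg (plusProb_nonneg β σ k) (hfold _))
      (mul_nonneg (sub_nonneg.2 (plusProb_le_one β σ k)) (hfold _))
  refine le_trans ?_ (Finset.single_le_sum hterm (Finset.mem_univ i))
  refine le_trans ?_ (le_add_of_nonneg_right
    (mul_nonneg (sub_nonneg.2 (plusProb_le_one β σ i)) (hfold _)))
  rw [fold_of_mag_nonneg hup]
  refine mul_le_mul_of_nonneg_right (pPlus_mono hβ ?_) (hf _ hup)
  have h1 : spin σ i / n ≤ 1 := by
    rw [div_le_one (by linarith)]
    exact (abs_le.1 (abs_spin σ i).le).2.trans hn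
  linarith

theorem restrictedOp_iterate_nonneg (β : ℝ) {n : ℕ} {f : Config n → ℝ}
    (hf : ∀ σ : Config n, 0 ≤ mag σ → 0 ≤ f σ) (m : ℕ) :
    ∀ σ : Config n, 0 ≤ mag σ → 0 ≤ (restrictedOp β n)^[m] f σ := by
  induction m with
  | zero => exact hf
  | succ m ih =>
    intro σ _
    rw [Function.iterate_succ_apply', restrictedOp, glauberOp]
    refine mul_nonneg (by positivity) (Finset.sum_nonneg fun k _ => ?_)
    exact add_nonneg (mul_nonneg (plusProb_nonneg β σ k) (ih _ (mag_fold_nonneg _)))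
      (mul_nonneg (sub_nonneg.2 (plusProb_le_one β σ k)) (ih _ (mag_fold_nonneg _)))

theorem le_restrictedOp_iterate {β : ℝ} (hβ : 0 ≤ β) {n : ℕ} (hn : n ≠ 0) {f : Config n → ℝ}
    (hf : ∀ σ : Config n, 0 ≤ mag σ → 0 ≤ f σ) (m : ℕ) :
    ∀ σ : Config n, 0 ≤ mag σ → n ≤ numPlus σ + m →
      (pPlus β (-1) / n) ^ m * f (fun _ => true) ≤ (restrictedOp β n)^[m] f σ := by
  induction m with
  | zero =>
    intro σ _ h
    have h1 : numPlus σ = numPlus (fun _ : Fin n => true) := by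
      have h2 := numPlus_le σ
      have h3 : numPlus (fun _ : Fin n => true) = n := by simp [numPlus]
      omega
    obtain ⟨ρ, hρ⟩ := exists_perm_of_numPlus_eq h1.symm
    have h4 : σ = fun _ => true := by rw [← hρ]; rfl
    simp [h4]
  | succ m ih =>
    intro σ hσ h
    obtain ⟨i, hi⟩ : ∃ i, n ≤ numPlus (Function.update σ i true) + m := by
      by_cases hex : ∃ i, σ i = false
      · obtain ⟨i, hi⟩ := hex
        refine ⟨i, ?_⟩
        have := numPlus_update σ i true
        simp [hi] at this
        omega
      · push Not at hex
        refine ⟨⟨0, Nat.pos_of_ne_zero hn⟩, ?_⟩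
        have : numPlus (Function.update σ ⟨0, Nat.pos_of_ne_zero hn⟩ true) = n := by
          have h1 : ∀ j, Function.update σ ⟨0, Nat.pos_of_ne_zero hn⟩ true j = true := fun j => by
            rw [Function.update_apply]
            split_ifs
            · rfl
            · simpa using hex j
          simp [numPlus, h1]
        omega
    have hup : 0 ≤ mag (Function.update σ i true) := hσ.trans (mag_le_mag_update_true σ i)
    have h1 := ih _ hup hi
    have h2 := le_restrictedOp hβ (restrictedOp_iterate_nonneg β hf m) hσ i
    rw [Function.iterate_succ_apply']
    refine le_trans ?_ h2
    rw [pow_succ', mul_assoc]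
    exact mul_le_mul_of_nonneg_left h1 (div_nonneg (pPlus_pos _ _).le (Nat.cast_nonneg n))

theorem restrictedOp_iterate_affine (β : ℝ) {n : ℕ} (hn : n ≠ 0) (a b : ℝ) (f : Config n → ℝ)
    (m : ℕ) : (restrictedOp β n)^[m] (fun τ => a * f τ + b) =
      fun σ => a * (restrictedOp β n)^[m] f σ + b := by
  induction m with
  | zero => rfl
  | succ m ih =>
    rw [Function.iterate_succ_apply', ih]
    ext σ
    rw [Function.iterate_succ_apply', restrictedOp,
      glauberOp_add β (fun τ => a * (restrictedOp β n)^[m] f (fold τ)) (fun _ => b),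
      glauberOp_const_mul, glauberOp_const β hn]
    rfl

theorem exists_bounds_restrictedOp_iterate {β : ℝ} (hβ : 0 ≤ β) {n : ℕ} (hn : n ≠ 0)
    {f : Config n → ℝ} (hf : ∀ σ, |f σ| ≤ 1) (m : ℕ) :
    ∃ a b : ℝ, b - a = (1 - (pPlus β (-1) / n) ^ n) ^ m * 2 ∧ ∀ σ : Config n, 0 ≤ mag σ →
      a ≤ (restrictedOp β n)^[m * n] f σ ∧ (restrictedOp β n)^[m * n] f σ ≤ b := by
  induction m with
  | zero =>
    refine ⟨-1, 1, by norm_num, fun σ _ => ?_⟩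
    simpa using abs_le.1 (hf σ)
  | succ m ih =>
    obtain ⟨a, b, hab, hm⟩ := ih
    set δ := (pPlus β (-1) / n) ^ n with hδ
    set g := (restrictedOp β n)^[m * n] f with hg
    set x := g fun _ => true with hx
    refine ⟨a + δ * (x - a), b - δ * (b - x), ?_, fun σ hσ => ?_⟩
    · rw [pow_succ]; linear_combination (1 - δ) * hab
    · have hit : (restrictedOp β n)^[(m + 1) * n] f = (restrictedOp β n)^[n] g := by
        rw [add_mul, one_mul, add_comm, Function.iterate_add_apply]
      have h1 := le_restrictedOp_iterate hβ hn (f := fun τ => 1 * g τ + (-a))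
        (fun τ hτ => by linarith [(hm τ hτ).1]) n σ hσ (by omega)
      have h2 := le_restrictedOp_iterate hβ hn (f := fun τ => (-1) * g τ + b)
        (fun τ hτ => by linarith [(hm τ hτ).2]) n σ hσ (by omega)
      rw [restrictedOp_iterate_affine β hn] at h1 h2
      simp only [← hδ, ← hx] at h1 h2
      rw [hit]
      constructor <;> linarith only [h1, h2]

theorem exists_rDist_le_quarter {β : ℝ} (hβ : 0 ≤ β) {n : ℕ} (hn : n ≠ 0) :
    ∃ t, rDist β n t ≤ 1 / 4 := by
  have hnR : (1 : ℝ) ≤ n := by exact_mod_cast Nat.one_le_iff_ne_zero.2 hn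
  have hnpos : (0 : ℝ) < n := by linarith
  set δ := (pPlus β (-1) / n) ^ n with hδ
  have hδ0 : 0 < δ := pow_pos (div_pos (pPlus_pos _ _) hnpos) _
  have hδ1 : δ ≤ 1 := pow_le_one₀ (div_nonneg (pPlus_pos _ _).le hnpos.le)
    ((div_le_one hnpos).2 ((pPlus_lt_one _ _).le.trans hnR))
  have hfac : (0 : ℝ) ≤ 1 - 1 / n := by rw [sub_nonneg, div_le_one hnpos]; exact hnR
  have hq : (1 - 1 / (n : ℝ)) ^ n < 1 :=
    pow_lt_one₀ hfac (by linarith [one_div_pos.2 hnpos]) hn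
  have hlim : Tendsto (fun m : ℕ => (n * (((1 - 1 / (n : ℝ)) ^ n) ^ m * 2) + (1 - δ) ^ m * 2) / 2)
      atTop (nhds ((n * (0 * 2) + 0 * 2) / 2)) :=
    (((tendsto_pow_atTop_nhds_zero_of_lt_one (by positivity) hq).mul_const 2).const_mul _ |>.add
      ((tendsto_pow_atTop_nhds_zero_of_lt_one (by linarith) (by linarith)).mul_const 2)).div_const 2
  rw [show (n * (0 * 2) + 0 * 2) / 2 = (0 : ℝ) by ring] at hlim
  obtain ⟨m, hm⟩ := (hlim.eventually (eventually_le_nhds (b := 1 / 4) (by norm_num))).exists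
  refine ⟨m * n, le_trans (rDist_le_of_forall ?_ fun f hf σ hσ => ?_) hm⟩
  · have : (0 : ℝ) ≤ 1 - δ := by linarith
    positivity
  · rw [← pow_mul, mul_comm n m]
    refine abs_restrictedOp_iterate_sub_le hβ hn hf (fun τ υ hτ hυ => ?_) hσ
    obtain ⟨a, b, hab, h⟩ := exists_bounds_restrictedOp_iterate hβ hn (abs_symm_le hf) m
    rw [← hδ] at hab
    rw [← hab, abs_le]
    constructor <;> linarith [h τ hτ, h υ hυ]

theorem tvDist_le_rDist (β : ℝ) {n : ℕ} (t : ℕ) {σ : Config n} (hσ : 0 ≤ mag σ) :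
    tvDist (rLaw β n t σ) (muPlus β n) ≤ rDist β n t :=
  le_ciSup (f := fun σ : {σ : Config n // 0 ≤ mag σ} => tvDist (rLaw β n t σ.1) (muPlus β n))
    (Set.finite_range _).bddAbove ⟨σ, hσ⟩

theorem sum_muPlus_mul_comp (β : ℝ) (n : ℕ) (f : Config n → ℝ) (ρ : Equiv.Perm (Fin n)) :
    ∑ η, muPlus β n η * f (η ∘ ρ) = ∑ η, muPlus β n η * f η := by
  rw [sum_muPlus_mul, sum_muPlus_mul]
  have h : ∀ σ : Config n, cwMeasure β n σ * f (fold σ ∘ ρ) =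
      cwMeasure β n (σ ∘ ρ) * f (fold (σ ∘ ρ)) := fun σ => by rw [fold_comp, cwMeasure_comp]
  rw [Finset.sum_congr rfl fun σ _ => h σ]
  exact Fintype.sum_equiv (Equiv.arrowCongr ρ.symm (Equiv.refl Bool)) _ _ fun σ => rfl

theorem quarter_lt_rDist_zero (β : ℝ) {n : ℕ} (hn : 2 ≤ n) : 1 / 4 < rDist β n 0 := by
  let a : Fin n := ⟨0, by omega⟩
  let b : Fin n := ⟨1, by omega⟩
  have hab : a ≠ b := by simp [a, b]
  let σ : Config n := Function.update (fun _ => true) a false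
  have hσ : 0 ≤ mag σ := by
    rw [mag]
    refine div_nonneg ?_ (Nat.cast_nonneg n)
    have : (2 : ℝ) ≤ n := by exact_mod_cast hn
    rw [sum_spin_update]
    simp [spin]
    linarith
  let f : Config n → ℝ := fun τ => (spin τ b - spin τ a) / 2
  have hf : ∀ τ, |f τ| ≤ 1 := fun τ => by
    have := abs_sub (spin τ b) (spin τ a)
    rw [abs_spin, abs_spin] at this
    simp only [f, abs_div, abs_two]; linarith
  have hfσ : f σ = 1 := by simp [f, σ, spin, hab.symm]
  have hμ : ∑ η, muPlus β n η * f η = 0 := by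
    have h1 := sum_muPlus_mul_comp β n f (Equiv.swap a b)
    have h2 : ∀ η : Config n, muPlus β n η * f (η ∘ Equiv.swap a b) = -(muPlus β n η * f η) :=
      fun η => by simp [f, spin]; ring
    rw [Finset.sum_congr rfl fun η _ => h2 η, Finset.sum_neg_distrib] at h1
    linarith
  have hP : ∑ η, rLaw β n 0 σ η * f η = 1 := by rw [sum_rLaw_mul]; exact hfσ
  refine lt_of_lt_of_le ?_ (tvDist_le_rDist β 0 hσ)
  have h3 : (1 : ℝ) ≤ ∑ η, |rLaw β n 0 σ η - muPlus β n η| := by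
    calc (1 : ℝ) = ∑ η, (rLaw β n 0 σ η - muPlus β n η) * f η := by
          simp only [sub_mul, Finset.sum_sub_distrib, hμ, hP, sub_zero]
      _ ≤ ∑ η, |rLaw β n 0 σ η - muPlus β n η| := by
          refine Finset.sum_le_sum fun η _ => (le_abs_self _).trans ?_
          rw [abs_mul]
          exact mul_le_of_le_one_right (abs_nonneg _) (hf η)
  rw [tvDist]; linarith

theorem exists_balanced_signs (n : ℕ) : ∃ e : Fin n → ℝ, (∀ i, e i = 1 ∨ e i = -1 ∨ e i = 0) ∧
    ∑ i, e i = 0 ∧ (n : ℝ) - 1 ≤ ∑ i, |e i| := by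
  induction n using Nat.twoStepInduction with
  | zero => exact ⟨fun _ => 0, by simp, by simp, by simp⟩
  | one => exact ⟨fun _ => 0, by simp, by simp, by simp⟩
  | more n ih _ =>
    obtain ⟨e, h1, h2, h3⟩ := ih
    refine ⟨Fin.cons 1 (Fin.cons (-1) e), ?_, ?_, ?_⟩
    · intro i
      refine Fin.cases (by simp) (fun j => Fin.cases (by simp) (fun k => ?_) j) i
      simpa using h1 k
    · simp [Fin.sum_univ_succ, h2]
    · simp only [Fin.sum_univ_succ, Fin.cons_zero, Fin.cons_succ, abs_neg, abs_one]
      push_cast; linarith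

/-- A linear statistic of the spins. -/
def linStat {n : ℕ} (e : Fin n → ℝ) (σ : Config n) : ℝ := ∑ i, e i * spin σ i

theorem linStat_update {n : ℕ} (e : Fin n → ℝ) (σ : Config n) (k : Fin n) (b : Bool) :
    linStat e (Function.update σ k b) =
      linStat e σ - e k * spin σ k + e k * (if b then 1 else -1) := by
  rw [linStat, linStat, ← Finset.add_sum_erase _ _ (Finset.mem_univ k),
    ← Finset.add_sum_erase _ (fun i => e i * spin σ i) (Finset.mem_univ k)]
  have : ∑ x ∈ Finset.univ.erase k, e x * spin (Function.update σ k b) x =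
      ∑ x ∈ Finset.univ.erase k, e x * spin σ x := Finset.sum_congr rfl fun x hx => by
    simp [spin, Finset.ne_of_mem_erase hx]
  rw [this]; simp only [spin, Function.update_self]; ring

theorem linStat_negConfig {n : ℕ} (e : Fin n → ℝ) (σ : Config n) :
    linStat e (negConfig σ) = -linStat e σ := by
  simp [linStat, spin_negConfig]

/-- Balanced linear statistics see the mean field only through a small diagonal term. -/
theorem exists_sum_mul_plusProb {β : ℝ} (hβ : 0 ≤ β) {n : ℕ} (e : Fin n → ℝ)
    (he : ∑ i, e i = 0) (σ : Config n) : ∃ B : ℝ, 0 ≤ B ∧ B ≤ β / n ∧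
      ∑ i, e i * (2 * plusProb β σ i - 1) = -B * linStat e σ := by
  set x := Real.tanh (β * (mag σ + 1 / n)) with hx
  set y := Real.tanh (β * (mag σ - 1 / n)) with hy
  have hn : (0 : ℝ) ≤ 1 / n := by positivity
  have hyx : y ≤ x := strictMono_tanh.monotone (mul_le_mul_of_nonneg_left (by linarith) hβ)
  have hxy := abs_tanh_sub_le (β * (mag σ + 1 / n)) (β * (mag σ - 1 / n))
  rw [← hx, ← hy, show β * (mag σ + 1 / n) - β * (mag σ - 1 / n) = 2 * (β / n) by ring,
    abs_of_nonneg (sub_nonneg.2 hyx), abs_of_nonneg (by positivity)] at hxy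
  refine ⟨(x - y) / 2, by linarith, by linarith, ?_⟩
  have h : ∀ i, e i * (2 * plusProb β σ i - 1) =
      (x + y) / 2 * e i - (x - y) / 2 * (e i * spin σ i) := fun i => by
    rw [plusProb, pPlus]
    cases hi : σ i
    · simp only [spin, hi, Bool.false_eq_true, if_false, neg_div, sub_neg_eq_add]
      rw [← hx]; ring
    · simp only [spin, hi, if_true]
      rw [← hy]; ring
  rw [Finset.sum_congr rfl fun i _ => h i, Finset.sum_sub_distrib, ← Finset.mul_sum,
    ← Finset.mul_sum, he, linStat]
  ring

theorem glauberOp_linStat (β : ℝ) {n : ℕ} (hn : n ≠ 0) (e : Fin n → ℝ) (σ : Config n) :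
    glauberOp β n (linStat e) σ = (1 - 1 / n) * linStat e σ +
      1 / n * ∑ i, e i * (2 * plusProb β σ i - 1) := by
  have hn0 : (n : ℝ) ≠ 0 := by exact_mod_cast hn
  have h : ∀ i, plusProb β σ i * linStat e (Function.update σ i true) +
      (1 - plusProb β σ i) * linStat e (Function.update σ i false) =
      linStat e σ - e i * spin σ i + e i * (2 * plusProb β σ i - 1) := fun i => by
    simp only [linStat_update, if_true, Bool.false_eq_true, if_false]; ring
  rw [glauberOp, Finset.sum_congr rfl fun i _ => h i, Finset.sum_add_distrib,
    Finset.sum_sub_distrib]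
  simp only [Finset.sum_const, Finset.card_univ, Fintype.card_fin, nsmul_eq_mul]
  rw [← linStat]
  field_simp

theorem glauberOp_linStat_sq_le {β : ℝ} (hβ : 0 ≤ β) {n : ℕ} (hn : n ≠ 0) {e : Fin n → ℝ}
    (he : ∑ i, e i = 0) (he1 : ∀ i, |e i| ≤ 1) (σ : Config n) :
    glauberOp β n (fun τ => linStat e τ ^ 2) σ ≤ (1 - 2 / n) * linStat e σ ^ 2 + 4 := by
  have hnpos : (0 : ℝ) < n := by exact_mod_cast Nat.pos_of_ne_zero hn
  obtain ⟨B, hB0, -, hB⟩ := exists_sum_mul_plusProb hβ e he σ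
  set Z := linStat e σ with hZ
  have h : ∀ i ∈ Finset.univ, plusProb β σ i * linStat e (Function.update σ i true) ^ 2 +
      (1 - plusProb β σ i) * linStat e (Function.update σ i false) ^ 2 ≤
      Z ^ 2 - 2 * Z * (e i * spin σ i) + 2 * Z * (e i * (2 * plusProb β σ i - 1)) + 4 := by
    intro i _
    simp only [linStat_update, if_true, Bool.false_eq_true, if_false, ← hZ]
    have h1 : e i ^ 2 ≤ 1 := (sq_le_one_iff_abs_le_one _).2 (he1 i)
    have h2 : -1 ≤ spin σ i * (2 * plusProb β σ i - 1) := by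
      refine (abs_le.1 ?_).1
      rw [abs_mul, abs_spin, one_mul, abs_le]
      constructor <;> linarith [plusProb_nonneg β σ i, plusProb_le_one β σ i]
    have h3 : spin σ i ^ 2 = 1 := spin_sq σ i
    have h4 : e i ^ 2 * (2 - 2 * (spin σ i * (2 * plusProb β σ i - 1))) ≤ 4 := by
      calc _ ≤ e i ^ 2 * 4 := mul_le_mul_of_nonneg_left (by linarith) (sq_nonneg _)
        _ ≤ 4 := by linarith
    have h5 : e i ^ 2 * spin σ i ^ 2 = e i ^ 2 := by rw [h3, mul_one]
    linarith only [h4, h5]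
  refine (mul_le_mul_of_nonneg_left (Finset.sum_le_sum h) (by positivity)).trans ?_
  rw [Finset.sum_add_distrib, Finset.sum_add_distrib, Finset.sum_sub_distrib, ← Finset.mul_sum,
    ← Finset.mul_sum, hB]
  simp only [Finset.sum_const, Finset.card_univ, Fintype.card_fin, nsmul_eq_mul]
  rw [← linStat, ← hZ]
  have h6 : 1 / (n : ℝ) * (n * Z ^ 2 - 2 * Z * Z + 2 * Z * (-B * Z) + n * 4) =
      (1 - 2 / n) * Z ^ 2 + 4 - 2 * B * Z ^ 2 / n := by field_simp; ring
  rw [h6]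
  have : 0 ≤ 2 * B * Z ^ 2 / n := by positivity
  linarith

theorem abs_linStat_le {n : ℕ} {e : Fin n → ℝ} (he1 : ∀ i, |e i| ≤ 1) (σ : Config n) :
    |linStat e σ| ≤ n := by
  refine (Finset.abs_sum_le_sum_abs _ _).trans ?_
  calc _ ≤ ∑ _i : Fin n, (1 : ℝ) := Finset.sum_le_sum fun i _ => by
        rw [abs_mul, abs_spin, mul_one]; exact he1 i
    _ = n := by simp

theorem le_glauberOp_linStat {β : ℝ} (hβ : 0 ≤ β) {n : ℕ} (hn : n ≠ 0) {e : Fin n → ℝ}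
    (he : ∑ i, e i = 0) (he1 : ∀ i, |e i| ≤ 1) (σ : Config n) :
    (1 - 1 / n) * linStat e σ - β / n ≤ glauberOp β n (linStat e) σ := by
  have hnpos : (0 : ℝ) < n := by exact_mod_cast Nat.pos_of_ne_zero hn
  obtain ⟨B, hB0, hB1, hB⟩ := exists_sum_mul_plusProb hβ e he σ
  rw [glauberOp_linStat β hn, hB]
  have h1 : B * linStat e σ ≤ β / n * n :=
    (mul_le_mul_of_nonneg_left ((le_abs_self _).trans (abs_linStat_le he1 σ)) hB0).trans
      (mul_le_mul_of_nonneg_right hB1 hnpos.le)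
  rw [div_mul_cancel₀ _ hnpos.ne'] at h1
  have h2 := mul_le_mul_of_nonneg_left h1 (by positivity : (0 : ℝ) ≤ 1 / n)
  rw [div_eq_mul_one_div β]
  linarith

theorem le_glauberOp_iterate_linStat {β : ℝ} (hβ : 0 ≤ β) {n : ℕ} (hn : n ≠ 0) {e : Fin n → ℝ}
    (he : ∑ i, e i = 0) (he1 : ∀ i, |e i| ≤ 1) (t : ℕ) : ∀ σ : Config n,
    (1 - 1 / n) ^ t * linStat e σ - β * (1 - (1 - 1 / n) ^ t) ≤
      (glauberOp β n)^[t] (linStat e) σ := by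
  have hnR : (1 : ℝ) ≤ n := by exact_mod_cast Nat.one_le_iff_ne_zero.2 hn
  have hfac : (0 : ℝ) ≤ 1 - 1 / n := by
    rw [sub_nonneg, div_le_one (by linarith)]; exact hnR
  induction t with
  | zero => simp
  | succ t ih =>
    intro σ
    rw [Function.iterate_succ_apply']
    refine le_trans ?_ (glauberOp_mono β ih σ)
    simp only [sub_eq_add_neg _ (β * _)]
    rw [glauberOp_add β (fun τ => (1 - 1 / (n : ℝ)) ^ t * linStat e τ) (fun _ => _),
      glauberOp_const_mul, glauberOp_const β hn]
    have h := mul_le_mul_of_nonneg_left (le_glauberOp_linStat hβ hn he he1 σ) (pow_nonneg hfac t)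
    have h2 : (1 - 1 / (n : ℝ)) ^ t * (β / n) = β * (1 - 1 / (n : ℝ)) ^ t * (1 / n) := by ring
    rw [pow_succ]
    linarith only [h, h2]

theorem glauberOp_iterate_linStat_sq_le {β : ℝ} (hβ : 0 ≤ β) {n : ℕ} (hn : 2 ≤ n)
    {e : Fin n → ℝ} (he : ∑ i, e i = 0) (he1 : ∀ i, |e i| ≤ 1) (t : ℕ) : ∀ σ : Config n,
    (glauberOp β n)^[t] (fun τ => linStat e τ ^ 2) σ ≤
      (1 - 2 / n) ^ t * linStat e σ ^ 2 + 2 * n * (1 - (1 - 2 / n) ^ t) := by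
  have hnR : (2 : ℝ) ≤ n := by exact_mod_cast hn
  have hn0 : n ≠ 0 := by omega
  have hfac : (0 : ℝ) ≤ 1 - 2 / n := by
    rw [sub_nonneg, div_le_one (by linarith)]; exact hnR
  induction t with
  | zero => simp
  | succ t ih =>
    intro σ
    rw [Function.iterate_succ_apply']
    refine (glauberOp_mono β ih σ).trans ?_
    rw [glauberOp_add β (fun τ => (1 - 2 / (n : ℝ)) ^ t * linStat e τ ^ 2) (fun _ => _),
      glauberOp_const_mul β _ (fun τ => linStat e τ ^ 2), glauberOp_const β hn0]
    have h := mul_le_mul_of_nonneg_left (glauberOp_linStat_sq_le hβ hn0 he he1 σ)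
      (pow_nonneg hfac t)
    have h2 : 2 * (n : ℝ) * ((1 - 2 / (n : ℝ)) ^ t * (2 / n)) = 4 * (1 - 2 / (n : ℝ)) ^ t := by
      have : (n : ℝ) ≠ 0 := by exact_mod_cast hn0
      field_simp; ring
    rw [pow_succ]
    linarith only [h, h2]

theorem sum_cwMeasure_mul_linStat_sq_le {β : ℝ} (hβ : 0 ≤ β) {n : ℕ} (hn : n ≠ 0)
    {e : Fin n → ℝ} (he : ∑ i, e i = 0) (he1 : ∀ i, |e i| ≤ 1) :
    ∑ σ, cwMeasure β n σ * linStat e σ ^ 2 ≤ 2 * n := by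
  have hnpos : (0 : ℝ) < n := by exact_mod_cast Nat.pos_of_ne_zero hn
  have h1 := sum_cwMeasure_mul_glauberOp β hn fun τ => linStat e τ ^ 2
  have h2 : ∑ σ, cwMeasure β n σ * glauberOp β n (fun τ => linStat e τ ^ 2) σ ≤
      ∑ σ, cwMeasure β n σ * ((1 - 2 / n) * linStat e σ ^ 2 + 4) :=
    Finset.sum_le_sum fun σ _ => mul_le_mul_of_nonneg_left
      (glauberOp_linStat_sq_le hβ hn he he1 σ) (cwMeasure_pos β n σ).le
  have h3 : ∑ σ, cwMeasure β n σ * ((1 - 2 / n) * linStat e σ ^ 2 + 4) =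
      (1 - 2 / n) * ∑ σ, cwMeasure β n σ * linStat e σ ^ 2 + 4 := by
    simp only [mul_add, Finset.sum_add_distrib, ← Finset.sum_mul, sum_cwMeasure, Finset.mul_sum]
    rw [one_mul]
    congr 1
    exact Finset.sum_congr rfl fun σ _ => by ring
  rw [h1, h3] at h2
  set E := ∑ σ, cwMeasure β n σ * linStat e σ ^ 2
  have h4 : 2 / n * E ≤ 4 := by linarith
  rw [div_mul_eq_mul_div, div_le_iff₀ hnpos] at h4
  linarith

theorem rLaw_nonneg (β : ℝ) {n : ℕ} (t : ℕ) {σ : Config n} (hσ : 0 ≤ mag σ) (η : Config n) :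
    0 ≤ rLaw β n t σ η := by
  classical
  have h := sum_rLaw_mul β t σ fun τ => if τ = η then 1 else 0
  simp only [mul_ite, mul_one, mul_zero, Finset.sum_ite_eq', Finset.mem_univ, if_true] at h
  rw [h]
  exact restrictedOp_iterate_nonneg β (fun τ _ => by split_ifs <;> norm_num) t σ hσ

theorem muPlus_nonneg (β : ℝ) (n : ℕ) (η : Config n) : 0 ≤ muPlus β n η :=
  Finset.sum_nonneg fun σ _ => by
    split_ifs
    · exact (cwMeasure_pos β n σ).le
    · rfl
    · exact (cwMeasure_pos β n σ).le
    · rfl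

/-- If two laws are at total variation distance at most `1/4`, the first absolute moment of a
statistic under the first one is controlled by second moments. -/
theorem sum_mul_le_of_tvDist_le {Ω : Type*} [Fintype Ω] {P Q : Ω → ℝ} (hP : ∀ x, 0 ≤ P x)
    (hQ : ∀ x, 0 ≤ Q x) (hQ1 : ∑ x, Q x = 1) (htv : tvDist P Q ≤ 1 / 4) (y : Ω → ℝ)
    {L M : ℝ} (hL : 0 < L) (hM : 0 < M) :
    ∑ x, P x * y x ≤ (∑ x, P x * y x ^ 2 + ∑ x, Q x * y x ^ 2) / (2 * L) + L / 4 +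
      ((∑ x, Q x * y x ^ 2) / (2 * M) + M / 2) := by
  have hamgm : ∀ K > 0, ∀ x, |y x| ≤ y x ^ 2 / (2 * K) + K / 2 := fun K hK x => by
    have h1 : y x ^ 2 / (2 * K) + K / 2 - |y x| = (|y x| - K) ^ 2 / (2 * K) := by
      rw [← sq_abs]; field_simp; ring
    have h2 : 0 ≤ (|y x| - K) ^ 2 / (2 * K) := by positivity
    linarith
  have hpt : ∀ x ∈ Finset.univ, P x * y x ≤ (P x * y x ^ 2 + Q x * y x ^ 2) / (2 * L) +
      L / 2 * |P x - Q x| + (Q x * y x ^ 2 / (2 * M) + M / 2 * Q x) := by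
    intro x _
    have h1 : P x * y x ≤ |P x - Q x| * |y x| + Q x * |y x| := by
      have h2 : (P x - Q x) * y x ≤ |P x - Q x| * |y x| := by
        rw [← abs_mul]; exact le_abs_self _
      have h3 := mul_le_mul_of_nonneg_left (le_abs_self (y x)) (hQ x)
      linarith
    have h4 := mul_le_mul_of_nonneg_left (hamgm L hL x) (abs_nonneg (P x - Q x))
    have h5 := mul_le_mul_of_nonneg_left (hamgm M hM x) (hQ x)
    have h6 : |P x - Q x| ≤ P x + Q x := by
      rw [abs_le]; constructor <;> linarith [hP x, hQ x]
    have h7 := mul_le_mul_of_nonneg_right h6 (by positivity : 0 ≤ y x ^ 2 / (2 * L))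
    have h8 : (P x * y x ^ 2 + Q x * y x ^ 2) / (2 * L) = (P x + Q x) * (y x ^ 2 / (2 * L)) := by
      ring
    have h9 : Q x * y x ^ 2 / (2 * M) = Q x * (y x ^ 2 / (2 * M)) := by ring
    rw [h8, h9]
    linarith only [h1, h4, h5, h7]
  refine (Finset.sum_le_sum hpt).trans ?_
  rw [Finset.sum_add_distrib, Finset.sum_add_distrib, Finset.sum_add_distrib, ← Finset.sum_div,
    ← Finset.sum_div, ← Finset.mul_sum, ← Finset.mul_sum, hQ1, Finset.sum_add_distrib]
  rw [tvDist] at htv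
  have : L / 2 * ∑ x, |P x - Q x| ≤ L / 2 * (1 / 2) :=
    mul_le_mul_of_nonneg_left (by linarith) (by positivity)
  linarith only [this]

theorem sum_muPlus (β : ℝ) (n : ℕ) : ∑ η, muPlus β n η = 1 := by
  have := sum_muPlus_mul β n fun _ => 1
  simpa [sum_cwMeasure] using this

theorem sq_le_of_moment_bound {X b N : ℝ} (hX : 0 < X) (hbN : b ^ 2 ≤ N)
    (h : X - b ≤ (X ^ 2 + 2 * N + 2 * N) / (2 * (3 * X / 2)) + 3 * X / 2 / 4 +
      (2 * N / (2 * (X / 10)) + X / 10 / 2)) : X ^ 2 ≤ 120 * N := by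
  have h1 : ((X ^ 2 + 2 * N + 2 * N) / (2 * (3 * X / 2)) + 3 * X / 2 / 4 +
      (2 * N / (2 * (X / 10)) + X / 10 / 2)) * X = 91 / 120 * X ^ 2 + 34 / 3 * N := by
    field_simp; ring
  have h2 := mul_le_mul_of_nonneg_right h hX.le
  rw [h1] at h2
  have h3 : b * X ≤ X ^ 2 / 10 + 5 / 2 * b ^ 2 := by
    have := sq_nonneg (X - 5 * b)
    linarith only [this]
  linarith only [h2, h3, hbN, sq_nonneg b]

theorem sq_le_of_rDist_le {β : ℝ} (hβ : 0 ≤ β) {n : ℕ} (hn : 2 ≤ n) (hβn : β ^ 2 ≤ n) {t : ℕ}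
    (ht : rDist β n t ≤ 1 / 4) : ((1 - 1 / (n : ℝ)) ^ t * (n - 1)) ^ 2 ≤ 120 * n := by
  obtain ⟨e, he, hsum, habs⟩ := exists_balanced_signs n
  have hn0 : n ≠ 0 := by omega
  have hnR : (2 : ℝ) ≤ n := by exact_mod_cast hn
  have hnpos : (0 : ℝ) < n := by linarith
  have he1 : ∀ i, |e i| ≤ 1 := fun i => by
    rcases he i with h | h | h <;> simp [h]
  let σ : Config n := fun i => decide (0 ≤ e i)
  have hstat : linStat e σ = ∑ i, |e i| := Finset.sum_congr rfl fun i _ => by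
    rcases he i with h | h | h <;> simp [spin, σ, h]
  have hmag : 0 ≤ mag σ := by
    refine div_nonneg ?_ hnpos.le
    rw [← hsum]
    refine Finset.sum_le_sum fun i _ => ?_
    rcases he i with h | h | h <;> simp [spin, σ, h]
    norm_num
  have hr : (0 : ℝ) < 1 - 1 / n := by
    rw [sub_pos, div_lt_one hnpos]; linarith
  have hr2 : (0 : ℝ) ≤ 1 - 2 / n := by
    rw [sub_nonneg, div_le_one hnpos]; exact hnR
  set X := (1 - 1 / (n : ℝ)) ^ t * linStat e σ with hX
  have hXle : (1 - 1 / (n : ℝ)) ^ t * (n - 1) ≤ X := by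
    rw [hX, hstat]; exact mul_le_mul_of_nonneg_left habs (by positivity)
  have hX0' : 0 < (1 - 1 / (n : ℝ)) ^ t * (n - 1) := mul_pos (by positivity) (by linarith)
  have hX0 : 0 < X := hX0'.trans_le hXle
  have hpow1 : (1 - 1 / (n : ℝ)) ^ t ≤ 1 :=
    pow_le_one₀ hr.le (by linarith [one_div_pos.2 hnpos])
  -- even statistics
  have heven1 : ∀ τ : Config n, |linStat e (negConfig τ)| = |linStat e τ| := fun τ => by
    rw [linStat_negConfig, abs_neg]
  have heven2 : ∀ τ : Config n, |linStat e (negConfig τ)| ^ 2 = |linStat e τ| ^ 2 := fun τ => by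
    rw [heven1]
  have hmean : X - β ≤ ∑ η, rLaw β n t σ η * |linStat e η| := by
    rw [sum_rLaw_mul β t σ fun η => |linStat e η|,
      restrictedOp_iterate_of_even β (f := fun η => |linStat e η|) heven1]
    have h1 := le_glauberOp_iterate_linStat hβ hn0 hsum he1 t σ
    have h2 : ∀ m : ℕ, ∀ τ, (glauberOp β n)^[m] (linStat e) τ ≤
        (glauberOp β n)^[m] (fun η => |linStat e η|) τ := by
      intro m
      induction m with
      | zero => exact fun τ => le_abs_self _
      | succ m ih =>
        intro τ
        rw [Function.iterate_succ_apply', Function.iterate_succ_apply']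
        exact glauberOp_mono β ih τ
    refine le_trans ?_ (h1.trans (h2 t σ))
    have h3 : 0 ≤ β * (1 - 1 / (n : ℝ)) ^ t := by positivity
    rw [← hX]; linarith only [h3]
  have hsq : ∑ η, rLaw β n t σ η * |linStat e η| ^ 2 ≤ X ^ 2 + 2 * n := by
    rw [sum_rLaw_mul β t σ fun η => |linStat e η| ^ 2,
      restrictedOp_iterate_of_even β (f := fun η => |linStat e η| ^ 2) heven2]
    simp only [sq_abs]
    refine (glauberOp_iterate_linStat_sq_le hβ hn hsum he1 t σ).trans ?_
    have h1 : (1 - 2 / (n : ℝ)) ^ t ≤ ((1 - 1 / (n : ℝ)) ^ 2) ^ t := by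
      refine pow_le_pow_left₀ hr2 ?_ t
      have : 0 ≤ (1 / (n : ℝ)) ^ 2 := by positivity
      have h2 : (2 : ℝ) / n = 2 * (1 / n) := by ring
      rw [h2]; linarith only [this]
    have h3 := mul_le_mul_of_nonneg_right h1 (sq_nonneg (linStat e σ))
    have h4 : ((1 - 1 / (n : ℝ)) ^ 2) ^ t * linStat e σ ^ 2 = X ^ 2 := by
      rw [hX, mul_pow, ← pow_mul, ← pow_mul, mul_comm 2 t]
    have h5 : 0 ≤ 2 * (n : ℝ) * (1 - 2 / (n : ℝ)) ^ t := by positivity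
    linarith only [h3, h4, h5]
  have hμ : ∑ η, muPlus β n η * |linStat e η| ^ 2 ≤ 2 * n := by
    rw [sum_muPlus_mul β n fun η => |linStat e η| ^ 2]
    simp only [fold_eq_of_even (f := fun η => |linStat e η| ^ 2) heven2, sq_abs]
    exact sum_cwMeasure_mul_linStat_sq_le hβ hn0 hsum he1
  have hmain := sum_mul_le_of_tvDist_le (rLaw_nonneg β t hmag) (muPlus_nonneg β n)
    (sum_muPlus β n) ((tvDist_le_rDist β t hmag).trans ht) (fun η => |linStat e η|)
    (L := 3 * X / 2) (M := X / 10) (by positivity) (by positivity)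
  have hfin : X ^ 2 ≤ 120 * n := by
    refine sq_le_of_moment_bound hX0 hβn (hmean.trans (hmain.trans ?_))
    gcongr
  exact (pow_le_pow_left₀ hX0'.le hXle 2).trans hfin

theorem exists_le_of_rDist_le {β : ℝ} (hβ : 0 ≤ β) : ∃ n₀ : ℕ, ∀ n, n₀ ≤ n → ∀ t : ℕ,
    rDist β n t ≤ 1 / 4 → 1 / 8 * (n * Real.log n) ≤ t := by
  obtain ⟨n₁, hn₁⟩ := exists_nat_ge (β ^ 2)
  refine ⟨max n₁ (480 ^ 2), fun n hn t ht => ?_⟩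
  have hn2 : 480 ^ 2 ≤ n := (le_max_right _ _).trans hn
  have hnR : (480 : ℝ) ^ 2 ≤ n := by exact_mod_cast hn2
  have hnpos : (0 : ℝ) < n := by linarith
  have hβn : β ^ 2 ≤ n := hn₁.trans (by exact_mod_cast (le_max_left _ _).trans hn)
  have h := sq_le_of_rDist_le hβ (by omega) hβn ht
  have hx : 1 / (n : ℝ) ≤ 1 / 2 := one_div_le_one_div_of_le (by norm_num) (by linarith)
  have hx0 : 0 < 1 / (n : ℝ) := by positivity
  have hexp : Real.exp (-(2 * (1 / (n : ℝ)))) ≤ 1 - 1 / n := by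
    rw [Real.exp_neg, inv_le_comm₀ (Real.exp_pos _) (by linarith)]
    refine le_trans ?_ (Real.add_one_le_exp _)
    rw [inv_le_iff_one_le_mul₀ (by linarith)]
    nlinarith only [hx, hx0]
  have hpow : Real.exp (-(2 * t / n)) ≤ (1 - 1 / (n : ℝ)) ^ t := by
    refine le_trans (le_of_eq ?_) (pow_le_pow_left₀ (Real.exp_pos _).le hexp t)
    rw [← Real.exp_nat_mul]; congr 1; ring
  have h1 : Real.exp (-(2 * t / n)) * (n / 2) ≤ (1 - 1 / (n : ℝ)) ^ t * (n - 1) :=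
    mul_le_mul hpow (by linarith) (by positivity) ((Real.exp_pos _).le.trans hpow)
  have h2 := (pow_le_pow_left₀ (by positivity) h1 2).trans h
  have h3 : Real.exp (-(4 * t / n)) * n ≤ 480 := by
    have h4 : (Real.exp (-(2 * t / n)) * ((n : ℝ) / 2)) ^ 2 =
        Real.exp (-(4 * t / n)) * n * n / 4 := by
      rw [mul_pow, ← Real.exp_nat_mul]
      rw [show ((2 : ℕ) : ℝ) * -(2 * t / n) = -(4 * t / n) by push_cast; ring]
      ring
    rw [h4, div_le_iff₀ (by norm_num)] at h2
    refine le_of_mul_le_mul_right ?_ hnpos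
    linarith only [h2]
  have h5 : Real.log n - 4 * t / n ≤ Real.log 480 := by
    have h6 := Real.log_le_log (by positivity) h3
    rw [Real.log_mul (Real.exp_pos _).ne' hnpos.ne', Real.log_exp] at h6
    linarith
  have h7 : 2 * Real.log 480 ≤ Real.log n := by
    have := Real.log_le_log (by norm_num) hnR
    rwa [Real.log_pow] at this
  have h8 : Real.log n / 2 ≤ 4 * t / n := by linarith
  rw [le_div_iff₀ hnpos] at h8
  linarith

theorem eq_of_mag_nonneg_of_le_one {n : ℕ} (hn : n ≤ 1) {σ τ : Config n} (hσ : 0 ≤ mag σ)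
    (hτ : 0 ≤ mag τ) : σ = τ := by
  have key : ∀ υ : Config n, 0 ≤ mag υ → ∀ i, υ i = true := by
    intro υ hυ i
    have h1 : n = 1 := by have := i.pos; omega
    subst h1
    by_contra hi
    rw [Subsingleton.elim i 0] at hi
    simp [mag, spin, hi] at hυ
    linarith
  ext i
  rw [key σ hσ, key τ hτ]

theorem rTMix_eq_zero_of_le_one (β : ℝ) {n : ℕ} (hn : n ≤ 1) : rTMix β n = 0 := by
  refine Nat.sInf_eq_zero.2 (Or.inl ?_)
  have h : rDist β n 0 ≤ 0 / 2 := by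
    refine rDist_le_of_forall le_rfl fun f _ σ hσ => ?_
    rw [sum_muPlus_mul]
    simp only [fun τ : Config n => eq_of_mag_nonneg_of_le_one hn (mag_fold_nonneg τ) hσ]
    simp [← Finset.sum_mul, sum_cwMeasure]
  exact h.trans (by norm_num)

theorem rDist_rTMix_le {β : ℝ} (hβ : 0 ≤ β) {n : ℕ} (hn : n ≠ 0) :
    rDist β n (rTMix β n) ≤ 1 / 4 :=
  Nat.sInf_mem (s := {t | rDist β n t ≤ 1 / 4}) (exists_rDist_le_quarter hβ hn)

theorem one_le_rTMix {β : ℝ} (hβ : 0 ≤ β) {n : ℕ} (hn : 2 ≤ n) : 1 ≤ rTMix β n := by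
  by_contra h
  have h1 := rDist_rTMix_le hβ (n := n) (by omega)
  rw [show rTMix β n = 0 by omega] at h1
  exact absurd h1 (not_le.2 (quarter_lt_rDist_zero β hn))

theorem one_le_mul_log {n : ℕ} (hn : 2 ≤ n) : 1 ≤ (n : ℝ) * Real.log n := by
  have h2 : (2 : ℝ) ≤ n := by exact_mod_cast hn
  have h3 := Real.log_le_log (by norm_num) h2
  have h4 := Real.log_two_gt_d9
  nlinarith only [h2, h3, h4]

/-- At low temperature (`β > 1`), the Glauber dynamics restricted to states of
non-negative magnetization mixes in time of order `n log n`: there are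
constants `C₃(β), C₄(β) > 0` with `C₃ n log n ≤ t_mix(n) ≤ C₄ n log n`. -/
theorem cw_lowtemp_mixing (β : ℝ) (hβ : 1 < β) :
    ∃ C₃ > (0 : ℝ), ∃ C₄ > (0 : ℝ), ∀ n : ℕ,
      C₃ * n * Real.log n ≤ (rTMix β n : ℝ) ∧
      (rTMix β n : ℝ) ≤ C₄ * n * Real.log n := by
  have hβ0 : 0 ≤ β := by linarith
  obtain ⟨K, n₀, hK, -, hup⟩ := exists_rDist_le hβ
  obtain ⟨n₁, hlow⟩ := exists_le_of_rDist_le hβ0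
  set N : ℝ := (n₁ : ℝ) * n₁ with hN
  set S : ℝ := ∑ n ∈ Finset.range n₀, (rTMix β n : ℝ) with hS
  have hN0 : 0 ≤ N := by positivity
  have hS0 : 0 ≤ S := Finset.sum_nonneg fun _ _ => Nat.cast_nonneg _
  have hfrac : 0 < 1 / (8 + N) := by positivity
  refine ⟨1 / (8 + N), hfrac, K + 1 + S, by positivity, fun n => ?_⟩
  rw [mul_assoc, mul_assoc]
  rcases Nat.lt_or_ge n 2 with hn | hn
  · rw [rTMix_eq_zero_of_le_one β (by omega)]
    interval_cases n <;> simp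
  have hlog := one_le_mul_log hn
  have hT := rDist_rTMix_le hβ0 (n := n) (by omega)
  constructor
  · rcases Nat.lt_or_ge n n₁ with h | h
    · have h1 : (1 : ℝ) ≤ rTMix β n := by exact_mod_cast one_le_rTMix hβ0 hn
      refine le_trans ?_ h1
      rw [one_div_mul_eq_div, div_le_one (by positivity)]
      have h2 : (n : ℝ) ≤ n₁ := by exact_mod_cast h.le
      have h3 : Real.log n ≤ n := Real.log_le_self (Nat.cast_nonneg n)
      have h4 : (n : ℝ) * Real.log n ≤ n₁ * n₁ :=
        mul_le_mul h2 (h3.trans h2) (Real.log_natCast_nonneg n) (Nat.cast_nonneg _)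
      linarith
    · refine le_trans ?_ (hlow n h _ hT)
      refine mul_le_mul_of_nonneg_right ?_ (by linarith)
      exact one_div_le_one_div_of_le (by norm_num) (by linarith)
  · rcases Nat.lt_or_ge n n₀ with h | h
    · have h1 : (rTMix β n : ℝ) ≤ S :=
        Finset.single_le_sum (f := fun m => (rTMix β m : ℝ)) (fun _ _ => Nat.cast_nonneg _)
          (Finset.mem_range.2 h)
      calc (rTMix β n : ℝ) ≤ (K + 1 + S) * 1 := by linarith
        _ ≤ _ := mul_le_mul_of_nonneg_left hlog (by positivity)
    · have h1 : rTMix β n ≤ ⌈K * (n * Real.log n)⌉₊ :=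
        Nat.sInf_le (hup n h _ (Nat.le_ceil _))
      have h2 : (rTMix β n : ℝ) ≤ ⌈K * (n * Real.log n)⌉₊ := by exact_mod_cast h1
      have h3 := Nat.ceil_lt_add_one (a := K * (n * Real.log n)) (by positivity)
      have h4 : 0 ≤ S * (n * Real.log n) := by positivity
      linarith

end

end CW
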